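/- arXiv:2112.09877 — 8 statements merged into one kernel-verified Lean document; each statement's English description precedes it below -/
import Mathlib

section
/- Let X be a topological space. Then the following are equivalent: (1) X is nowhere scattered, i.e., no closed subset of X contains an isolated point (in the subspace topology); (2) X has no nonempty, scattered, locally closed subset; (3) X has no nonempty, locally closed subset that is a T₁ space in the subspace topology; (4) X has no locally closed subset containing exactly one element. -/
/-- A point `x` is isolated in the subset `C` of a topological space, i.e. `x ∈ C` and
`{x}` is open in the subspace topology of `C`. -/
def IsIsolatedIn {X : Type*} [TopologicalSpace X] (C : Set X) (x : X) : Prop :=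
  x ∈ C ∧ ∃ U : Set X, IsOpen U ∧ U ∩ C = {x}

/-- A topological space is scattered if every nonempty closed subset contains a point that is
isolated relative to that subset. -/
def ScatteredSpace (X : Type*) [TopologicalSpace X] : Prop :=
  ∀ C : Set X, IsClosed C → C.Nonempty → ∃ x, IsIsolatedIn C x

/-- A topological space is nowhere scattered if no closed subset contains an isolated point
(relative to the subspace topology). -/
def NowhereScatteredSpace (X : Type*) [TopologicalSpace X] : Prop :=
  ∀ C : Set X, IsClosed C → ∀ x, ¬ IsIsolatedIn C x

theorem IsIsolatedIn.isLocallyClosed_singleton {X : Type*} [TopologicalSpace X] {C : Set X}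
    {x : X} (h : IsIsolatedIn C x) (hC : IsClosed C) : IsLocallyClosed ({x} : Set X) := by
  obtain ⟨-, U, hU, hUC⟩ := h
  exact ⟨U, C, hU, hC, hUC.symm⟩

theorem IsLocallyClosed.singleton_of_subtype {X : Type*} [TopologicalSpace X] {Y : Set X}
    (hY : IsLocallyClosed Y) {y : Y} (hy : IsLocallyClosed ({y} : Set Y)) :
    IsLocallyClosed ({(y : X)} : Set X) := by
  simpa using hy.image Topology.IsInducing.subtypeVal (by simpa using hY)

theorem ScatteredSpace.of_subsingleton (X : Type*) [TopologicalSpace X] [Subsingleton X] :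
    ScatteredSpace X := by
  rintro C - ⟨x, hx⟩
  refine ⟨x, hx, Set.univ, isOpen_univ, ?_⟩
  rw [Set.univ_inter]
  exact Set.subsingleton_of_subsingleton.eq_singleton_of_mem hx

theorem nowhereScatteredSpace_iff_not_exists_singleton (X : Type*) [TopologicalSpace X] :
    NowhereScatteredSpace X ↔ ¬ ∃ Y : Set X, IsLocallyClosed Y ∧ ∃ x : X, Y = {x} := by
  constructor
  · rintro h ⟨_, ⟨U, C, hU, hC, hUC⟩, x, rfl⟩
    have hx : x ∈ U ∩ C := hUC ▸ Set.mem_singleton x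
    exact h C hC x ⟨hx.2, U, hU, hUC.symm⟩
  · exact fun h C hC x hx => h ⟨_, hx.isLocallyClosed_singleton hC, x, rfl⟩

theorem nowhereScatteredSpace_tfae (X : Type*) [TopologicalSpace X] :
    List.TFAE
      [ NowhereScatteredSpace X,
        ¬ ∃ Y : Set X, Y.Nonempty ∧ IsLocallyClosed Y ∧ ScatteredSpace Y,
        ¬ ∃ Y : Set X, Y.Nonempty ∧ IsLocallyClosed Y ∧ T1Space Y,
        ¬ ∃ Y : Set X, IsLocallyClosed Y ∧ ∃ x : X, Y = {x} ] := by
  tfae_have 1 ↔ 4 := nowhereScatteredSpace_iff_not_exists_singleton X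
  tfae_have 2 → 4 := by
    rintro h ⟨_, hY, x, rfl⟩
    exact h ⟨{x}, Set.singleton_nonempty x, hY, .of_subsingleton _⟩
  tfae_have 3 → 4 := by
    rintro h ⟨_, hY, x, rfl⟩
    exact h ⟨{x}, Set.singleton_nonempty x, hY, inferInstance⟩
  tfae_have 4 → 2 := by
    rintro h ⟨Y, ⟨y, hy⟩, hY, hs⟩
    obtain ⟨z, hz⟩ := hs Set.univ isClosed_univ ⟨⟨y, hy⟩, Set.mem_univ _⟩
    exact h ⟨_, hY.singleton_of_subtype (hz.isLocallyClosed_singleton isClosed_univ), z, rfl⟩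
  tfae_have 4 → 3 := by
    rintro h ⟨Y, ⟨y, hy⟩, hY, _⟩
    exact h ⟨_, hY.singleton_of_subtype (y := ⟨y, hy⟩) isClosed_singleton.isLocallyClosed, y, rfl⟩
  tfae_finish
end

section
/- Let X be a nowhere scattered topological space and let Y ⊆ X be a locally closed subset. Then Y, with the subspace topology, is nowhere scattered. -/
theorem nowhereScatteredSpace_of_isLocallyClosed {X : Type*} [TopologicalSpace X]
    (hX : NowhereScatteredSpace X) (Y : Set X) (hY : IsLocallyClosed Y) :
    NowhereScatteredSpace Y := by
  obtain ⟨O, K, hO, hK, rfl⟩ := hY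
  rintro C hC x ⟨hxC, U, hU, hUC⟩
  obtain ⟨D, hD, rfl⟩ := isClosed_induced_iff.mp hC
  obtain ⟨V, hV, rfl⟩ := isOpen_induced_iff.mp hU
  refine hX (D ∩ K) (hD.inter hK) x ⟨⟨hxC, x.2.2⟩, V ∩ O, hV.inter hO, ?_⟩
  have h := congrArg (Set.image Subtype.val) hUC
  simp only [← Set.preimage_inter, Subtype.image_preimage_coe, Set.image_singleton] at h
  rw [← h]
  ext y
  simp only [Set.mem_inter_iff]
  tauto
end

section
/- Let A be a C*-algebra. Then no hereditary sub-C*-algebra of A admits a finite-dimensional irreducible representation if and only if no hereditary sub-C*-algebra of A admits a character. -/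
section NowhereScattered

variable {A : Type*} [NonUnitalRing A] [Module ℂ A] [StarRing A] [PartialOrder A]
  [TopologicalSpace A]

/-- A sub-*-algebra `B` of `A` is hereditary if `0 ≤ a ≤ b` with `b ∈ B` implies `a ∈ B`. -/
def NonUnitalStarSubalgebra.Hereditary (B : NonUnitalStarSubalgebra ℂ A) : Prop :=
  ∀ b ∈ B, ∀ a : A, 0 ≤ a → a ≤ b → a ∈ B

/-- A sub-*-algebra admits a character if there is a nonzero *-algebra homomorphism to `ℂ`. -/
def NonUnitalStarSubalgebra.AdmitsCharacter (B : NonUnitalStarSubalgebra ℂ A) : Prop :=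
  ∃ φ : B →⋆ₙₐ[ℂ] ℂ, φ ≠ 0

end NowhereScattered

/-- A C*-algebra is nowhere scattered if no hereditary sub-C*-algebra of it admits a
character. -/
def NowhereScattered (A : Type*) [NonUnitalRing A] [Module ℂ A] [StarRing A] [PartialOrder A]
    [TopologicalSpace A] : Prop :=
  ∀ B : NonUnitalStarSubalgebra ℂ A, IsClosed (B : Set A) → B.Hereditary →
    ¬ B.AdmitsCharacter

section FinDim

variable {A : Type*} [NonUnitalCStarAlgebra A] [PartialOrder A] [StarOrderedRing A]

/-- A finite-dimensional irreducible representation of the sub-*-algebra `B`: a nonzero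
*-homomorphism into the bounded operators on a nonzero finite-dimensional complex Hilbert
space with no nontrivial invariant subspaces. -/
structure FinDimIrrep (B : NonUnitalStarSubalgebra ℂ A) where
  H : Type
  [normedH : NormedAddCommGroup H]
  [ipsH : InnerProductSpace ℂ H]
  [fdH : FiniteDimensional ℂ H]
  [ntH : Nontrivial H]
  π : B →⋆ₙₐ[ℂ] (H →L[ℂ] H)
  nonzero : π ≠ 0
  irreducible : ∀ p : Submodule ℂ H, (∀ b : B, ∀ v ∈ p, π b v ∈ p) → p = ⊥ ∨ p = ⊤

end FinDim

section Density

variable {K V : Type*} [Field K] [IsAlgClosed K] [AddCommGroup V] [Module K V]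

/-- **Burnside's theorem** on matrix algebras: over an algebraically closed field, an algebra of
operators on a finite-dimensional space without nontrivial invariant subspaces is everything. -/
theorem Subalgebra.eq_top_of_forall_invariant_eq_bot_or_eq_top [FiniteDimensional K V]
    [Nontrivial V] (S : Subalgebra K (Module.End K V))
    (hS : ∀ p : Submodule K V, (∀ s ∈ S, ∀ v ∈ p, s v ∈ p) → p = ⊥ ∨ p = ⊤) : S = ⊤ := by
  have hsimple : IsSimpleModule S V := by
    refine isSimpleModule_iff _ _ |>.2 { eq_bot_or_eq_top := fun p => ?_ }
    rcases hS (p.restrictScalars K) (fun s hs v hv => p.smul_mem ⟨s, hs⟩ hv) with h | h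
    · exact .inl ((Submodule.restrictScalars_eq_bot_iff ..).1 h)
    · exact .inr ((Submodule.restrictScalars_eq_top_iff ..).1 h)
  refine eq_top_iff.2 fun f _ => ?_
  let f' : Module.End (Module.End S V) V :=
    { toFun := f
      map_add' := map_add f
      map_smul' := fun g v => by
        obtain ⟨c, rfl⟩ := (IsSimpleModule.algebraMap_end_bijective_of_isAlgClosed K).2 g
        simp }
  obtain ⟨s, hs⟩ := Module.Finite.fg_top (R := K) (M := V)
  obtain ⟨r, hr⟩ := jacobson_density f' s
  have : f = r := LinearMap.ext_on hs fun v hv => hr v hv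
  exact this ▸ r.2

end Density

section Corner

variable {A : Type*} [NonUnitalCStarAlgebra A]
  {H : Type*} [NormedAddCommGroup H] [InnerProductSpace ℂ H] [CompleteSpace H]
  {B : NonUnitalStarSubalgebra ℂ A}

open scoped InnerProductSpace

theorem NonUnitalStarSubalgebra.sqrt_mem [PartialOrder A] [StarOrderedRing A]
    (hB : IsClosed (B : Set A)) {a : A} (ha : a ∈ B) (ha0 : 0 ≤ a) : CFC.sqrt a ∈ B := by
  rw [CFC.sqrt_eq_real_sqrt a ha0]
  exact cfcₙ_mem (𝕜' := ℂ) (hs := hB) _ ha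

theorem NonUnitalStarSubalgebra.exists_isSelfAdjoint_mul_self [PartialOrder A] [StarOrderedRing A]
    (hB : IsClosed (B : Set A)) {a : B} (ha : 0 ≤ (a : A)) : ∃ s : B, star s = s ∧ s * s = a :=
  ⟨⟨CFC.sqrt (a : A), sqrt_mem hB a.2 ha⟩,
    Subtype.ext (CFC.sqrt_nonneg (a : A)).isSelfAdjoint.star_eq,
    Subtype.ext (CFC.sqrt_mul_sqrt_self _ ha)⟩

namespace NonUnitalStarAlgHom

theorem inner_apply_left (π : B →⋆ₙₐ[ℂ] (H →L[ℂ] H)) (b : B) (v w : H) :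
    ⟪π b v, w⟫_ℂ = ⟪v, π (star b) w⟫_ℂ := by
  rw [map_star, ContinuousLinearMap.star_eq_adjoint, ContinuousLinearMap.adjoint_inner_right]

theorem inner_mul_self_apply (π : B →⋆ₙₐ[ℂ] (H →L[ℂ] H)) {s : B} (hs : star s = s) (v : H) :
    ⟪v, π (s * s) v⟫_ℂ = (‖π s v‖ : ℂ) ^ 2 := by
  have h := inner_apply_left π s v (π s v)
  rw [hs, inner_self_eq_norm_sq_to_K] at h
  rw [map_mul, mul_apply_eq_comp, ← h]
  rfl

theorem apply_eq_zero_of_le [PartialOrder A] [StarOrderedRing A] (hB : IsClosed (B : Set A))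
    (π : B →⋆ₙₐ[ℂ] (H →L[ℂ] H)) {a b : B} (ha : 0 ≤ (a : A)) (hab : (a : A) ≤ b)
    {v : H} (hv : π b v = 0) : π a v = 0 := by
  obtain ⟨s, hs, rfl⟩ := B.exists_isSelfAdjoint_mul_self hB ha
  obtain ⟨t, ht, htt⟩ := B.exists_isSelfAdjoint_mul_self hB (a := b - s * s) (sub_nonneg.2 hab)
  have h1 := inner_mul_self_apply π ht v
  rw [htt, map_sub, sub_apply, inner_sub_right, hv, inner_zero_right,
    inner_mul_self_apply π hs] at h1
  have h2 : 0 - ‖π s v‖ ^ 2 = ‖π t v‖ ^ 2 := by exact_mod_cast h1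
  have h3 : π s v = 0 := by
    rw [← norm_eq_zero]
    nlinarith [sq_nonneg ‖π s v‖, sq_nonneg ‖π t v‖]
  rw [map_mul, mul_apply_eq_comp, h3, map_zero]

theorem continuous_of_isClosed (hB : IsClosed (B : Set A)) (π : B →⋆ₙₐ[ℂ] (H →L[ℂ] H)) :
    Continuous π :=
  have := hB
  AddMonoidHomClass.continuous_of_bound π 1 fun b => by
    simpa only [one_mul] using NonUnitalStarAlgHom.norm_apply_le π b

/-- The elements of `B` that a representation `π` maps to scalar multiples of the projection
onto the line spanned by `e`. -/
def lineCorner (π : B →⋆ₙₐ[ℂ] (H →L[ℂ] H)) (e : H) : NonUnitalStarSubalgebra ℂ A where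
  carrier := {a | ∃ h : a ∈ B, ∀ w, ⟪e, w⟫_ℂ = 0 → π ⟨a, h⟩ w = 0 ∧ π (star ⟨a, h⟩) w = 0}
  add_mem' := by
    rintro a b ⟨ha, ha'⟩ ⟨hb, hb'⟩
    refine ⟨add_mem ha hb, fun w hw => ?_⟩
    have h : (⟨a + b, add_mem ha hb⟩ : B) = ⟨a, ha⟩ + ⟨b, hb⟩ := rfl
    simp only [h, star_add, map_add, add_apply, ha' w hw, hb' w hw, add_zero, and_self]
  zero_mem' := by
    refine ⟨zero_mem B, fun w _ => ?_⟩
    have h : (⟨0, zero_mem B⟩ : B) = 0 := rfl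
    simp [h]
  mul_mem' := by
    rintro a b ⟨ha, ha'⟩ ⟨hb, hb'⟩
    refine ⟨mul_mem ha hb, fun w hw => ?_⟩
    have h : (⟨a * b, mul_mem ha hb⟩ : B) = ⟨a, ha⟩ * ⟨b, hb⟩ := rfl
    simp only [h, star_mul, map_mul, mul_apply_eq_comp, ha' w hw, hb' w hw, map_zero, and_self]
  smul_mem' := by
    rintro c a ⟨ha, ha'⟩
    refine ⟨SMulMemClass.smul_mem c ha, fun w hw => ?_⟩
    have h : (⟨c • a, SMulMemClass.smul_mem c ha⟩ : B) = c • ⟨a, ha⟩ := rfl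
    simp only [h, star_smul, map_smul, smul_apply, ha' w hw, smul_zero, and_self]
  star_mem' := by
    rintro a ⟨ha, ha'⟩
    refine ⟨star_mem ha, fun w hw => ?_⟩
    have h : (⟨star a, star_mem ha⟩ : B) = star ⟨a, ha⟩ := rfl
    simp only [h, star_star, ha' w hw, and_self]

variable (π : B →⋆ₙₐ[ℂ] (H →L[ℂ] H)) (e : H)

theorem mem_lineCorner {a : A} : a ∈ lineCorner π e ↔
    ∃ h : a ∈ B, ∀ w, ⟪e, w⟫_ℂ = 0 → π ⟨a, h⟩ w = 0 ∧ π (star ⟨a, h⟩) w = 0 := Iff.rfl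

theorem lineCorner_le : lineCorner π e ≤ B := fun _ ha => ha.1

theorem isClosed_lineCorner (hB : IsClosed (B : Set A)) :
    IsClosed (lineCorner π e : Set A) := by
  have hπ : Continuous π := continuous_of_isClosed hB π
  have h : (lineCorner π e : Set A) = Subtype.val ''
      {b : B | ∀ w, ⟪e, w⟫_ℂ = 0 → π b w = 0 ∧ π (star b) w = 0} := by
    ext a
    simp [mem_lineCorner]
  rw [h]
  refine hB.isClosedEmbedding_subtypeVal.isClosedMap _ ?_
  simp only [Set.ofPred_forall, Set.ofPred_and]
  refine isClosed_iInter fun w => isClosed_iInter fun _ => IsClosed.inter ?_ ?_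
  · exact isClosed_eq (by fun_prop) continuous_const
  · exact isClosed_eq ((hπ.comp continuous_star).clm_apply continuous_const) continuous_const

theorem hereditary_lineCorner [PartialOrder A] [StarOrderedRing A]
    (hB : IsClosed (B : Set A)) (hher : B.Hereditary) :
    (lineCorner π e).Hereditary := by
  rintro b ⟨hb, hb'⟩ a ha hab
  have haB := hher b hb a ha hab
  have hstar : star (⟨a, haB⟩ : B) = ⟨a, haB⟩ := Subtype.ext ha.isSelfAdjoint.star_eq
  refine ⟨haB, fun w hw => ?_⟩
  rw [hstar, and_self]
  exact apply_eq_zero_of_le hB π (b := ⟨b, hb⟩) ha hab (hb' w hw).1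

variable {e}

theorem apply_eq_inner_smul_of_mem_lineCorner (he : ‖e‖ = 1) (a : lineCorner π e) :
    π ⟨a, lineCorner_le π e a.2⟩ e = ⟪e, π ⟨a, lineCorner_le π e a.2⟩ e⟫_ℂ • e := by
  obtain ⟨a, ha, ha'⟩ := a
  set x := π ⟨a, ha⟩ e with hx
  have hee : ⟪e, e⟫_ℂ = 1 := by simp [inner_self_eq_norm_sq_to_K, he]
  have h0 : ⟪e, x - ⟪e, x⟫_ℂ • e⟫_ℂ = 0 := by
    rw [inner_sub_right, inner_smul_right, hee, mul_one, sub_self]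
  have h1 : ⟪x, x - ⟪e, x⟫_ℂ • e⟫_ℂ = 0 := by
    conv_lhs => rw [hx]
    rw [inner_apply_left, (ha' _ h0).2, inner_zero_right]
  rw [← sub_eq_zero, ← inner_self_eq_zero (𝕜 := ℂ)]
  conv_lhs => rw [inner_sub_left, inner_smul_left, h0, h1, mul_zero, sub_zero]

/-- The vector functional of a unit vector `e` is a character on the corner of `e`. -/
noncomputable def lineCornerCharacter (he : ‖e‖ = 1) : lineCorner π e →⋆ₙₐ[ℂ] ℂ where
  toFun a := ⟪e, π ⟨a, lineCorner_le π e a.2⟩ e⟫_ℂ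
  map_smul' c a := by
    have h : (⟨(c • a : lineCorner π e), lineCorner_le π e (c • a).2⟩ : B) =
      c • ⟨a, lineCorner_le π e a.2⟩ := rfl
    rw [h, map_smul, smul_apply, inner_smul_right]
    rfl
  map_zero' := by
    have h : (⟨(0 : lineCorner π e), lineCorner_le π e (0 : lineCorner π e).2⟩ : B) = 0 := rfl
    simp only [h, map_zero]
    exact inner_zero_right e
  map_add' a b := by
    have h : (⟨(a + b : lineCorner π e), lineCorner_le π e (a + b).2⟩ : B) =
      ⟨a, lineCorner_le π e a.2⟩ + ⟨b, lineCorner_le π e b.2⟩ := rfl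
    rw [h, map_add, add_apply, inner_add_right]
  map_mul' a b := by
    have h : (⟨(a * b : lineCorner π e), lineCorner_le π e (a * b).2⟩ : B) =
      ⟨a, lineCorner_le π e a.2⟩ * ⟨b, lineCorner_le π e b.2⟩ := rfl
    rw [h, map_mul, mul_apply_eq_comp,
      apply_eq_inner_smul_of_mem_lineCorner π he b, map_smul, inner_smul_right, mul_comm]
    simp [inner_self_eq_norm_sq_to_K, he]
  map_star' a := by
    have h : (⟨(star a : lineCorner π e), lineCorner_le π e (star a).2⟩ : B) =
      star ⟨a, lineCorner_le π e a.2⟩ := rfl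
    rw [h, ← inner_apply_left, RCLike.star_def, inner_conj_symm]

theorem lineCorner_admitsCharacter (he : ‖e‖ = 1) {b : B}
    (hb : ∀ w, π b w = ⟪e, w⟫_ℂ • e) : (lineCorner π e).AdmitsCharacter := by
  have hee : ⟪e, e⟫_ℂ = 1 := by simp [inner_self_eq_norm_sq_to_K, he]
  have hmem : (b : A) ∈ lineCorner π e := by
    refine ⟨b.2, fun w hw => ⟨by simp [hb, hw], ?_⟩⟩
    refine ext_inner_left ℂ fun v => ?_
    rw [← inner_apply_left, Subtype.coe_eta, hb, inner_smul_left, hw, mul_zero, inner_zero_right]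
  refine ⟨lineCornerCharacter π he, fun h => ?_⟩
  have h1 : ⟪e, π b e⟫_ℂ = 0 := DFunLike.congr_fun h ⟨b, hmem⟩
  rw [hb, hee, one_smul, hee] at h1
  exact one_ne_zero h1

/-- The range of a nonzero finite-dimensional irreducible representation contains a rank one
projection. -/
theorem exists_apply_eq_inner_smul [FiniteDimensional ℂ H] [Nontrivial H] (hπ : π ≠ 0)
    (hirr : ∀ p : Submodule ℂ H, (∀ b : B, ∀ v ∈ p, π b v ∈ p) → p = ⊥ ∨ p = ⊤) :
    ∃ e : H, ‖e‖ = 1 ∧ ∃ b : B, ∀ w, π b w = ⟪e, w⟫_ℂ • e := by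
  let R : Set (Module.End ℂ H) := Set.range fun b : B => (π b : H →ₗ[ℂ] H)
  have htop : Algebra.adjoin ℂ R = ⊤ :=
    Subalgebra.eq_top_of_forall_invariant_eq_bot_or_eq_top _ fun p hp =>
      hirr p fun b v hv => hp _ (Algebra.subset_adjoin ⟨b, rfl⟩) v hv
  have hideal (f : Module.End ℂ H) : ∀ b : B, ∃ c : B, ∀ w, π c w = π b (f w) := by
    have hf : f ∈ Algebra.adjoin ℂ R := htop ▸ Algebra.mem_top
    induction hf using Algebra.adjoin_induction with
    | mem x hx =>
      obtain ⟨a, rfl⟩ := hx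
      exact fun b => ⟨b * a, by simp⟩
    | algebraMap r => exact fun b => ⟨r • b, by simp [Module.algebraMap_end_apply]⟩
    | add x y _ _ hx hy =>
      intro b
      obtain ⟨c, hc⟩ := hx b
      obtain ⟨d, hd⟩ := hy b
      exact ⟨c + d, by simp [hc, hd]⟩
    | mul x y _ _ hx hy =>
      intro b
      obtain ⟨c, hc⟩ := hx b
      obtain ⟨d, hd⟩ := hy c
      exact ⟨d, by simp [hc, hd]⟩
  obtain ⟨b, u, hbu⟩ : ∃ b u, π b u ≠ 0 := by
    by_contra! h
    exact hπ (NonUnitalStarAlgHom.ext fun b => ContinuousLinearMap.ext fun u => h b u)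
  let e : H := (‖π b u‖ : ℂ)⁻¹ • π b u
  have he : ‖e‖ = 1 := by simp [e, norm_smul, hbu]
  refine ⟨e, he, ?_⟩
  obtain ⟨c, hc⟩ := hideal ((innerSL ℂ e).toLinearMap.smulRight ((‖π b u‖ : ℂ)⁻¹ • u)) b
  refine ⟨c, fun w => ?_⟩
  rw [hc]
  simp [e, mul_comm]

end NonUnitalStarAlgHom

end Corner

section FinDim

variable {A : Type*} [NonUnitalCStarAlgebra A] [PartialOrder A] [StarOrderedRing A]

/-- A character, viewed as a one-dimensional irreducible representation. -/
noncomputable def FinDimIrrep.ofCharacter {B : NonUnitalStarSubalgebra ℂ A} (φ : B →⋆ₙₐ[ℂ] ℂ)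
    (hφ : φ ≠ 0) : FinDimIrrep B where
  H := ℂ
  π := ((StarAlgHom.ofId ℂ (ℂ →L[ℂ] ℂ) : ℂ →⋆ₐ[ℂ] (ℂ →L[ℂ] ℂ)) : ℂ →⋆ₙₐ[ℂ] (ℂ →L[ℂ] ℂ)).comp φ
  nonzero h := hφ <| NonUnitalStarAlgHom.ext fun b => by
    simpa [Algebra.algebraMap_eq_smul_one] using DFunLike.congr_fun (DFunLike.congr_fun h b) 1
  irreducible p _ := eq_bot_or_eq_top p

theorem no_finDimIrrep_iff_no_character :
    (∀ B : NonUnitalStarSubalgebra ℂ A, IsClosed (B : Set A) → B.Hereditary →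
      IsEmpty (FinDimIrrep B)) ↔
    ∀ B : NonUnitalStarSubalgebra ℂ A, IsClosed (B : Set A) → B.Hereditary →
      ¬ B.AdmitsCharacter := by
  refine ⟨fun h B hB hher ⟨φ, hφ⟩ => ?_, fun h B hB hher => ⟨fun ρ => ?_⟩⟩
  · exact (h B hB hher).elim (FinDimIrrep.ofCharacter φ hφ)
  · obtain ⟨H, π, hπ, hirr⟩ := ρ
    have := FiniteDimensional.complete ℂ H
    obtain ⟨e, he, b, hb⟩ := π.exists_apply_eq_inner_smul hπ hirr
    exact h _ (π.isClosed_lineCorner e hB) (π.hereditary_lineCorner e hB hher)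
      (π.lineCorner_admitsCharacter he hb)

end FinDim
end

section
/- Let A be a C*-algebra and let a ∈ A be positive. Then the hereditary sub-C*-algebra cl(aAa) (the closure of the set of elements axa for x ∈ A) admits no character if and only if there exists a countable subset G ⊆ A such that (axa)² = 0 for each x ∈ G and a belongs to the closed *-subalgebra of A generated by {axa : x ∈ G}. -/
section Corner

variable {A : Type*} [NonUnitalCStarAlgebra A] [PartialOrder A] [StarOrderedRing A]

/-- The *-subalgebra `aAa` of `A`, for a self-adjoint element `a`. -/
def cornerAlg (a : A) (ha : IsSelfAdjoint a) : NonUnitalStarSubalgebra ℂ A where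
  carrier := {y : A | ∃ x : A, y = a * x * a}
  add_mem' := by rintro y z ⟨x, rfl⟩ ⟨x', rfl⟩; exact ⟨x + x', by noncomm_ring⟩
  zero_mem' := ⟨0, by simp⟩
  mul_mem' := by rintro y z ⟨x, rfl⟩ ⟨x', rfl⟩; exact ⟨x * (a * (a * x')), by noncomm_ring⟩
  smul_mem' := by rintro c y ⟨x, rfl⟩; exact ⟨c • x, by simp [mul_smul_comm, smul_mul_assoc]⟩
  star_mem' := by
    rintro y ⟨x, rfl⟩
    exact ⟨star x, by simp [star_mul, ha.star_eq, mul_assoc]⟩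

/-- The hereditary sub-C*-algebra `cl (aAa)` of `A`, for a self-adjoint element `a`;
its underlying set is the norm-closure of `{a * x * a : x ∈ A}`. -/
def hereditarySub (a : A) (ha : IsSelfAdjoint a) : NonUnitalStarSubalgebra ℂ A :=
  (cornerAlg a ha).topologicalClosure

end Corner

open Set

lemma exists_approx_unit_of_isSelfAdjoint {R : Type*} [CStarAlgebra R] {b : R}
    (hb : IsSelfAdjoint b) {δ : ℝ} (hδ : 0 < δ) :
    ∃ g d : R, IsSelfAdjoint d ∧ Commute b g ∧
      (1 - b * b * g) * (1 - d) = 0 ∧ (1 - d) * (1 - b * b * g) = 0 ∧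
      ‖b * d‖ ≤ δ ∧ ‖d * b * d‖ ≤ δ := by
  have hm : ∀ s : ℝ, 0 < max (s ^ 2) (δ ^ 2) := fun s => lt_max_of_lt_right (by positivity)
  have hmul : ∀ f g : ℝ → ℝ, Continuous f → Continuous g →
      cfc f b * cfc g b = cfc (fun s => f s * g s) b := fun f g hf hg =>
    (cfc_mul f g b hf.continuousOn hg.continuousOn).symm
  have hsub : ∀ f : ℝ → ℝ, Continuous f → 1 - cfc f b = cfc (fun s => 1 - f s) b :=
    fun f hf => by
      rw [cfc_sub (fun _ => (1 : ℝ)) f b continuousOn_const hf.continuousOn, cfc_const_one ℝ b]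
  have hgc : Continuous fun s : ℝ => (max (s ^ 2) (δ ^ 2))⁻¹ :=
    Continuous.inv₀ (by fun_prop) fun s => (hm s).ne'
  have hdc : Continuous fun s : ℝ => δ ^ 2 * (max (s ^ 2) (δ ^ 2))⁻¹ := by fun_prop
  have hid : cfc (fun s : ℝ => s) b = b := cfc_id' ℝ b
  have hcomm : Commute b (cfc (fun s : ℝ => (max (s ^ 2) (δ ^ 2))⁻¹) b) :=
    (Commute.refl b).cfc_real _ |>.symm
  refine ⟨cfc (fun s : ℝ => (max (s ^ 2) (δ ^ 2))⁻¹) b,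
    cfc (fun s : ℝ => δ ^ 2 * (max (s ^ 2) (δ ^ 2))⁻¹) b, cfc_predicate _ b, hcomm, ?_⟩
  have hbbg : b * b * cfc (fun s : ℝ => (max (s ^ 2) (δ ^ 2))⁻¹) b =
      cfc (fun s : ℝ => s * s * (max (s ^ 2) (δ ^ 2))⁻¹) b := by
    rw [← hmul (fun s => s * s) _ (by fun_prop) hgc, ← hmul _ _ continuous_id' continuous_id', hid]
  have key : ∀ s : ℝ, (1 - s * s * (max (s ^ 2) (δ ^ 2))⁻¹) *
      (1 - δ ^ 2 * (max (s ^ 2) (δ ^ 2))⁻¹) = 0 := fun s => by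
    rcases le_total (s ^ 2) (δ ^ 2) with h | h
    · rw [max_eq_right h, mul_inv_cancel₀ (by positivity)]; simp
    · have : s ^ 2 ≠ 0 := ((pow_pos hδ 2).trans_le h).ne'
      rw [max_eq_left h, ← pow_two, mul_inv_cancel₀ this]; simp
  have hd1 : ∀ s : ℝ, |s * (δ ^ 2 * (max (s ^ 2) (δ ^ 2))⁻¹)| ≤ δ := fun s => by
    rw [abs_mul, abs_of_nonneg (by have := hm s; positivity : 0 ≤ δ ^ 2 * (max (s ^ 2) (δ ^ 2))⁻¹),
      ← mul_assoc, ← div_eq_mul_inv, div_le_iff₀ (hm s)]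
    rcases le_total |s| δ with h | h
    · calc |s| * δ ^ 2 ≤ δ * δ ^ 2 := by gcongr
        _ ≤ _ := by gcongr; exact le_max_right _ _
    · calc |s| * δ ^ 2 = δ * (|s| * δ) := by ring
        _ ≤ δ * (|s| * |s|) := by gcongr
        _ = δ * s ^ 2 := by rw [abs_mul_abs_self, pow_two]
        _ ≤ _ := by gcongr; exact le_max_left _ _
  have hd2 : ∀ s : ℝ, |δ ^ 2 * (max (s ^ 2) (δ ^ 2))⁻¹| ≤ 1 := fun s => by
    rw [abs_of_nonneg (by have := hm s; positivity), ← div_eq_mul_inv, div_le_one (hm s)]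
    exact le_max_right _ _
  have hbd : b * cfc (fun s : ℝ => δ ^ 2 * (max (s ^ 2) (δ ^ 2))⁻¹) b =
      cfc (fun s : ℝ => s * (δ ^ 2 * (max (s ^ 2) (δ ^ 2))⁻¹)) b := by
    rw [← hmul _ _ continuous_id' hdc, hid]
  refine ⟨?_, ?_, ?_, ?_⟩
  · rw [hbbg, hsub _ (by fun_prop), hsub _ hdc, hmul _ _ (by fun_prop) (by fun_prop)]
    simp [key]
  · rw [hbbg, hsub _ hdc, hsub _ (by fun_prop), hmul _ _ (by fun_prop) (by fun_prop)]
    simp [fun s : ℝ => (mul_comm _ _).trans (key s)]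
  · rw [hbd]
    exact norm_cfc_le hδ.le fun s _ => hd1 s
  · rw [mul_assoc, hbd, hmul _ _ hdc (by fun_prop)]
    refine norm_cfc_le hδ.le fun s _ => ?_
    rw [norm_mul, Real.norm_eq_abs, Real.norm_eq_abs]
    exact (mul_le_of_le_one_left (abs_nonneg _) (hd2 s)).trans (hd1 s)

/-- A closed `*`-subalgebra containing all square-zero elements contains their left multiples. -/
lemma mul_mem_of_mul_self_eq_zero {R : Type*} [CStarAlgebra R]
    (J : NonUnitalStarSubalgebra ℂ R) (hJ : IsClosed (J : Set R))
    (hsq : ∀ y : R, y * y = 0 → y ∈ J) (x y : R) (hy : y * y = 0) : x * y ∈ J := by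
  have hc : IsSelfAdjoint (y * star y) := .mul_star_self y
  have hcl : x * y ∈ closure (J : Set R) := by
    rw [Metric.mem_closure_iff]
    intro ε hε
    obtain ⟨δ, hδ, hδε⟩ : ∃ δ : ℝ, 0 < δ ∧ ‖x‖ * Real.sqrt δ < ε := by
      refine ⟨(ε / (‖x‖ + 1)) ^ 2, by positivity, ?_⟩
      rw [Real.sqrt_sq (by positivity), mul_div_assoc', div_lt_iff₀ (by positivity)]
      linarith [mul_comm ε ‖x‖]
    obtain ⟨g, d, hd, -, -, h2, -, h4⟩ := exists_approx_unit_of_isSelfAdjoint hc hδ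
    set c := y * star y with hcdef
    have hyc : y * c = 0 := by rw [hcdef, ← mul_assoc, hy, zero_mul]
    refine ⟨x * ((1 - d) * y), ?_, ?_⟩
    · have e1 : x * ((1 - d) * y) = ((1 - c * c * g) * x * (1 - d)) * y +
          (c * c * g) * x * (1 - d) * y := by noncomm_ring
      rw [e1]
      refine add_mem (mul_mem (hsq _ ?_) (hsq _ hy)) (hsq _ ?_)
      · calc _ = (1 - c * c * g) * x * ((1 - d) * (1 - c * c * g)) * x * (1 - d) := by
              simp only [mul_assoc]
          _ = 0 := by rw [h2]; simp
      · calc _ = (c * c * g) * x * (1 - d) * (y * c) * (c * g * x * (1 - d) * y) := by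
              simp only [mul_assoc]
          _ = 0 := by rw [hyc]; simp
    · have e2 : x * y - x * ((1 - d) * y) = x * (d * y) := by noncomm_ring
      rw [dist_eq_norm, e2]
      have : ‖d * y‖ ≤ Real.sqrt δ := by
        apply Real.le_sqrt_of_sq_le
        rw [pow_two, ← CStarRing.norm_self_mul_star, star_mul, hd.star_eq]
        calc _ = ‖d * c * d‖ := by simp only [hcdef, mul_assoc]
          _ ≤ δ := h4
      exact (norm_mul_le _ _).trans_lt
        ((mul_le_mul_of_nonneg_left this (norm_nonneg _)).trans_lt hδε)
  rwa [hJ.closure_eq] at hcl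

/-- The closed `*`-subalgebra generated by the square-zero elements of a unital C⋆-algebra is a
left ideal. -/
lemma mul_mem_topologicalClosure_adjoin_squareZero {R : Type*} [CStarAlgebra R] (x : R) {z : R}
    (hz : z ∈ (NonUnitalStarAlgebra.adjoin ℂ {y : R | y * y = 0}).topologicalClosure) :
    x * z ∈ (NonUnitalStarAlgebra.adjoin ℂ {y : R | y * y = 0}).topologicalClosure := by
  set J := (NonUnitalStarAlgebra.adjoin ℂ {y : R | y * y = 0}).topologicalClosure
  have hJc : IsClosed (J : Set R) := NonUnitalStarSubalgebra.isClosed_topologicalClosure _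
  have hle : NonUnitalStarAlgebra.adjoin ℂ {y : R | y * y = 0} ≤ J :=
    NonUnitalStarSubalgebra.le_topologicalClosure _
  have hsq : ∀ y : R, y * y = 0 → y ∈ J := fun y hy =>
    hle (NonUnitalStarAlgebra.subset_adjoin ℂ _ hy)
  have hadj : ∀ z ∈ NonUnitalStarAlgebra.adjoin ℂ {y : R | y * y = 0},
      ∀ x : R, x * z ∈ J ∧ z * x ∈ J := by
    intro z hz
    induction hz using NonUnitalStarAlgebra.adjoin_induction with
    | mem y hy =>
      intro x
      refine ⟨mul_mem_of_mul_self_eq_zero J hJc hsq x y hy, ?_⟩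
      have hy' : star y * star y = 0 := by rw [← star_mul, show y * y = 0 from hy, star_zero]
      simpa using star_mem (mul_mem_of_mul_self_eq_zero J hJc hsq (star x) (star y) hy')
    | add y z _ _ hy hz =>
      exact fun x => ⟨by rw [mul_add]; exact add_mem (hy x).1 (hz x).1,
        by rw [add_mul]; exact add_mem (hy x).2 (hz x).2⟩
    | zero => exact fun x => by simp
    | mul y z hy' hz' hy hz =>
      exact fun x => ⟨by rw [← mul_assoc]; exact mul_mem (hy x).1 (hle hz'),
        by rw [mul_assoc]; exact mul_mem (hle hy') (hz x).2⟩
    | smul r y _ hy =>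
      exact fun x => ⟨by rw [mul_smul_comm]; exact SMulMemClass.smul_mem r (hy x).1,
        by rw [smul_mul_assoc]; exact SMulMemClass.smul_mem r (hy x).2⟩
    | star y _ hy =>
      exact fun x => ⟨by simpa using star_mem (hy (star x)).2,
        by simpa using star_mem (hy (star x)).1⟩
  have : MapsTo (fun w => x * w) (closure (NonUnitalStarAlgebra.adjoin ℂ {y : R | y * y = 0}))
      (J : Set R) :=
    MapsTo.closure_left (fun z hz => (hadj z hz x).1) (by fun_prop) hJc
  exact this hz

lemma CFC.continuous_posPart {A X : Type*} [NonUnitalCStarAlgebra A] [TopologicalSpace X]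
    {f : X → A} (hf : Continuous f) (hsa : ∀ x, IsSelfAdjoint (f x)) :
    Continuous fun x => (f x)⁺ :=
  Continuous.cfcₙ_of_mem_nhdsSet (s := univ) (·⁺ : ℝ → ℝ) Filter.univ_mem hf hsa

lemma CFC.continuous_negPart {A X : Type*} [NonUnitalCStarAlgebra A] [TopologicalSpace X]
    {f : X → A} (hf : Continuous f) (hsa : ∀ x, IsSelfAdjoint (f x)) :
    Continuous fun x => (f x)⁻ :=
  Continuous.cfcₙ_of_mem_nhdsSet (s := univ) (·⁻ : ℝ → ℝ) Filter.univ_mem hf hsa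

/-- A maximal left ideal containing all square-zero elements contains a real translate of every
self-adjoint element. -/
lemma Ideal.IsMaximal.exists_sub_algebraMap_mem_of_isSelfAdjoint {R : Type*} [CStarAlgebra R]
    {M : Ideal R} (hM : M.IsMaximal) (hsq : ∀ y : R, y * y = 0 → y ∈ M) {b : R}
    (hb : IsSelfAdjoint b) : ∃ t : ℝ, b - algebraMap ℝ R t ∈ M := by
  have hMc : IsClosed (M : Set R) := hM.isClosed
  have hsa : ∀ t : ℝ, IsSelfAdjoint (b - algebraMap ℝ R t) := fun t =>
    hb.sub (.algebraMap R (.all t))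
  have hcont : Continuous fun t : ℝ => b - algebraMap ℝ R t :=
    continuous_const.sub (continuous_algebraMap ℝ R)
  have hcover : ∀ t : ℝ, (b - algebraMap ℝ R t)⁺ ∈ M ∨ (b - algebraMap ℝ R t)⁻ ∈ M := by
    intro t
    set p := (b - algebraMap ℝ R t)⁺
    set m := (b - algebraMap ℝ R t)⁻
    have hmp : m * p = 0 := CFC.negPart_mul_posPart _
    rw [or_iff_not_imp_right]
    intro hm
    obtain ⟨r, hr⟩ := hM.exists_inv hm
    obtain ⟨i, hi, hri⟩ : ∃ i ∈ M, r * m + i = 1 := hr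
    have : p = p * r * m + p * i := by
      rw [mul_assoc, ← mul_add, hri, mul_one]
    rw [this]
    refine add_mem (hsq _ ?_) (M.mul_mem_left p hi)
    calc p * r * m * (p * r * m) = p * r * (m * p) * (r * m) := by simp only [mul_assoc]
      _ = 0 := by rw [hmp]; simp
  obtain ⟨t, -, htp, htm⟩ := isPreconnected_closed_iff.mp (isPreconnected_univ (α := ℝ))
    {t | (b - algebraMap ℝ R t)⁺ ∈ M} {t | (b - algebraMap ℝ R t)⁻ ∈ M}
    (hMc.preimage (CFC.continuous_posPart hcont hsa))
    (hMc.preimage (CFC.continuous_negPart hcont hsa)) (fun t _ => hcover t)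
    (by
      let _ := CStarAlgebra.spectralOrder R
      let _ := CStarAlgebra.spectralOrderedRing R
      refine ⟨‖b‖, mem_univ _, ?_⟩
      have : (b - algebraMap ℝ R ‖b‖)⁺ = 0 := by
        rw [CFC.posPart_eq_zero_iff _ (hsa _), sub_nonpos]
        exact hb.le_algebraMap_norm_self
      simp [this])
    (by
      let _ := CStarAlgebra.spectralOrder R
      let _ := CStarAlgebra.spectralOrderedRing R
      refine ⟨-‖b‖, mem_univ _, ?_⟩
      have : (b - algebraMap ℝ R (-‖b‖))⁻ = 0 := by
        rw [CFC.negPart_eq_zero_iff _ (hsa _), sub_nonneg, map_neg]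
        exact hb.neg_algebraMap_norm_le_self
      exact mem_ofPred_eq ▸ this ▸ zero_mem M)
  refine ⟨t, ?_⟩
  rw [← CFC.posPart_sub_negPart _ (hsa t)]
  exact sub_mem htp htm

/-- A maximal left ideal containing all square-zero elements is the kernel of a character. -/
lemma Ideal.IsMaximal.exists_starAlgHom {R : Type*} [CStarAlgebra R] {M : Ideal R}
    (hM : M.IsMaximal) (hsq : ∀ y : R, y * y = 0 → y ∈ M) :
    ∃ χ : R →⋆ₐ[ℂ] ℂ, ∀ x, χ x = 0 → x ∈ M := by
  have hone : (1 : R) ∉ M := fun h => hM.ne_top ((M.eq_top_iff_one).mpr h)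
  have hconst : ∀ z : ℂ, algebraMap ℂ R z ∈ M → z = 0 := by
    intro z hz
    by_contra h0
    refine hone ?_
    simpa [← map_mul, inv_mul_cancel₀ h0] using M.mul_mem_left (algebraMap ℂ R z⁻¹) hz
  have huniq : ∀ (x : R) (z w : ℂ), x - algebraMap ℂ R z ∈ M → x - algebraMap ℂ R w ∈ M →
      z = w := by
    intro x z w hz hw
    refine sub_eq_zero.mp (hconst _ ?_)
    rw [map_sub]
    simpa using sub_mem hw hz
  have hsa : ∀ b : R, IsSelfAdjoint b → ∃ t : ℝ, b - algebraMap ℂ R t ∈ M := fun b hb => by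
    simpa [IsScalarTower.algebraMap_apply ℝ ℂ R] using
      hM.exists_sub_algebraMap_mem_of_isSelfAdjoint hsq hb
  have hex : ∀ x : R, ∃ z : ℂ, x - algebraMap ℂ R z ∈ M ∧
      star x - algebraMap ℂ R (star z) ∈ M := by
    intro x
    obtain ⟨s, hs⟩ := hsa (realPart x) (realPart x).2
    obtain ⟨t, ht⟩ := hsa (imaginaryPart x) (imaginaryPart x).2
    have ht' := M.mul_mem_left (algebraMap ℂ R Complex.I) ht
    refine ⟨s + Complex.I * t, ?_, ?_⟩
    · convert add_mem hs ht' using 1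
      nth_rw 1 [← realPart_add_I_smul_imaginaryPart x]
      rw [Algebra.smul_def, map_add, map_mul, mul_sub]
      abel
    · convert sub_mem hs ht' using 1
      nth_rw 1 [← realPart_add_I_smul_imaginaryPart x]
      rw [star_add, star_smul, (realPart x).2.star_eq, (imaginaryPart x).2.star_eq]
      simp [Algebra.smul_def, mul_sub]
      abel
  choose c hc hcs using hex
  refine ⟨{ toFun := c, map_one' := ?_, map_mul' := ?_, map_zero' := ?_, map_add' := ?_,
            commutes' := ?_, map_star' := ?_ }, ?_⟩
  · exact huniq 1 _ _ (hc 1) (by simp)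
  · intro x y
    refine huniq (x * y) _ _ (hc _) ?_
    convert add_mem (M.mul_mem_left x (hc y)) (M.mul_mem_left (algebraMap ℂ R (c y)) (hc x))
      using 1
    rw [map_mul, mul_sub, mul_sub, Algebra.commutes (c y) x, ← map_mul, ← map_mul, mul_comm (c y)]
    abel
  · exact huniq 0 _ _ (hc 0) (by simp)
  · intro x y
    refine huniq (x + y) _ _ (hc _) ?_
    convert add_mem (hc x) (hc y) using 1
    rw [map_add]
    abel
  · exact fun z => huniq _ _ _ (hc _) (by simp)
  · exact fun x => huniq _ _ _ (hc _) (hcs x)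
  · intro x hx
    have := hc x
    rwa [show c x = 0 from hx, map_zero, sub_zero] at this

/-- A self-adjoint element outside a closed two-sided ideal containing all square-zero elements is
detected by a character. -/
lemma exists_starAlgHom_ne_zero_of_notMem {R : Type*} [CStarAlgebra R]
    (J : NonUnitalStarSubalgebra ℂ R) (hJ : IsClosed (J : Set R))
    (hmul : ∀ x, ∀ z ∈ J, x * z ∈ J) (hsq : ∀ y : R, y * y = 0 → y ∈ J) {b : R}
    (hb : IsSelfAdjoint b) (hbJ : b ∉ J) : ∃ χ : R →⋆ₐ[ℂ] ℂ, χ b ≠ 0 := by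
  have hmul' : ∀ x, ∀ z ∈ J, z * x ∈ J := fun x z hz => by
    simpa using star_mem (hmul (star x) _ (star_mem hz))
  obtain ⟨g, d, hbg, h1, hdJ⟩ : ∃ g d : R, Commute b g ∧ (1 - b * b * g) * (1 - d) = 0 ∧
      1 - d ∉ J := by
    by_contra! H
    refine hbJ ?_
    have hcl : b ∈ closure (J : Set R) := by
      rw [Metric.mem_closure_iff]
      intro ε hε
      obtain ⟨g, d, -, hbg, h1, -, h3, -⟩ :=
        exists_approx_unit_of_isSelfAdjoint hb (half_pos hε)
      refine ⟨b * (1 - d), hmul _ _ (H g d hbg h1), ?_⟩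
      rw [dist_eq_norm, mul_sub, mul_one, sub_sub_cancel]
      linarith
    rwa [hJ.closure_eq] at hcl
  set e := b * b * g with he
  let L : Ideal R :=
    { carrier := {z | ∃ j ∈ J, ∃ r, z = j + r * (1 - e)}
      add_mem' := by
        rintro _ _ ⟨j, hj, r, rfl⟩ ⟨j', hj', r', rfl⟩
        exact ⟨j + j', add_mem hj hj', r + r', by rw [add_mul]; abel⟩
      zero_mem' := ⟨0, zero_mem J, 0, by simp⟩
      smul_mem' := by
        rintro x _ ⟨j, hj, r, rfl⟩
        exact ⟨x * j, hmul x j hj, x * r, by rw [smul_eq_mul, mul_add, mul_assoc]⟩ }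
  have hL : L ≠ ⊤ := by
    intro h
    obtain ⟨j, hj, r, hr⟩ : (1 : R) ∈ L := h ▸ Submodule.mem_top
    refine hdJ ?_
    have : 1 - d = j * (1 - d) := by
      calc 1 - d = (j + r * (1 - e)) * (1 - d) := by rw [← hr, one_mul]
        _ = j * (1 - d) := by rw [add_mul, mul_assoc, h1, mul_zero, add_zero]
    rw [this]
    exact hmul' _ _ hj
  obtain ⟨M, hM, hLM⟩ := L.exists_le_maximal hL
  have hJM : ∀ z ∈ J, z ∈ M := fun z hz => hLM ⟨z, hz, 0, by simp⟩
  have heM : 1 - e ∈ M := hLM ⟨0, zero_mem J, 1, by simp⟩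
  obtain ⟨χ, hχ⟩ := hM.exists_starAlgHom fun y hy => hJM y (hsq y hy)
  refine ⟨χ, fun h => hM.ne_top ((M.eq_top_iff_one).mpr ?_)⟩
  have : e = g * b * b := by
    rw [he, mul_assoc, hbg.eq, ← mul_assoc, hbg.eq]
  have he' : e ∈ M := this ▸ M.mul_mem_left _ (hχ b h)
  simpa using add_mem heM he'

lemma exists_norm_sub_mul_pow_mul_le {A : Type*} [NonUnitalCStarAlgebra A] {c : A}
    (hc : IsSelfAdjoint c) {δ : ℝ} (hδ : 0 < δ) :
    ∃ w : A, IsSelfAdjoint w ∧ Commute c w ∧ ‖c - c * (c * c * c * w)‖ ≤ δ ∧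
      ‖c * c * c * w‖ ≤ 1 := by
  have hm : ∀ s : ℝ, 0 < max (s ^ 2) (δ ^ 2) := fun s => lt_max_of_lt_right (by positivity)
  have hgc : Continuous fun s : ℝ => (max (s ^ 2) (δ ^ 2))⁻¹ :=
    Continuous.inv₀ (by fun_prop) fun s => (hm s).ne'
  have hwc : Continuous fun s : ℝ => s * (max (s ^ 2) (δ ^ 2))⁻¹ ^ 2 := by fun_prop
  have hid : cfcₙ (fun s : ℝ => s) c = c := cfcₙ_id' ℝ c
  have hmul : ∀ f : ℝ → ℝ, Continuous f → f 0 = 0 →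
      c * cfcₙ f c = cfcₙ (fun s => s * f s) c := fun f hf hf0 => by
    rw [cfcₙ_mul (fun s => s) f c (continuousOn_id' _) rfl hf.continuousOn hf0, hid]
  have hh : ∀ s : ℝ, 0 ≤ s * (s * (s * (s * (max (s ^ 2) (δ ^ 2))⁻¹ ^ 2))) ∧
      s * (s * (s * (s * (max (s ^ 2) (δ ^ 2))⁻¹ ^ 2))) ≤ 1 := fun s => by
    have h1 : s * (s * (s * (s * (max (s ^ 2) (δ ^ 2))⁻¹ ^ 2))) =
        (s ^ 2 / max (s ^ 2) (δ ^ 2)) ^ 2 := by ring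
    rw [h1]
    refine ⟨by positivity, pow_le_one₀ (by have := hm s; positivity) ?_⟩
    rw [div_le_one (hm s)]
    exact le_max_left _ _
  refine ⟨cfcₙ (fun s : ℝ => s * (max (s ^ 2) (δ ^ 2))⁻¹ ^ 2) c, cfcₙ_predicate _ c,
    (Commute.refl c).cfcₙ_real _ |>.symm, ?_⟩
  have e : c * c * c * cfcₙ (fun s : ℝ => s * (max (s ^ 2) (δ ^ 2))⁻¹ ^ 2) c =
      cfcₙ (fun s : ℝ => s * (s * (s * (s * (max (s ^ 2) (δ ^ 2))⁻¹ ^ 2)))) c := by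
    rw [mul_assoc, mul_assoc, hmul _ hwc (by simp), hmul _ (by fun_prop) (by simp),
      hmul _ (by fun_prop) (by simp)]
  rw [e]
  constructor
  · rw [hmul _ (by fun_prop) (by simp)]
    nth_rw 1 [← hid]
    rw [← cfcₙ_sub (fun s : ℝ => s)
      (fun s : ℝ => s * (s * (s * (s * (s * (max (s ^ 2) (δ ^ 2))⁻¹ ^ 2))))) c
      (continuousOn_id' _) rfl (Continuous.continuousOn (by fun_prop)) (by simp)]
    refine norm_cfcₙ_le fun s _ => ?_
    obtain ⟨h0, h1⟩ := hh s
    rcases le_total |s| δ with h | h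
    · rw [← mul_one_sub, norm_mul, Real.norm_eq_abs, Real.norm_eq_abs]
      exact (mul_le_of_le_one_right (abs_nonneg _) (abs_le.mpr ⟨by linarith, by linarith⟩)).trans h
    · have hs : s ≠ 0 := abs_pos.mp (hδ.trans_le h)
      have : δ ^ 2 ≤ s ^ 2 := sq_le_sq.mpr (by rwa [abs_of_pos hδ])
      rw [max_eq_left this]
      field_simp
      simp [hδ.le]
  · refine norm_cfcₙ_le fun s _ => ?_
    rw [Real.norm_eq_abs, abs_of_nonneg (hh s).1]
    exact (hh s).2

lemma exists_norm_sub_mul_self_lt {A : Type*} [NonUnitalCStarAlgebra A] (y : A) {ε : ℝ}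
    (hε : 0 < ε) :
    ∃ w : A, ‖y - y * star y * (y * star y) * (y * star y) * w * y‖ < ε := by
  obtain ⟨w, hw, hcw, h1, h2⟩ := exists_norm_sub_mul_pow_mul_le
    (IsSelfAdjoint.mul_star_self y) (show 0 < ε ^ 2 / 4 by positivity)
  refine ⟨w, ?_⟩
  set c := y * star y with hc
  have hcs : star c = c := (IsSelfAdjoint.mul_star_self y).star_eq
  set h := c * c * c * w with hh
  have hch : Commute c h :=
    (((Commute.refl c).mul_right (Commute.refl c)).mul_right (Commute.refl c)).mul_right hcw
  have hhs : star h = h := by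
    have : Commute (c * c * c) w := (hcw.mul_left hcw).mul_left hcw
    rw [hh, star_mul (c * c * c) w, hw.star_eq, star_mul (c * c) c, star_mul c c, hcs,
      ← mul_assoc c c c, this.eq]
  have key : ‖y - h * y‖ ^ 2 ≤ ε ^ 2 / 2 := by
    rw [pow_two, ← CStarRing.norm_self_mul_star]
    have e : (y - h * y) * star (y - h * y) = (c - c * h) - h * (c - c * h) := by
      rw [star_sub, star_mul, hhs, sub_mul, mul_sub, mul_sub, mul_sub, ← mul_assoc y, ← hc,
        mul_assoc h y, mul_assoc h y, ← mul_assoc y, ← hc, hch.eq]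
    rw [e]
    calc _ ≤ ‖c - c * h‖ + ‖h‖ * ‖c - c * h‖ :=
          (norm_sub_le _ _).trans (by gcongr; exact norm_mul_le _ _)
      _ ≤ ε ^ 2 / 4 + 1 * (ε ^ 2 / 4) := by gcongr
      _ = ε ^ 2 / 2 := by ring
  exact lt_of_pow_lt_pow_left₀ 2 hε.le (key.trans_lt (by linarith [pow_pos hε 2]))

lemma mem_closure_cube_mul_mul_cube {A : Type*} [NonUnitalCStarAlgebra A] (y : A) :
    y ∈ closure (range fun x : A => y * star y * (y * star y) * (y * star y) * x *
      (star y * y * (star y * y) * (star y * y))) := by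
  rw [Metric.mem_closure_range_iff]
  intro ε hε
  obtain ⟨w, hw⟩ := exists_norm_sub_mul_self_lt y (half_pos hε)
  set c := y * star y * (y * star y) * (y * star y)
  have hpos : 0 < ε / 2 / (‖c * w‖ + 1) := by positivity
  obtain ⟨v, hv⟩ := exists_norm_sub_mul_self_lt (star y) hpos
  rw [star_star, ← norm_star] at hv
  simp only [star_sub, star_mul, star_star] at hv
  refine ⟨w * y * star v, ?_⟩
  rw [dist_eq_norm]
  have e : y - c * (w * y * star v) * (star y * y * (star y * y) * (star y * y)) =
      (y - c * w * y) +
      c * w * (y - y * (star v * (star y * y * (star y * y * (star y * y))))) := by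
    simp only [mul_sub, mul_assoc]
    abel
  rw [e]
  refine (norm_add_le _ _).trans_lt ?_
  have : ‖c * w‖ * (ε / 2 / (‖c * w‖ + 1)) ≤ ε / 2 := by
    rw [mul_div_assoc', div_le_iff₀ (by positivity)]
    nlinarith [norm_nonneg (c * w)]
  have := (norm_mul_le _ _).trans
    ((mul_le_mul_of_nonneg_left hv.le (norm_nonneg (c * w))).trans this)
  linarith

section Corner

variable {A : Type*} [NonUnitalCStarAlgebra A]

lemma isClosed_hereditarySub {a : A} (ha : IsSelfAdjoint a) :
    IsClosed (hereditarySub a ha : Set A) :=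
  NonUnitalStarSubalgebra.isClosed_topologicalClosure _

lemma mem_hereditarySub_of_mul_mul {a : A} (ha : IsSelfAdjoint a) (x : A) :
    a * x * a ∈ hereditarySub a ha :=
  NonUnitalStarSubalgebra.le_topologicalClosure _ ⟨x, rfl⟩

lemma self_mem_hereditarySub {a : A} (ha : IsSelfAdjoint a) : a ∈ hereditarySub a ha := by
  rw [← SetLike.mem_coe, ← (isClosed_hereditarySub ha).closure_eq, Metric.mem_closure_iff]
  intro ε hε
  obtain ⟨w, -, hw, h1, -⟩ := exists_norm_sub_mul_pow_mul_le ha (half_pos hε)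
  refine ⟨a * (a * a * a * w), ?_, by rw [dist_eq_norm]; linarith⟩
  have : a * (a * a * a * w) = a * (a * a * w) * a := by
    rw [mul_assoc (a * a) a w, hw.eq]
    simp only [mul_assoc]
  rw [this]
  exact mem_hereditarySub_of_mul_mul ha _

/-- Square-zero elements of `cl (aAa)` are limits of square-zero elements of `aAa`. -/
lemma mem_closure_squareZero_of_mem_hereditarySub {a : A} (ha : IsSelfAdjoint a) {y : A}
    (hy : y ∈ hereditarySub a ha) (hy2 : y * y = 0) :
    y ∈ closure {z : A | (∃ x, z = a * x * a) ∧ z * z = 0} := by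
  set S := {z : A | (∃ x, z = a * x * a) ∧ z * z = 0}
  let r : A → A := fun z => (2⁻¹ : ℝ) • (z + star z)
  have hrsa : ∀ z, IsSelfAdjoint (r z) := fun z =>
    IsSelfAdjoint.smul (.all _) (IsSelfAdjoint.add_star_self z)
  have hrc : Continuous r := by fun_prop
  have hpc := CFC.continuous_posPart hrc hrsa
  have hmc := CFC.continuous_negPart hrc hrsa
  let F : A → A → A := fun x z => (r z)⁺ * (r z)⁺ * (r z)⁺ * x * ((r z)⁻ * (r z)⁻ * (r z)⁻)
  have hFc : ∀ x, Continuous (F x) := fun x => by fun_prop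
  have hFS : ∀ x, MapsTo (F x) (cornerAlg a ha) S := by
    rintro x _ ⟨s, rfl⟩
    have hmp : (r (a * s * a))⁻ * (r (a * s * a))⁺ = 0 := CFC.negPart_mul_posPart _
    have hpm : (r (a * s * a))⁺ * (r (a * s * a))⁻ = 0 := CFC.posPart_mul_negPart _
    have hr : (r (a * s * a))⁺ - (r (a * s * a))⁻ = r (a * s * a) :=
      CFC.posPart_sub_negPart _ (hrsa _)
    obtain ⟨s', hs'⟩ : ∃ s', r (a * s * a) = a * s' * a :=
      ⟨(2⁻¹ : ℝ) • (s + star s), by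
        simp only [r, star_mul, ha.star_eq, mul_smul_comm, smul_mul_assoc, mul_add, add_mul,
          mul_assoc]⟩
    simp only [F]
    set p := (r (a * s * a))⁺
    set m := (r (a * s * a))⁻
    rw [hs'] at hr
    have hp3 : p * p * p = a * s' * a * p * (a * s' * a) := by
      rw [← hr, sub_mul, hmp, sub_zero, mul_sub, mul_assoc p p m, hpm, mul_zero, sub_zero]
    have hm3 : m * m * m = a * s' * a * m * (a * s' * a) := by
      rw [← hr, sub_mul, hpm, zero_sub, mul_sub, neg_mul, neg_mul, mul_assoc m m p, hmp, mul_zero,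
        neg_zero, zero_sub, neg_neg]
    refine ⟨⟨s' * a * p * (a * s' * a) * x * (a * s' * a * m * (a * s')), ?_⟩, ?_⟩
    · rw [hp3, hm3]
      simp only [mul_assoc]
    · calc _ = p * p * p * x * (m * m) * (m * p) * (p * p * x * (m * m * m)) := by
            simp only [mul_assoc]
        _ = 0 := by rw [hmp]; simp
  have hcl : ∀ x, ∀ z ∈ hereditarySub a ha, F x z ∈ closure S := fun x z hz =>
    (hFS x).closure (hFc x) hz
  have hb : y * star y - star y * y ∈ hereditarySub a ha :=
    sub_mem (mul_mem hy (star_mem hy)) (mul_mem (star_mem hy) hy)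
  have hrb : r (y * star y - star y * y) = y * star y - star y * y := by
    simp only [r, star_sub, star_mul, star_star]
    rw [← two_smul ℝ, smul_smul]
    norm_num
  let : PartialOrder A := CStarAlgebra.spectralOrder A
  have : StarOrderedRing A := CStarAlgebra.spectralOrderedRing A
  obtain ⟨hp, hm⟩ := CFC.posPart_negPart_unique (a := y * star y - star y * y) rfl
    (by
      have : star y * star y = 0 := by rw [← star_mul, hy2, star_zero]
      rw [mul_assoc, ← mul_assoc (star y), this]; simp)
    (mul_star_self_nonneg y) (star_mul_self_nonneg y)
  refine closure_minimal ?_ isClosed_closure (mem_closure_cube_mul_mul_cube y)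
  rintro _ ⟨x, rfl⟩
  have := hcl x _ hb
  simp only [F, hrb, hp, hm] at this
  exact this

lemma mem_topologicalClosure_adjoin_of_not_admitsCharacter {a : A} (ha : IsSelfAdjoint a)
    (h : ¬ (hereditarySub a ha).AdmitsCharacter) :
    a ∈ (NonUnitalStarAlgebra.adjoin ℂ
      {z : A | (∃ x, z = a * x * a) ∧ z * z = 0}).topologicalClosure := by
  set T := (NonUnitalStarAlgebra.adjoin ℂ
      {z : A | (∃ x, z = a * x * a) ∧ z * z = 0}).topologicalClosure
  have hTc : IsClosed (T : Set A) := NonUnitalStarSubalgebra.isClosed_topologicalClosure _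
  have : IsClosed (hereditarySub a ha : Set A) := isClosed_hereditarySub ha
  let b : hereditarySub a ha := ⟨a, self_mem_hereditarySub ha⟩
  have hb : IsSelfAdjoint (Unitization.inr b : Unitization ℂ (hereditarySub a ha)) :=
    IsSelfAdjoint.inr ℂ (Subtype.ext ha)
  set J := (NonUnitalStarAlgebra.adjoin ℂ
    {y : Unitization ℂ (hereditarySub a ha) | y * y = 0}).topologicalClosure
  have hbJ : (Unitization.inr b : Unitization ℂ (hereditarySub a ha)) ∈ J := by
    by_contra hbJ
    obtain ⟨χ, hχ⟩ := exists_starAlgHom_ne_zero_of_notMem J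
      (NonUnitalStarSubalgebra.isClosed_topologicalClosure _)
      (fun x z hz => mul_mem_topologicalClosure_adjoin_squareZero x hz)
      (fun y hy => NonUnitalStarSubalgebra.le_topologicalClosure _
        (NonUnitalStarAlgebra.subset_adjoin ℂ _ hy)) hb hbJ
    exact h ⟨(χ : Unitization ℂ (hereditarySub a ha) →⋆ₙₐ[ℂ] ℂ).comp
      (Unitization.inrNonUnitalStarAlgHom ℂ _), fun h0 => hχ (DFunLike.congr_fun h0 b)⟩
  have hadj : ∀ z ∈ NonUnitalStarAlgebra.adjoin ℂ
      {y : Unitization ℂ (hereditarySub a ha) | y * y = 0},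
      z.fst = 0 ∧ (z.snd : A) ∈ T := by
    intro z hz
    induction hz using NonUnitalStarAlgebra.adjoin_induction with
    | mem y hy =>
      have hy' : y * y = 0 := hy
      have h1 : y.fst = 0 := by simpa using congr_arg (fun w => w.fst) hy'
      have h2 : (y.snd : A) * y.snd = 0 := by
        simpa [h1] using congr_arg (fun w => (w.snd : A)) hy'
      refine ⟨h1, ?_⟩
      refine closure_mono ?_ (mem_closure_squareZero_of_mem_hereditarySub ha y.snd.2 h2)
      exact NonUnitalStarAlgebra.subset_adjoin ℂ _
    | add y z _ _ hy hz => exact ⟨by simp [hy.1, hz.1], by simpa using add_mem hy.2 hz.2⟩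
    | zero => exact ⟨by simp, by simp⟩
    | mul y z _ _ hy hz =>
      exact ⟨by simp [hy.1], by simpa [hy.1, hz.1] using mul_mem hy.2 hz.2⟩
    | smul c y _ hy => exact ⟨by simp [hy.1], by simpa using SMulMemClass.smul_mem c hy.2⟩
    | star y _ hy => exact ⟨by simp [hy.1], by simpa using star_mem hy.2⟩
  have hmaps : MapsTo (fun z : Unitization ℂ (hereditarySub a ha) => (z.snd : A))
      (closure (NonUnitalStarAlgebra.adjoin ℂ
        {y : Unitization ℂ (hereditarySub a ha) | y * y = 0})) (T : Set A) :=
    MapsTo.closure_left (fun z hz => (hadj z hz).2)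
      (continuous_subtype_val.comp Unitization.continuous_snd) hTc
  exact hmaps hbJ

/-- A character on `cl (aAa)` cannot exist if square-zero elements of `aAa` generate `a`. -/
lemma not_admitsCharacter_of_mem_topologicalClosure_adjoin {a : A} (ha : IsSelfAdjoint a)
    {S : Set A} (hS : ∀ y ∈ S, y ∈ hereditarySub a ha ∧ y * y = 0)
    (haS : a ∈ (NonUnitalStarAlgebra.adjoin ℂ S).topologicalClosure) :
    ¬ (hereditarySub a ha).AdmitsCharacter := by
  rintro ⟨φ, hφ⟩
  have hBc : IsClosed (hereditarySub a ha : Set A) := isClosed_hereditarySub ha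
  have hφc : Continuous φ :=
    AddMonoidHomClass.continuous_of_bound φ 1 fun x => by
      simpa using NonUnitalStarAlgHom.norm_apply_le φ x
  let b : hereditarySub a ha := ⟨a, self_mem_hereditarySub ha⟩
  have hφb : φ b = 0 := by
    have hK : IsClosed (Subtype.val '' {x : hereditarySub a ha | φ x = 0}) :=
      hBc.isClosedEmbedding_subtypeVal.isClosedMap _ (isClosed_eq hφc continuous_const)
    have hadj : (NonUnitalStarAlgebra.adjoin ℂ S : Set A) ⊆
        Subtype.val '' {x : hereditarySub a ha | φ x = 0} := by
      intro z hz
      induction hz using NonUnitalStarAlgebra.adjoin_induction with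
      | mem y hy =>
        refine ⟨⟨y, (hS y hy).1⟩, ?_, rfl⟩
        have : φ (⟨y, (hS y hy).1⟩ * ⟨y, (hS y hy).1⟩) = 0 := by
          rw [show (⟨y, (hS y hy).1⟩ * ⟨y, (hS y hy).1⟩ : hereditarySub a ha) = 0 from
            Subtype.ext (hS y hy).2, map_zero]
        rw [map_mul] at this
        exact mul_self_eq_zero.mp this
      | add y z _ _ hy hz =>
        obtain ⟨⟨y, hy, rfl⟩, ⟨z, hz, rfl⟩⟩ := And.intro hy hz
        exact ⟨y + z, by simp_all, rfl⟩
      | zero => exact ⟨0, by simp, rfl⟩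
      | mul y z _ _ hy hz =>
        obtain ⟨⟨y, hy, rfl⟩, ⟨z, hz, rfl⟩⟩ := And.intro hy hz
        exact ⟨y * z, by simp_all, rfl⟩
      | smul c y _ hy =>
        obtain ⟨y, hy, rfl⟩ := hy
        exact ⟨c • y, by simp_all, rfl⟩
      | star y _ hy =>
        obtain ⟨y, hy, rfl⟩ := hy
        exact ⟨star y, by simp_all [map_star], rfl⟩
    obtain ⟨x, hx, hxa⟩ := closure_minimal hadj hK haS
    rwa [show b = x from Subtype.ext hxa.symm]
  have hcorner : ∀ x, ∀ hx : a * x * a ∈ hereditarySub a ha, φ ⟨a * x * a, hx⟩ = 0 := by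
    intro x hx
    have hlim : a * x * a ∈ closure (Subtype.val '' {y : hereditarySub a ha | φ y = 0}) := by
      have hmaps : MapsTo (fun u => u * x * star u) (closure {u : A | ∃ w, u = a * (a * w * a)})
          (closure (Subtype.val '' {y : hereditarySub a ha | φ y = 0})) := by
        refine MapsTo.closure ?_ (by fun_prop)
        rintro _ ⟨w, rfl⟩
        let v : hereditarySub a ha := ⟨a * (w * a * x * a * star w) * a,
          mem_hereditarySub_of_mul_mul ha _⟩
        refine ⟨b * v * b, by simp [hφb], ?_⟩
        simp only [b, v, NonUnitalStarSubalgebra.coe_mul, star_mul, ha.star_eq, mul_assoc]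
      have hau : a ∈ closure {u : A | ∃ w, u = a * (a * w * a)} := by
        rw [Metric.mem_closure_iff]
        intro ε hε
        obtain ⟨w, -, hw, h1, -⟩ := exists_norm_sub_mul_pow_mul_le ha (half_pos hε)
        refine ⟨a * (a * a * a * w), ⟨a * w, ?_⟩, by rw [dist_eq_norm]; linarith⟩
        have : a * a * a * w = a * a * w * a := by
          rw [mul_assoc (a * a) a w, hw.eq, ← mul_assoc (a * a)]
        rw [this]
        simp only [mul_assoc]
      simpa [ha.star_eq] using hmaps hau
    have hK : IsClosed (Subtype.val '' {x : hereditarySub a ha | φ x = 0}) :=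
      hBc.isClosedEmbedding_subtypeVal.isClosedMap _ (isClosed_eq hφc continuous_const)
    rw [hK.closure_eq] at hlim
    obtain ⟨y, hy, hyx⟩ := hlim
    rwa [show (⟨a * x * a, hx⟩ : hereditarySub a ha) = y from Subtype.ext hyx.symm]
  refine hφ (NonUnitalStarAlgHom.ext fun y => ?_)
  have hK : IsClosed (Subtype.val '' {x : hereditarySub a ha | φ x = 0}) :=
    hBc.isClosedEmbedding_subtypeVal.isClosedMap _ (isClosed_eq hφc continuous_const)
  have hsub : (cornerAlg a ha : Set A) ⊆ Subtype.val '' {x : hereditarySub a ha | φ x = 0} := by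
    rintro _ ⟨x, rfl⟩
    exact ⟨⟨a * x * a, mem_hereditarySub_of_mul_mul ha x⟩, hcorner x _, rfl⟩
  obtain ⟨x, hx, hxy⟩ := closure_minimal hsub hK y.2
  rw [show y = x from Subtype.ext hxy.symm]
  exact hx

end Corner

lemma NonUnitalStarAlgebra.exists_finite_of_mem_adjoin {A : Type*} [NonUnitalCStarAlgebra A]
    {S : Set A} {x : A} (hx : x ∈ adjoin ℂ S) :
    ∃ F ⊆ S, F.Finite ∧ x ∈ adjoin ℂ F := by
  induction hx using NonUnitalStarAlgebra.adjoin_induction with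
  | mem y hy => exact ⟨{y}, by simpa using hy, finite_singleton y, subset_adjoin ℂ _ rfl⟩
  | add y z _ _ hy hz =>
    obtain ⟨F, hF, hFf, hyF⟩ := hy
    obtain ⟨F', hF', hFf', hzF⟩ := hz
    exact ⟨F ∪ F', union_subset hF hF', hFf.union hFf',
      add_mem (adjoin_mono subset_union_left hyF) (adjoin_mono subset_union_right hzF)⟩
  | zero => exact ⟨∅, empty_subset _, finite_empty, zero_mem _⟩
  | mul y z _ _ hy hz =>
    obtain ⟨F, hF, hFf, hyF⟩ := hy
    obtain ⟨F', hF', hFf', hzF⟩ := hz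
    exact ⟨F ∪ F', union_subset hF hF', hFf.union hFf',
      mul_mem (adjoin_mono subset_union_left hyF) (adjoin_mono subset_union_right hzF)⟩
  | smul r y _ hy =>
    obtain ⟨F, hF, hFf, hyF⟩ := hy
    exact ⟨F, hF, hFf, SMulMemClass.smul_mem r hyF⟩
  | star y _ hy =>
    obtain ⟨F, hF, hFf, hyF⟩ := hy
    exact ⟨F, hF, hFf, star_mem hyF⟩

lemma NonUnitalStarAlgebra.exists_countable_of_mem_topologicalClosure_adjoin {A : Type*}
    [NonUnitalCStarAlgebra A] {S : Set A} {x : A} (hx : x ∈ (adjoin ℂ S).topologicalClosure) :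
    ∃ F ⊆ S, F.Countable ∧ x ∈ (adjoin ℂ F).topologicalClosure := by
  obtain ⟨u, hu, hux⟩ := mem_closure_iff_seq_limit.mp hx
  choose F hFS hFf hF using fun n => exists_finite_of_mem_adjoin (hu n)
  refine ⟨⋃ n, F n, iUnion_subset hFS, countable_iUnion fun n => (hFf n).countable, ?_⟩
  exact mem_closure_iff_seq_limit.mpr
    ⟨u, fun n => adjoin_mono (subset_iUnion F n) (hF n), hux⟩

theorem no_character_iff_squareZero {A : Type*} [NonUnitalCStarAlgebra A] [PartialOrder A]
    [StarOrderedRing A] (a : A) (ha : 0 ≤ a) :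
    ¬ (hereditarySub a ha.isSelfAdjoint).AdmitsCharacter ↔
      ∃ G : Set A, G.Countable ∧ (∀ x ∈ G, (a * x * a) * (a * x * a) = 0) ∧
        a ∈ (NonUnitalStarAlgebra.adjoin ℂ
          {y : A | ∃ x ∈ G, y = a * x * a}).topologicalClosure := by
  constructor
  · intro h
    obtain ⟨F, hFS, hFc, haF⟩ :=
      NonUnitalStarAlgebra.exists_countable_of_mem_topologicalClosure_adjoin
        (mem_topologicalClosure_adjoin_of_not_admitsCharacter ha.isSelfAdjoint h)
    choose! g hg using fun y (hy : y ∈ F) => (hFS hy).1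
    refine ⟨g '' F, hFc.image g, ?_, ?_⟩
    · rintro _ ⟨y, hy, rfl⟩
      rw [← hg y hy]
      exact (hFS hy).2
    · refine closure_mono (NonUnitalStarAlgebra.adjoin_mono fun y hy => ?_) haF
      exact ⟨g y, mem_image_of_mem g hy, hg y hy⟩
  · rintro ⟨G, -, hG, haG⟩
    refine not_admitsCharacter_of_mem_topologicalClosure_adjoin ha.isSelfAdjoint ?_ haG
    rintro _ ⟨x, hx, rfl⟩
    exact ⟨mem_hereditarySub_of_mul_mul _ x, hG x hx⟩
end

section
/- Let A be a C*-algebra and let a ∈ A be a positive element with A = cl(aAa) (i.e., a is strictly positive in A). Let y ∈ A satisfy y² = 0 and let γ > 0. Then there exists x ∈ A such that (axa)² = 0 and ‖y − axa‖ < γ. -/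
/-- The positive part is continuous on the self-adjoint elements of a C⋆-algebra. -/
theorem continuousOn_posPart_isSelfAdjoint {A : Type*} [NonUnitalCStarAlgebra A] :
    ContinuousOn (fun e : A ↦ e⁺) {e | IsSelfAdjoint e} := by
  simp only [CFC.posPart_def]
  exact ContinuousOn.cfcₙ_of_mem_nhdsSet (s := Set.univ) (fun t : ℝ ↦ t⁺) Filter.univ_mem
    continuousOn_id

/-- The negative part is continuous on the self-adjoint elements of a C⋆-algebra. -/
theorem continuousOn_negPart_isSelfAdjoint {A : Type*} [NonUnitalCStarAlgebra A] :
    ContinuousOn (fun e : A ↦ e⁻) {e | IsSelfAdjoint e} := by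
  simp only [CFC.negPart_def]
  exact ContinuousOn.cfcₙ_of_mem_nhdsSet (s := Set.univ) (fun t : ℝ ↦ t⁻) Filter.univ_mem
    continuousOn_id

/-- A self-adjoint element `e` satisfies `e⁺ * e⁺ = e⁺ * e`. -/
theorem IsSelfAdjoint.posPart_mul_self {A : Type*} [NonUnitalCStarAlgebra A] {e : A}
    (he : IsSelfAdjoint e) : e⁺ * e⁺ = e⁺ * e := by
  have h : e⁺ * e = e⁺ * (e⁺ - e⁻) := by rw [CFC.posPart_sub_negPart e he]
  simp [h, mul_sub]

/-- A self-adjoint element `e` satisfies `e⁻ * e⁻ = -(e * e⁻)`. -/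
theorem IsSelfAdjoint.negPart_mul_self {A : Type*} [NonUnitalCStarAlgebra A] {e : A}
    (he : IsSelfAdjoint e) : e⁻ * e⁻ = -(e * e⁻) := by
  have h : e * e⁻ = (e⁺ - e⁻) * e⁻ := by rw [CFC.posPart_sub_negPart e he]
  simp [h, sub_mul]

/-- The function `t * (1 - t ^ 5 / (t ^ 5 + δ ^ 5)) ^ 2` is at most `δ` on `[0, ∞)`. -/
theorem mul_sq_div_le {t δ : ℝ} (ht : 0 ≤ t) (hδ : 0 < δ) :
    t * (1 - t ^ 5 / (t ^ 5 + δ ^ 5)) ^ 2 ≤ δ := by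
  have h5 : 0 < t ^ 5 + δ ^ 5 := by positivity
  have he : 1 - t ^ 5 / (t ^ 5 + δ ^ 5) = δ ^ 5 / (t ^ 5 + δ ^ 5) := by
    field_simp; ring
  rw [he, div_pow, ← mul_div_assoc, div_le_iff₀ (by positivity)]
  rcases le_total t δ with h | h
  · have : (δ ^ 5) ^ 2 ≤ (t ^ 5 + δ ^ 5) ^ 2 := by gcongr; linarith [pow_nonneg ht 5]
    exact mul_le_mul h this (by positivity) hδ.le
  · calc t * (δ ^ 5) ^ 2 = δ * (t * δ ^ 9) := by ring
      _ ≤ δ * (t * t ^ 9) := by gcongr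
      _ = δ * (t ^ 5) ^ 2 := by ring
      _ ≤ δ * (t ^ 5 + δ ^ 5) ^ 2 := by gcongr; linarith [pow_pos hδ 5]

/-- The C⋆-identity computation of `y - y * g(star y * y)` in the functional calculus of
`star y * y`. -/
theorem star_sub_mul_cfcₙ_mul_self {A : Type*} [NonUnitalCStarAlgebra A] (y : A) {g : ℝ → ℝ}
    (hg : ContinuousOn g (quasispectrum ℝ (star y * y))) (hg0 : g 0 = 0) :
    star (y - y * cfcₙ g (star y * y)) * (y - y * cfcₙ g (star y * y)) =
      cfcₙ (fun t : ℝ ↦ t * (1 - g t) ^ 2) (star y * y) := by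
  have hs : IsSelfAdjoint (star y * y) := .star_mul_self y
  have hstar : star (cfcₙ g (star y * y)) = cfcₙ g (star y * y) :=
    (IsSelfAdjoint.cfcₙ : IsSelfAdjoint (cfcₙ g (star y * y)))
  have h1 : star (y - y * cfcₙ g (star y * y)) * (y - y * cfcₙ g (star y * y)) =
      star y * y - cfcₙ g (star y * y) * (star y * y) - (star y * y * cfcₙ g (star y * y) -
        cfcₙ g (star y * y) * (star y * y) * cfcₙ g (star y * y)) := by
    simp only [star_sub, star_mul, hstar]
    noncomm_ring
  rw [h1]
  generalize star y * y = c at *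
  have h2 : cfcₙ (fun t : ℝ ↦ t * (1 - g t) ^ 2) c =
      cfcₙ (fun t : ℝ ↦ (t - g t * t) - (t * g t - g t * t * g t)) c :=
    cfcₙ_congr fun t _ ↦ by ring
  have hgt : ContinuousOn (fun t ↦ g t * t) (quasispectrum ℝ c) := hg.mul continuousOn_id
  have htg : ContinuousOn (fun t ↦ t * g t) (quasispectrum ℝ c) := continuousOn_id.mul hg
  rw [h2, cfcₙ_sub (fun t ↦ t - g t * t) (fun t ↦ t * g t - g t * t * g t) c
      (continuousOn_id.sub hgt) (by simp) (htg.sub (hgt.mul hg)) (by simp [hg0]),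
    cfcₙ_sub (fun t ↦ t) (fun t ↦ g t * t) c continuousOn_id rfl hgt (by simp),
    cfcₙ_sub (fun t ↦ t * g t) (fun t ↦ g t * t * g t) c htg (by simp) (hgt.mul hg) (by simp),
    cfcₙ_mul (fun t ↦ g t * t) g c hgt (by simp) hg hg0,
    cfcₙ_mul g (fun t ↦ t) c hg hg0 continuousOn_id rfl,
    cfcₙ_mul (fun t ↦ t) g c continuousOn_id rfl hg hg0, cfcₙ_id' ℝ c]

/-- Every `y` in a C⋆-algebra is a norm limit of elements `y * c ^ 2 * h * c ^ 2` with
`c = star y * y`. -/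
theorem exists_norm_sub_mul_star_mul_self_lt {A : Type*} [NonUnitalCStarAlgebra A]
    (y : A) {ε : ℝ} (hε : 0 < ε) :
    ∃ h : A, ‖y - y * ((star y * y) * (star y * y) * h * ((star y * y) * (star y * y)))‖ < ε := by
  let _ : PartialOrder A := CStarAlgebra.spectralOrder A
  have _ : StarOrderedRing A := CStarAlgebra.spectralOrderedRing A
  set c := star y * y with hc
  have hc0 : 0 ≤ c := star_mul_self_nonneg y
  have hcs : IsSelfAdjoint c := hc0.isSelfAdjoint
  have hsp : ∀ t ∈ quasispectrum ℝ c, 0 ≤ t := fun t ht ↦ quasispectrum_nonneg_of_nonneg c hc0 t ht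
  obtain ⟨δ, hδ, hδε⟩ : ∃ δ : ℝ, 0 < δ ∧ δ < ε ^ 2 := exists_between (by positivity)
  have hne : ∀ t ∈ quasispectrum ℝ c, t ^ 5 + δ ^ 5 ≠ 0 := fun t ht ↦ by
    have := hsp t ht
    positivity
  have hf : ContinuousOn (fun t : ℝ ↦ t / (t ^ 5 + δ ^ 5)) (quasispectrum ℝ c) :=
    continuousOn_id.div (by fun_prop) hne
  have hg : ContinuousOn (fun t : ℝ ↦ t ^ 5 / (t ^ 5 + δ ^ 5)) (quasispectrum ℝ c) :=
    ContinuousOn.div (by fun_prop) (by fun_prop) hne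
  refine ⟨cfcₙ (fun t : ℝ ↦ t / (t ^ 5 + δ ^ 5)) c, ?_⟩
  set g := cfcₙ (fun t : ℝ ↦ t ^ 5 / (t ^ 5 + δ ^ 5)) c
  have hcc : c * c = cfcₙ (fun t : ℝ ↦ t * t) c := by
    rw [cfcₙ_mul (fun t : ℝ ↦ t) (fun t : ℝ ↦ t) c, cfcₙ_id' ℝ c]
  have hprod : c * c * cfcₙ (fun t : ℝ ↦ t / (t ^ 5 + δ ^ 5)) c * (c * c) = g := by
    rw [hcc, ← cfcₙ_mul (fun t ↦ t * t) _ c (by fun_prop) (by simp) hf (by simp),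
      ← cfcₙ_mul (fun t ↦ t * t * (t / (t ^ 5 + δ ^ 5))) _ c
        (ContinuousOn.mul (by fun_prop) hf) (by simp) (by fun_prop) (by simp)]
    refine cfcₙ_congr fun t _ ↦ ?_
    ring
  rw [hprod]
  have hnorm : ‖y - y * g‖ ^ 2 ≤ δ := by
    rw [sq, ← CStarRing.norm_star_mul_self,
      star_sub_mul_cfcₙ_mul_self y hg (by simp)]
    refine norm_cfcₙ_le fun t ht ↦ ?_
    have ht0 := hsp t ht
    rw [Real.norm_of_nonneg (by positivity)]
    exact mul_sq_div_le ht0 hδ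
  exact lt_of_pow_lt_pow_left₀ 2 hε.le (hnorm.trans_lt hδε)

open Filter Topology ComplexStarModule in
theorem exists_squareZero_approx {A : Type*} [NonUnitalCStarAlgebra A] [PartialOrder A]
    [StarOrderedRing A] (a : A) (ha : 0 ≤ a)
    (hstrict : closure {y : A | ∃ x : A, y = a * x * a} = Set.univ)
    (y : A) (hy : y * y = 0) (γ : ℝ) (hγ : 0 < γ) :
    ∃ x : A, (a * x * a) * (a * x * a) = 0 ∧ ‖y - a * x * a‖ < γ := by
  have has : star a = a := ha.isSelfAdjoint
  obtain ⟨h, hh⟩ := exists_norm_sub_mul_star_mul_self_lt y hγ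
  set c := star y * y with hc
  set b := y * star y with hb
  set d := c - b with hd
  have hds : IsSelfAdjoint d := (IsSelfAdjoint.star_mul_self y).sub (IsSelfAdjoint.mul_star_self y)
  have hcb : c * b = 0 := by
    rw [hc, hb, mul_assoc, ← mul_assoc y, hy, zero_mul, mul_zero]
  obtain ⟨hdp, hdn⟩ := CFC.posPart_negPart_unique hd hcb
    (star_mul_self_nonneg y) (mul_star_self_nonneg y)
  set F : A → A := fun e ↦ e⁻ * e⁻ * (y * h) * (e⁺ * e⁺) with hF
  have hFd : F d = y * (c * c * h * (c * c)) := by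
    simp only [hF, hdp, hdn, hc, hb, mul_assoc]
  have hFc : ContinuousOn F {e | IsSelfAdjoint e} :=
    ((continuousOn_negPart_isSelfAdjoint.mul continuousOn_negPart_isSelfAdjoint).mul
      continuousOn_const).mul
      (continuousOn_posPart_isSelfAdjoint.mul continuousOn_posPart_isSelfAdjoint)
  obtain ⟨u, hu, hud⟩ := mem_closure_iff_seq_limit.mp (hstrict ▸ Set.mem_univ d)
  choose v hv using hu
  have hlim : Tendsto (fun n ↦ (ℜ (u n) : A)) atTop (𝓝[{e | IsSelfAdjoint e}] d) := by
    refine tendsto_nhdsWithin_iff.mpr ⟨?_, Eventually.of_forall fun n ↦ (ℜ (u n)).2⟩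
    have h1 : Continuous fun e : A ↦ (ℜ e : A) := by
      simp only [realPart_apply_coe]
      fun_prop
    simpa [Function.comp_def, hds.coe_realPart] using (h1.tendsto d).comp hud
  have hFlim : Tendsto (fun n ↦ ‖y - F (ℜ (u n))‖) atTop (𝓝 ‖y - F d‖) :=
    (tendsto_const_nhds.sub ((hFc d hds).tendsto.comp hlim)).norm
  obtain ⟨n, hn⟩ := (hFlim.eventually_lt_const (hFd ▸ hh)).exists
  set r : A := (ℜ (v n) : A) with hr
  set e : A := (ℜ (u n) : A) with he
  have hes : IsSelfAdjoint e := (ℜ (u n)).2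
  have hea : e = a * r * a := by
    simp only [he, hr, realPart_apply_coe, hv n, star_mul, has, mul_smul_comm, smul_mul_assoc,
      mul_add, add_mul, mul_assoc]
  have hFe : a * (-(r * a * e⁻ * (y * h) * e⁺ * a * r)) * a = F e := by
    simp only [hF, hes.posPart_mul_self, hes.negPart_mul_self]
    have : ∀ p q : A, -(e * p) * (y * h) * (q * e) =
        -((a * r * a) * p * (y * h) * (q * (a * r * a))) := fun p q ↦ by
      rw [hea]; noncomm_ring
    rw [this]
    noncomm_ring
  refine ⟨-(r * a * e⁻ * (y * h) * e⁺ * a * r), ?_, ?_⟩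
  · rw [hFe]
    calc F e * F e = e⁻ * e⁻ * (y * h) * e⁺ * (e⁺ * e⁻) * (e⁻ * (y * h) * (e⁺ * e⁺)) := by
          simp only [hF, mul_assoc]
      _ = 0 := by simp
  · rw [hFe]
    exact hn
end

section
/- Let A be a C*-algebra. Then the following are equivalent: (1) A is nowhere scattered; (2) for every positive a ∈ A there exists a positive b ∈ A with ‖a − b‖ < 1/2 such that the hereditary sub-C*-algebra cl((b−1/2)₊ A (b−1/2)₊) admits no character; (3) for every positive a ∈ A there exist a positive b ∈ A with ‖a − b‖ < 1/2 and a countable subset G ⊆ A such that ((b−1/2)₊ x (b−1/2)₊)² = 0 for each x ∈ G and (b−1/2)₊ belongs to the closed *-subalgebra of A generated by {(b−1/2)₊ x (b−1/2)₊ : x ∈ G}. -/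
section Cutdown

variable {A : Type*} [NonUnitalCStarAlgebra A] [PartialOrder A] [StarOrderedRing A]

/-- The cut-down `(b - 1/2)₊`, obtained from `b` by continuous functional calculus with
the function `t ↦ max (t - 1/2) 0`. -/
noncomputable def cutdown (b : A) : A :=
  cfcₙ (fun t : ℝ => max (t - 1 / 2) 0) b

lemma cutdown_isSelfAdjoint (b : A) : IsSelfAdjoint (cutdown b) :=
  cfcₙ_predicate _ b

end Cutdown

section Auxiliary

open Filter Topology

lemma exists_cutoff {ε : ℝ} (hε : 0 < ε) :
    ∃ k : ℝ → ℝ, Continuous k ∧ k 0 = 0 ∧ (∀ t, 0 ≤ k t * t) ∧ (∀ t, k t * t ≤ 1) ∧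
      ∀ t, |t * (1 - k t * t) ^ 2| ≤ ε := by
  have hm (t : ℝ) : 0 < max (ε ^ 2) (t ^ 2) := lt_max_of_lt_left (by positivity)
  have hk (t : ℝ) : t / max (ε ^ 2) (t ^ 2) * t = t ^ 2 / max (ε ^ 2) (t ^ 2) := by ring
  have hg0 (t : ℝ) : 0 ≤ t / max (ε ^ 2) (t ^ 2) * t := by
    rw [hk]; exact div_nonneg (sq_nonneg t) (hm t).le
  have hg1 (t : ℝ) : t / max (ε ^ 2) (t ^ 2) * t ≤ 1 := by
    rw [hk]; exact div_le_one_of_le₀ (le_max_right _ _) (hm t).le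
  refine ⟨fun t ↦ t / max (ε ^ 2) (t ^ 2),
    continuous_id.div (by fun_prop) fun t ↦ (hm t).ne', by simp, hg0, hg1, fun t ↦ ?_⟩
  rw [abs_mul, abs_sq]
  rcases le_or_gt |t| ε with ht | ht
  · have : (1 - t / max (ε ^ 2) (t ^ 2) * t) ^ 2 ≤ 1 := by nlinarith [hg0 t, hg1 t]
    nlinarith [abs_nonneg t]
  · have ht0 : t ≠ 0 := abs_pos.mp (hε.trans ht)
    have : max (ε ^ 2) (t ^ 2) = t ^ 2 := max_eq_right (by rw [← sq_abs t]; gcongr)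
    have : t / max (ε ^ 2) (t ^ 2) * t = 1 := by rw [this]; field_simp
    simp [this, hε.le]

section General

variable {B : Type*} [NonUnitalCStarAlgebra B]

lemma exists_norm_sub_mul_star_mul_self_le (z : B) {ε : ℝ} (hε : 0 < ε) :
    ∃ y : B, IsSelfAdjoint y ∧ Commute y (star z * z) ∧ ‖y * (star z * z)‖ ≤ 1 ∧
      ‖z - z * (y * (star z * z))‖ ≤ ε := by
  obtain ⟨k, hk, hk0, hg0, hg1, hb⟩ := exists_cutoff (show 0 < ε ^ 2 by positivity)
  set a := star z * z with ha
  have hsa : IsSelfAdjoint a := .star_mul_self z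
  have hid : cfcₙ (fun t : ℝ ↦ t) a = a := cfcₙ_id' ℝ a
  have hya : cfcₙ k a * a = cfcₙ (fun t ↦ k t * t) a := by
    rw [cfcₙ_mul k (fun t ↦ t) a, hid]
  have hcomm : Commute (cfcₙ k a) a := (Commute.refl a).cfcₙ_real k
  refine ⟨cfcₙ k a, cfcₙ_predicate k a, hcomm, ?_, ?_⟩
  · rw [hya]
    refine norm_cfcₙ_le fun t _ ↦ ?_
    rw [Real.norm_of_nonneg (hg0 t)]
    exact hg1 t
  · rw [← sq_le_sq₀ (norm_nonneg _) hε.le, sq, ← CStarRing.norm_star_mul_self]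
    have h1 : IsSelfAdjoint (cfcₙ k a * a) := by rw [hya]; exact cfcₙ_predicate _ a
    have e1 : a * (cfcₙ k a * a) = cfcₙ (fun t ↦ t * (k t * t)) a := by
      rw [hya, cfcₙ_mul (fun t ↦ t) (fun t ↦ k t * t) a, hid]
    have e2 : (cfcₙ k a * a) * a = cfcₙ (fun t ↦ k t * t * t) a := by
      rw [hya, cfcₙ_mul (fun t ↦ k t * t) (fun t ↦ t) a, hid]
    have e3 : (cfcₙ k a * a) * a * (cfcₙ k a * a) =
        cfcₙ (fun t ↦ k t * t * t * (k t * t)) a := by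
      rw [e2, hya, cfcₙ_mul (fun t ↦ k t * t * t) (fun t ↦ k t * t) a]
    have h2 : cfcₙ (fun t ↦ t * (1 - k t * t) ^ 2) a =
        a - a * (cfcₙ k a * a) - (cfcₙ k a * a) * a + (cfcₙ k a * a) * a * (cfcₙ k a * a) := by
      rw [e3, e2, e1]
      nth_rw 2 [← hid]
      rw [← cfcₙ_sub (fun t ↦ t) (fun t ↦ t * (k t * t)) a, ← cfcₙ_sub _ _ a,
        ← cfcₙ_add _ _ a]
      exact cfcₙ_congr fun t _ ↦ by ring
    have h3 : star (z - z * (cfcₙ k a * a)) * (z - z * (cfcₙ k a * a)) =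
        cfcₙ (fun t ↦ t * (1 - k t * t) ^ 2) a := by
      rw [h2, star_sub, star_mul, h1.star_eq, ha]
      noncomm_ring
    rw [h3]
    exact norm_cfcₙ_le fun t _ ↦ hb t

lemma exists_norm_sub_self_mul_star_mul_le (z : B) {ε : ℝ} (hε : 0 < ε) :
    ∃ y : B, ‖z - z * star z * y * z‖ ≤ ε := by
  obtain ⟨y, hy, hc, -, h⟩ := exists_norm_sub_mul_star_mul_self_le (star z) hε
  refine ⟨y, ?_⟩
  rw [← norm_star] at h
  simpa [hy.star_eq, mul_assoc] using h

lemma continuousOn_posPart : ContinuousOn (fun a : B ↦ a⁺) {a | IsSelfAdjoint a} :=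
  ContinuousOn.cfcₙ_of_mem_nhdsSet (s := Set.univ) _ univ_mem continuousOn_id (fun _ h ↦ h)

lemma continuousOn_negPart : ContinuousOn (fun a : B ↦ a⁻) {a | IsSelfAdjoint a} :=
  ContinuousOn.cfcₙ_of_mem_nhdsSet (s := Set.univ) _ univ_mem continuousOn_id (fun _ h ↦ h)

end General

section SquareZero

variable {B : Type*} [NonUnitalCStarAlgebra B]

open Unitization in
lemma commutator_mem_of_mul_self_eq_zero {W : NonUnitalStarSubalgebra ℂ B}
    (hW : IsClosed (W : Set B)) (h : ∀ z : B, z * z = 0 → z ∈ W) (x : B) {z : B}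
    (hz : z * z = 0) : x * z - z * x ∈ W := by
  have hcl : IsClosed ((↑) '' (W : Set B) : Set (Unitization ℂ B)) :=
    isometry_inr.isClosedEmbedding.isClosedMap _ hW
  let F : ℂ → Unitization ℂ B := fun t ↦
    (x * z - z * x : B) * Ring.inverse (1 + t • (x : Unitization ℂ B))
  have hF : Tendsto F (𝓝[≠] 0) (𝓝 ((x * z - z * x : B) : Unitization ℂ B)) := by
    have h1 : ContinuousAt F 0 := by
      refine continuousAt_const.mul (ContinuousAt.comp (g := Ring.inverse) ?_ (by fun_prop))
      simpa using NormedRing.inverse_continuousAt (1 : (Unitization ℂ B)ˣ)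
    have h2 : F 0 = ((x * z - z * x : B) : Unitization ℂ B) := by simp [F]
    rw [← h2]
    exact h1.tendsto.mono_left nhdsWithin_le_nhds
  have hu : ∀ᶠ t : ℂ in 𝓝 0, IsUnit (1 + t • (x : Unitization ℂ B)) := by
    have : ContinuousAt (fun t : ℂ ↦ 1 + t • (x : Unitization ℂ B)) 0 := by fun_prop
    refine this.eventually (p := IsUnit) (Units.isOpen.mem_nhds ?_)
    simp
  have hmem : ∀ᶠ t in 𝓝[≠] 0, F t ∈ ((↑) '' (W : Set B) : Set (Unitization ℂ B)) := by
    filter_upwards [hu.filter_mono nhdsWithin_le_nhds, self_mem_nhdsWithin] with t ht ht0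
    obtain ⟨u, hu⟩ := ht
    set X : Unitization ℂ B := Unitization.inr x
    set Z : Unitization ℂ B := Unitization.inr z with hZ
    have hZZ : Z * Z = 0 := by rw [hZ, ← inr_mul, hz, inr_zero]
    have hb : ((u * Z * (↑u⁻¹ : Unitization ℂ B)).snd : Unitization ℂ B) = u * Z * ↑u⁻¹ :=
      Unitization.ext (by simp [hZ]) (by simp)
    set b := (u * Z * (↑u⁻¹ : Unitization ℂ B)).snd
    have hbb : b * b = 0 := by
      apply inr_injective (R := ℂ)
      rw [inr_mul, hb, inr_zero]
      calc u * Z * (↑u⁻¹ : Unitization ℂ B) * (u * Z * ↑u⁻¹)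
          = u * Z * ((↑u⁻¹ : Unitization ℂ B) * u) * Z * ↑u⁻¹ := by noncomm_ring
        _ = u * (Z * Z) * ↑u⁻¹ := by simp [mul_assoc]
        _ = 0 := by simp [hZZ]
    refine ⟨t⁻¹ • (b - z), SMulMemClass.smul_mem _ (sub_mem (h b hbb) (h z hz)), ?_⟩
    rw [inr_smul, inr_sub, hb, inv_smul_eq_iff₀ ht0]
    simp only [F]
    rw [← hu, Ring.inverse_unit, inr_sub, inr_mul, inr_mul]
    calc u * Z * (↑u⁻¹ : Unitization ℂ B) - Z
        = (u * Z - Z * u) * ↑u⁻¹ := by simp [sub_mul, mul_assoc]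
      _ = (t • (X * Z - Z * X)) * ↑u⁻¹ := by
        rw [hu]; congr 1; simp [add_mul, mul_add, smul_sub]
      _ = _ := by rw [smul_mul_assoc]
  obtain ⟨w, hw, hwe⟩ := hcl.mem_of_tendsto hF hmem
  rwa [← inr_injective hwe]

variable (B) in
/-- The C*-subalgebra generated by the square-zero elements. -/
def sqZeroSubalgebra : NonUnitalStarSubalgebra ℂ B :=
  (NonUnitalStarAlgebra.adjoin ℂ {z : B | z * z = 0}).topologicalClosure

lemma isClosed_sqZeroSubalgebra : IsClosed (sqZeroSubalgebra B : Set B) := isClosed_closure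

lemma mem_sqZeroSubalgebra {z : B} (hz : z * z = 0) : z ∈ sqZeroSubalgebra B :=
  NonUnitalStarSubalgebra.le_topologicalClosure _ (NonUnitalStarAlgebra.subset_adjoin ℂ _ hz)

lemma commutator_mem_sqZeroSubalgebra {w : B} (hw : w ∈ sqZeroSubalgebra B) (x : B) :
    x * w - w * x ∈ sqZeroSubalgebra B := by
  have hadj : ∀ w ∈ NonUnitalStarAlgebra.adjoin ℂ {z : B | z * z = 0}, ∀ x : B,
      x * w - w * x ∈ sqZeroSubalgebra B := by
    intro w hw
    have hle {v : B} (hv : v ∈ NonUnitalStarAlgebra.adjoin ℂ {z : B | z * z = 0}) :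
      v ∈ sqZeroSubalgebra B := NonUnitalStarSubalgebra.le_topologicalClosure _ hv
    induction hw using NonUnitalStarAlgebra.adjoin_induction with
    | mem z hz =>
      exact fun x ↦ commutator_mem_of_mul_self_eq_zero isClosed_sqZeroSubalgebra
        (fun _ ↦ mem_sqZeroSubalgebra) x hz
    | add a b _ _ ha hb =>
      intro x
      convert add_mem (ha x) (hb x) using 1
      noncomm_ring
    | zero => simp
    | mul a b ha' hb' ha hb =>
      intro x
      convert add_mem (mul_mem (ha x) (hle hb')) (mul_mem (hle ha') (hb x)) using 1
      noncomm_ring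
    | smul r a _ ha =>
      intro x
      convert SMulMemClass.smul_mem r (ha x) using 1
      simp [smul_sub, mul_smul_comm, smul_mul_assoc]
    | star a _ ha =>
      intro x
      convert neg_mem (star_mem (ha (star x))) using 1
      simp
  exact closure_minimal (t := {w | x * w - w * x ∈ sqZeroSubalgebra B}) (fun w hw ↦ hadj w hw x)
    (isClosed_sqZeroSubalgebra.preimage (by fun_prop)) hw

lemma commutator_mul_mem_sqZeroSubalgebra {v w : B} (hv : v ∈ sqZeroSubalgebra B)
    (hw : w ∈ sqZeroSubalgebra B) (x : B) : (v * w - w * v) * x ∈ sqZeroSubalgebra B := by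
  convert sub_mem (neg_mem (commutator_mem_sqZeroSubalgebra hv (w * x)))
    (mul_mem hw (neg_mem (commutator_mem_sqZeroSubalgebra hv x))) using 1
  noncomm_ring

lemma mul_commutator_mul_mem_sqZeroSubalgebra {v w : B} (hv : v ∈ sqZeroSubalgebra B)
    (hw : w ∈ sqZeroSubalgebra B) (y x : B) :
    y * (v * w - w * v) * x ∈ sqZeroSubalgebra B := by
  convert add_mem (add_mem (commutator_mul_mem_sqZeroSubalgebra hv hw (y * x))
    (commutator_mul_mem_sqZeroSubalgebra (commutator_mem_sqZeroSubalgebra hv y) hw x))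
    (commutator_mul_mem_sqZeroSubalgebra hv (commutator_mem_sqZeroSubalgebra hw y) x) using 1
  noncomm_ring

lemma mul_mem_sqZeroSubalgebra_of_mul_self_eq_zero {z : B} (hz : z * z = 0) (x : B) :
    z * x ∈ sqZeroSubalgebra B ∧ ∀ y, y * z * x ∈ sqZeroSubalgebra B := by
  have hzW := mem_sqZeroSubalgebra hz
  have key (y x : B) : y * (z * (star z * z)) * x ∈ sqZeroSubalgebra B := by
    convert mul_commutator_mul_mem_sqZeroSubalgebra (star_mem hzW) hzW (y * z) x using 1
    simp only [mul_assoc, mul_sub, sub_mul]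
    simp [← mul_assoc, hz]
  have key' (x : B) : z * (star z * z) * x ∈ sqZeroSubalgebra B := by
    convert mul_commutator_mul_mem_sqZeroSubalgebra (star_mem hzW) hzW z x using 1
    simp [mul_sub, ← mul_assoc, hz]
  have hcl : z ∈ closure {w | ∃ y, w = z * (star z * z) * y} := by
    refine Metric.mem_closure_iff.mpr fun ε hε ↦ ?_
    obtain ⟨y, -, hc, -, h⟩ := exists_norm_sub_mul_star_mul_self_le z (half_pos hε)
    refine ⟨_, ⟨y, rfl⟩, ?_⟩
    rw [dist_eq_norm, mul_assoc, ← hc.eq]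
    linarith
  refine ⟨?_, fun y ↦ ?_⟩
  · refine closure_minimal (t := {w | w * x ∈ sqZeroSubalgebra B}) ?_
      (isClosed_sqZeroSubalgebra.preimage (by fun_prop)) hcl
    rintro _ ⟨y, rfl⟩
    simpa [mul_assoc] using key' (y * x)
  · refine closure_minimal (t := {w | y * w * x ∈ sqZeroSubalgebra B}) ?_
      (isClosed_sqZeroSubalgebra.preimage (by fun_prop)) hcl
    rintro _ ⟨y', rfl⟩
    simpa [mul_assoc] using key y (y' * x)

end SquareZero

section LeftIdeal

variable {U : Type*} [CStarAlgebra U] {L : Ideal U}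

lemma exists_real_sub_algebraMap_mem (hL : IsClosed (L : Set U))
    (h : ∀ a : U, IsSelfAdjoint a → a⁺ ∈ L ∨ a⁻ ∈ L) {a : U} (ha : IsSelfAdjoint a) :
    ∃ s : ℝ, a - algebraMap ℝ U s ∈ L := by
  let _ := CStarAlgebra.spectralOrder U
  let _ := CStarAlgebra.spectralOrderedRing U
  have hsa (s : ℝ) : IsSelfAdjoint (a - algebraMap ℝ U s) := ha.sub (.algebraMap _ (.all s))
  have hc : Continuous fun s : ℝ ↦ a - algebraMap ℝ U s := by fun_prop
  have hpos : IsClosed {s : ℝ | (a - algebraMap ℝ U s)⁺ ∈ L} :=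
    hL.preimage (continuousOn_posPart.comp_continuous hc hsa)
  have hneg : IsClosed {s : ℝ | (a - algebraMap ℝ U s)⁻ ∈ L} :=
    hL.preimage (continuousOn_negPart.comp_continuous hc hsa)
  obtain ⟨s, -, h1, h2⟩ := isPreconnected_closed_iff.mp isPreconnected_univ _ _ hpos hneg
    (fun s _ ↦ h _ (hsa s))
    ⟨‖a‖, trivial, by
      have : (a - algebraMap ℝ U ‖a‖)⁺ = 0 :=
        (CFC.posPart_eq_zero_iff _ (hsa _)).mpr (sub_nonpos.mpr ha.le_algebraMap_norm_self)
      simp [this]⟩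
    ⟨-‖a‖, trivial, by
      have : (a - algebraMap ℝ U (-‖a‖))⁻ = 0 :=
        (CFC.negPart_eq_zero_iff _ (hsa _)).mpr
          (sub_nonneg.mpr (by simpa using ha.neg_algebraMap_norm_le_self))
      simp only [Set.mem_ofPred_eq]
      rw [this]
      exact zero_mem L⟩
  exact ⟨s, by rw [← CFC.posPart_sub_negPart _ (hsa s)]; exact sub_mem h1 h2⟩

lemma exists_algHom_sub_algebraMap_mem (hL : IsClosed (L : Set U)) (hne : L ≠ ⊤)
    (h : ∀ a : U, IsSelfAdjoint a → a⁺ ∈ L ∨ a⁻ ∈ L) :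
    ∃ φ : U →ₐ[ℂ] ℂ, ∀ x, x - algebraMap ℂ U (φ x) ∈ L := by
  have hex (x : U) : ∃ s : ℂ, x - algebraMap ℂ U s ∈ L := by
    obtain ⟨s, hs⟩ := exists_real_sub_algebraMap_mem hL h (realPart x).2
    obtain ⟨t, ht⟩ := exists_real_sub_algebraMap_mem hL h (imaginaryPart x).2
    refine ⟨s + t * Complex.I, ?_⟩
    convert add_mem hs (L.mul_mem_left (algebraMap ℂ U Complex.I) ht) using 1
    conv_lhs => rw [← realPart_add_I_smul_imaginaryPart x]
    simp only [Algebra.algebraMap_eq_smul_one, smul_one_mul, add_smul, smul_sub,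
      mul_comm _ Complex.I, mul_smul, Complex.coe_smul]
    abel
  have huniq {s : ℂ} (hs : algebraMap ℂ U s ∈ L) : s = 0 := by
    by_contra h0
    refine hne ((Ideal.eq_top_iff_one L).mpr ?_)
    convert L.mul_mem_left (algebraMap ℂ U s⁻¹) hs using 1
    rw [← map_mul, inv_mul_cancel₀ h0, map_one]
  choose φ hφ using hex
  have heq {x : U} {s : ℂ} (hs : x - algebraMap ℂ U s ∈ L) : φ x = s := by
    refine sub_eq_zero.mp (huniq ?_)
    convert sub_mem hs (hφ x) using 1
    rw [map_sub]
    abel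
  refine ⟨AlgHom.ofLinearMap
    { toFun := φ
      map_add' := fun x y ↦ heq ?_
      map_smul' := fun r x ↦ heq ?_ } (heq (by simp)) fun x y ↦ heq ?_, hφ⟩
  · convert add_mem (hφ x) (hφ y) using 1
    rw [map_add]
    abel
  · convert L.mul_mem_left (algebraMap ℂ U r) (hφ x) using 1
    simp [mul_sub, Algebra.smul_def]
  · convert add_mem (L.mul_mem_left x (hφ y)) (L.mul_mem_left (algebraMap ℂ U (φ y)) (hφ x))
      using 1
    simp only [LinearMap.coe_mk, AddHom.coe_mk, mul_sub, map_mul]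
    rw [Algebra.commutes (φ y) x, ← Algebra.commutes (φ y) (algebraMap ℂ U (φ x))]
    abel

end LeftIdeal

section Characters

variable {B : Type*} [NonUnitalCStarAlgebra B]

lemma exists_norm_sub_le_and_mul_eq {c : B} (hc : IsSelfAdjoint c) {ε : ℝ} (hε : 0 < ε) :
    ∃ f g : B, g * f = f ∧ ‖c - f‖ ≤ ε := by
  refine ⟨cfcₙ (fun t : ℝ ↦ t - max (-ε) (min ε t)) c, cfcₙ (fun t : ℝ ↦ min 1 (|t| / ε)) c,
    ?_, ?_⟩
  · rw [← cfcₙ_mul _ _ c (by fun_prop) (by simp) (by fun_prop) (by simp [hε.le])]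
    refine cfcₙ_congr fun t _ ↦ ?_
    rcases le_total |t| ε with ht | ht
    · rw [abs_le] at ht
      simp [ht]
    · rw [min_eq_left ((one_le_div₀ hε).mpr ht)]
      simp
  · nth_rw 1 [← cfcₙ_id' ℝ c]
    rw [← cfcₙ_sub _ _ c (by fun_prop) (by simp) (by fun_prop) (by simp [hε.le])]
    refine norm_cfcₙ_le fun t _ ↦ ?_
    rw [sub_sub_cancel, Real.norm_eq_abs, abs_le]
    exact ⟨le_max_left _ _, max_le (by linarith) (min_le_left _ _)⟩

open Unitization in
lemma exists_ne_zero_of_notMem_sqZeroSubalgebra {f g : B} (hgf : g * f = f)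
    (hf : f ∉ sqZeroSubalgebra B) : ∃ φ : B →⋆ₙₐ[ℂ] ℂ, φ ≠ 0 := by
  let L₀ : Ideal (Unitization ℂ B) :=
    { carrier := {u | ∀ v, ∃ w ∈ sqZeroSubalgebra B, (w : Unitization ℂ B) = v * u * (f : B)}
      zero_mem' := fun v ↦ ⟨0, zero_mem _, by simp⟩
      add_mem' := fun {a b} ha hb v ↦ by
        obtain ⟨w, hw, hwe⟩ := ha v
        obtain ⟨w', hw', hwe'⟩ := hb v
        exact ⟨w + w', add_mem hw hw', by simp [hwe, hwe', mul_add, add_mul]⟩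
      smul_mem' := fun u a ha v ↦ by
        obtain ⟨w, hw, hwe⟩ := ha (v * u)
        exact ⟨w, hw, by simp [hwe, mul_assoc]⟩ }
  have hL₀ : L₀ ≠ ⊤ := by
    intro h
    obtain ⟨w, hw, hwe⟩ := (Ideal.eq_top_iff_one L₀).mp h 1
    refine hf ?_
    rw [← inr_injective (R := ℂ) (show (w : Unitization ℂ B) = f by simpa using hwe)]
    exact hw
  have hg₀ : 1 - (g : Unitization ℂ B) ∈ L₀ := fun v ↦ ⟨0, zero_mem _, by
    rw [mul_assoc, sub_mul, ← inr_mul, hgf]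
    simp⟩
  have hz₀ {z : B} (hz : z * z = 0) : (z : Unitization ℂ B) ∈ L₀ := by
    intro v
    induction v with
    | inl_add_inr r v =>
      obtain ⟨h1, h2⟩ := mul_mem_sqZeroSubalgebra_of_mul_self_eq_zero hz f
      refine ⟨r • (z * f) + v * z * f, add_mem (SMulMemClass.smul_mem r h1) (h2 v), ?_⟩
      rw [add_mul, add_mul, inr_add, inr_smul, inr_mul, inr_mul, inr_mul, mul_assoc]
      congr 1
      rw [Algebra.smul_def, mul_assoc]
      rfl
  obtain ⟨L, hLmax, hL⟩ := Ideal.exists_le_maximal L₀ hL₀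
  have hdich (a : Unitization ℂ B) (ha : IsSelfAdjoint a) : a⁺ ∈ L ∨ a⁻ ∈ L := by
    by_contra! hcon
    obtain ⟨y, u, hu, hyu⟩ := hLmax.exists_inv hcon.2
    refine hcon.1 ?_
    have hzero : a⁺ * y * a⁻ * (a⁺ * y * a⁻) = 0 := by
      rw [show a⁺ * y * a⁻ * (a⁺ * y * a⁻) = a⁺ * y * (a⁻ * a⁺) * y * a⁻ by noncomm_ring,
        CFC.negPart_mul_posPart]
      simp
    have hfst : (a⁺ * y * a⁻).fst = 0 := by
      simpa using congrArg (fun u ↦ u.fst) hzero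
    have hinr : ((a⁺ * y * a⁻).snd : Unitization ℂ B) = a⁺ * y * a⁻ :=
      Unitization.ext (by rw [hfst]; simp) (by simp)
    have hmem : a⁺ * y * a⁻ ∈ L := by
      rw [← hinr]
      refine hL (hz₀ (inr_injective (R := ℂ) ?_))
      rw [inr_mul, hinr, hzero, inr_zero]
    have : a⁺ = a⁺ * y * a⁻ + a⁺ * u := by rw [mul_assoc, ← mul_add, hyu, mul_one]
    rw [this]
    exact add_mem hmem (L.mul_mem_left _ hu)
  obtain ⟨φ, hφ⟩ := exists_algHom_sub_algebraMap_mem Ideal.IsMaximal.isClosed hLmax.ne_top hdich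
  have hφg : φ g = 1 := by
    by_contra h1
    refine hLmax.ne_top (Ideal.eq_top_of_isUnit_mem L
      (x := algebraMap ℂ (Unitization ℂ B) (1 - φ g)) ?_
      (((isUnit_iff_ne_zero.mpr (sub_ne_zero.mpr (Ne.symm h1)))).map _))
    convert add_mem (hφ g) (hL hg₀) using 1
    rw [map_sub, map_one]
    abel
  refine ⟨{ toFun := fun x ↦ φ x
            map_smul' := fun r x ↦ by simp
            map_zero' := by simp
            map_add' := by simp
            map_mul' := by simp
            map_star' := fun x ↦ by rw [inr_star, map_star] }, fun h ↦ ?_⟩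
  exact one_ne_zero (hφg.symm.trans (DFunLike.congr_fun h g))

theorem sqZeroSubalgebra_eq_top (h : ∀ φ : B →⋆ₙₐ[ℂ] ℂ, φ = 0) : sqZeroSubalgebra B = ⊤ := by
  have hsa (c : B) (hc : IsSelfAdjoint c) : c ∈ sqZeroSubalgebra B := by
    refine isClosed_sqZeroSubalgebra.closure_subset (Metric.mem_closure_iff.mpr fun ε hε ↦ ?_)
    obtain ⟨f, g, hgf, hf⟩ := exists_norm_sub_le_and_mul_eq hc (half_pos hε)
    refine ⟨f, ?_, by rw [dist_eq_norm]; linarith⟩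
    by_contra hmem
    obtain ⟨φ, hφ⟩ := exists_ne_zero_of_notMem_sqZeroSubalgebra hgf hmem
    exact hφ (h φ)
  refine eq_top_iff.mpr fun x _ ↦ ?_
  rw [← realPart_add_I_smul_imaginaryPart x]
  exact add_mem (hsa _ (realPart x).2) (SMulMemClass.smul_mem _ (hsa _ (imaginaryPart x).2))

end Characters

section HereditarySub

variable {A : Type*} [NonUnitalCStarAlgebra A]

lemma mem_closure_mul_star_mul_self_cube (z : A) :
    z ∈ closure {w | ∃ y, w = z * y * (star z * z * (star z * z) * (star z * z))} := by
  refine Metric.mem_closure_iff.mpr fun ε hε ↦ ?_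
  obtain ⟨y, -, hc, h1, h⟩ :=
    exists_norm_sub_mul_star_mul_self_le z (show 0 < ε / 4 by positivity)
  refine ⟨_, ⟨y * y * y, rfl⟩, ?_⟩
  set p := star z * z
  have h2 : ‖(z - z * (y * p)) * (y * p)‖ ≤ ε / 4 :=
    (norm_mul_le _ _).trans (by nlinarith [norm_nonneg (z - z * (y * p)), norm_nonneg (y * p)])
  have h3 : ‖(z - z * (y * p)) * (y * p) * (y * p)‖ ≤ ε / 4 :=
    (norm_mul_le _ _).trans
      (by nlinarith [norm_nonneg ((z - z * (y * p)) * (y * p)), norm_nonneg (y * p)])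
  have he : y * p * (y * p) * (y * p) = y * y * y * (p * p * p) := by
    have h (a : A) : p * (y * a) = y * (p * a) := by rw [← mul_assoc, ← hc.eq, mul_assoc]
    simp only [mul_assoc, h]
  have : z - z * (y * y * y) * (p * p * p) = (z - z * (y * p)) +
      (z - z * (y * p)) * (y * p) + (z - z * (y * p)) * (y * p) * (y * p) := by
    rw [mul_assoc, ← he]
    noncomm_ring
  rw [dist_eq_norm, this]
  linarith [norm_add₃_le (a := z - z * (y * p)) (b := (z - z * (y * p)) * (y * p))
    (c := (z - z * (y * p)) * (y * p) * (y * p))]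

lemma exists_countable_subset_mem_topologicalClosure {S : Set A} {a : A}
    (ha : a ∈ (NonUnitalStarAlgebra.adjoin ℂ S).topologicalClosure) :
    ∃ T ⊆ S, T.Countable ∧ a ∈ (NonUnitalStarAlgebra.adjoin ℂ T).topologicalClosure := by
  have hadj (b : A) (hb : b ∈ NonUnitalStarAlgebra.adjoin ℂ S) :
      ∃ T ⊆ S, T.Countable ∧ b ∈ NonUnitalStarAlgebra.adjoin ℂ T := by
    induction hb using NonUnitalStarAlgebra.adjoin_induction with
    | mem z hz =>
      exact ⟨{z}, by simpa using hz, by simp, NonUnitalStarAlgebra.subset_adjoin ℂ _ rfl⟩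
    | add a b _ _ ha hb =>
      obtain ⟨T, hT, hTc, haT⟩ := ha
      obtain ⟨T', hT', hTc', hbT⟩ := hb
      exact ⟨T ∪ T', Set.union_subset hT hT', hTc.union hTc',
        add_mem (NonUnitalStarAlgebra.adjoin_mono Set.subset_union_left haT)
          (NonUnitalStarAlgebra.adjoin_mono Set.subset_union_right hbT)⟩
    | zero => exact ⟨∅, by simp, by simp, zero_mem _⟩
    | mul a b _ _ ha hb =>
      obtain ⟨T, hT, hTc, haT⟩ := ha
      obtain ⟨T', hT', hTc', hbT⟩ := hb
      exact ⟨T ∪ T', Set.union_subset hT hT', hTc.union hTc',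
        mul_mem (NonUnitalStarAlgebra.adjoin_mono Set.subset_union_left haT)
          (NonUnitalStarAlgebra.adjoin_mono Set.subset_union_right hbT)⟩
    | smul r a _ ha =>
      obtain ⟨T, hT, hTc, haT⟩ := ha
      exact ⟨T, hT, hTc, SMulMemClass.smul_mem r haT⟩
    | star a _ ha =>
      obtain ⟨T, hT, hTc, haT⟩ := ha
      exact ⟨T, hT, hTc, star_mem haT⟩
  obtain ⟨u, hu, hua⟩ := mem_closure_iff_seq_limit.mp ha
  choose T hT hTc hTu using fun n ↦ hadj (u n) (hu n)
  exact ⟨⋃ n, T n, Set.iUnion_subset hT, Set.countable_iUnion hTc,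
    mem_closure_of_tendsto hua <| .of_forall fun n ↦
      NonUnitalStarAlgebra.adjoin_mono (Set.subset_iUnion T n) (hTu n)⟩

variable {c : A} (hc : IsSelfAdjoint c)

instance isClosed_hereditarySub_s5 : IsClosed (hereditarySub c hc : Set A) := isClosed_closure

lemma mul_mul_self_mem_hereditarySub (x : A) : c * x * c ∈ hereditarySub c hc :=
  subset_closure ⟨x, rfl⟩

lemma self_mem_hereditarySub_s5 : c ∈ hereditarySub c hc := by
  refine Metric.mem_closure_iff.mpr fun ε hε ↦ ?_
  obtain ⟨y, hy⟩ := exists_norm_sub_self_mul_star_mul_le c (half_pos hε)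
  refine ⟨_, ⟨star c * y, rfl⟩, ?_⟩
  rw [dist_eq_norm, ← mul_assoc]
  linarith

variable {hc}

lemma mul_negPart_mul_mul_posPart_mul_mem {W : NonUnitalStarSubalgebra ℂ A}
    (hWcl : IsClosed (W : Set A))
    (hW : ∀ x, (c * x * c) * (c * x * c) = 0 → c * x * c ∈ W)
    {h : A} (hh : IsSelfAdjoint h)
    (hmem : h ∈ hereditarySub c hc) (x : A) : h * h⁻ * h * x * (h * h⁺ * h) ∈ W := by
  obtain ⟨u, hu, hua⟩ := mem_closure_iff_seq_limit.mp hmem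
  have hre : Tendsto (fun n ↦ (realPart (u n) : A)) atTop (𝓝 h) := by
    have : Continuous fun a : A ↦ (realPart a : A) := by
      simp only [realPart_apply_coe]
      fun_prop
    simpa only [hh.coe_realPart, Function.comp_def] using (this.tendsto h).comp hua
  have hsa (n : ℕ) : IsSelfAdjoint (realPart (u n) : A) := (realPart (u n)).2
  have hre' : Tendsto (fun n ↦ (realPart (u n) : A)) atTop (𝓝[{a | IsSelfAdjoint a}] h) :=
    tendsto_nhdsWithin_of_tendsto_nhds_of_eventually_within _ hre (.of_forall hsa)
  have hp := (continuousOn_posPart h hh).tendsto.comp hre'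
  have hn := (continuousOn_negPart h hh).tendsto.comp hre'
  refine hWcl.mem_of_tendsto
    ((((hre.mul hn).mul hre).mul_const x).mul ((hre.mul hp).mul hre)) (.of_forall fun n ↦ ?_)
  obtain ⟨y, hy⟩ : ∃ y, (realPart (u n) : A) = c * y * c := by
    obtain ⟨y, hy⟩ := hu n
    refine ⟨(realPart y : A), ?_⟩
    simp [realPart_apply_coe, hy, mul_add, add_mul, mul_smul_comm, smul_mul_assoc, hc.star_eq,
      mul_assoc]
  simp only [Function.comp_apply]
  set k := (realPart (u n) : A) with hk
  have hz : k * k⁺ * k * (k * k⁻ * k) = 0 := by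
    have : k⁺ * k * k * k⁻ = 0 := by
      nth_rw 2 3 [← CFC.posPart_sub_negPart k (hsa n)]
      simp only [mul_sub, sub_mul, mul_assoc, CFC.posPart_mul_negPart]
      simp [← mul_assoc]
    rw [show k * k⁺ * k * (k * k⁻ * k) = k * (k⁺ * k * k * k⁻) * k by noncomm_ring, this]
    simp
  have he : k * k⁻ * k * x * (k * k⁺ * k) =
      c * (y * c * k⁻ * k * x * k * k⁺ * c * y) * c := by
    have h (a : A) : k * a * k = c * y * c * a * (c * y * c) := by rw [hy]
    simpa only [mul_assoc] using h (k⁻ * k * x * (k * k⁺))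
  rw [he]
  refine hW _ ?_
  rw [← he, show k * k⁻ * k * x * (k * k⁺ * k) * (k * k⁻ * k * x * (k * k⁺ * k)) =
    k * k⁻ * k * x * (k * k⁺ * k * (k * k⁻ * k)) * x * (k * k⁺ * k) by noncomm_ring, hz]
  simp

variable [PartialOrder A] [StarOrderedRing A]

lemma cube_mul_mul_cube_mem {W : NonUnitalStarSubalgebra ℂ A} (hWcl : IsClosed (W : Set A))
    (hW : ∀ x, (c * x * c) * (c * x * c) = 0 → c * x * c ∈ W)
    {p q : A} (hp : 0 ≤ p) (hq : 0 ≤ q) (hpq : p * q = 0)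
    (hqp : q * p = 0) (hpB : p ∈ hereditarySub c hc) (hqB : q ∈ hereditarySub c hc) (x : A) :
    q * q * q * x * (p * p * p) ∈ W := by
  obtain ⟨h1, h2⟩ := CFC.posPart_negPart_unique (a := p - q) rfl hpq hp hq
  convert mul_negPart_mul_mul_posPart_mul_mem hWcl hW
    ((IsSelfAdjoint.of_nonneg hp).sub (.of_nonneg hq)) (sub_mem hpB hqB) x using 2
  · simp [h2, mul_sub, sub_mul, hpq, mul_assoc q q p, hqp]
  · simp [h1, mul_sub, sub_mul, mul_assoc p p q, hpq, hqp]

lemma mem_of_mul_self_eq_zero {W : NonUnitalStarSubalgebra ℂ A} (hWcl : IsClosed (W : Set A))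
    (hW : ∀ x, (c * x * c) * (c * x * c) = 0 → c * x * c ∈ W)
    {z : A} (hz : z * z = 0) (hzB : z ∈ hereditarySub c hc) :
    z ∈ W := by
  have hz' : star z * star z = 0 := by rw [← star_mul, hz, star_zero]
  set q := z * star z with hq
  have key (x : A) : q * q * q * x * z ∈ W := by
    refine closure_minimal (t := {w | q * q * q * x * w ∈ W}) ?_
      (hWcl.preimage (by fun_prop)) (mem_closure_mul_star_mul_self_cube z)
    rintro _ ⟨y, rfl⟩
    have := cube_mul_mul_cube_mem hWcl hW (star_mul_self_nonneg z) (mul_star_self_nonneg z)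
      (by rw [mul_assoc, ← mul_assoc z z, hz]; simp)
      (by rw [mul_assoc, ← mul_assoc (star z), hz']; simp)
      (mul_mem (star_mem hzB) hzB) (mul_mem hzB (star_mem hzB)) (x * (z * y))
    simpa only [hq, Set.mem_ofPred_eq, mul_assoc] using this
  have := closure_minimal (t := {w | star w ∈ W}) ?_ (hWcl.preimage (by fun_prop))
    (mem_closure_mul_star_mul_self_cube (star z))
  · simpa using this
  · rintro _ ⟨y, rfl⟩
    simpa [mul_assoc, hq] using key (star y)

lemma hereditarySub_le_of_not_admitsCharacter {W : NonUnitalStarSubalgebra ℂ A}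
    (hWcl : IsClosed (W : Set A))
    (hW : ∀ x, (c * x * c) * (c * x * c) = 0 → c * x * c ∈ W)
    (h : ¬ (hereditarySub c hc).AdmitsCharacter) :
    hereditarySub c hc ≤ W := by
  have htop : sqZeroSubalgebra (hereditarySub c hc) = ⊤ :=
    sqZeroSubalgebra_eq_top fun φ ↦ by
      by_contra hφ
      exact h ⟨φ, hφ⟩
  intro b hb
  have hmem : (⟨b, hb⟩ : hereditarySub c hc) ∈ sqZeroSubalgebra (hereditarySub c hc) := by
    simp [htop]
  refine closure_minimal (t := {b : hereditarySub c hc | (b : A) ∈ W}) ?_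
    (hWcl.preimage continuous_subtype_val) hmem
  refine NonUnitalStarAlgebra.adjoin_le
    (S := W.comap (NonUnitalStarSubalgebraClass.subtype (hereditarySub c hc))) fun z hz ↦ ?_
  exact mem_of_mul_self_eq_zero hWcl hW (congrArg Subtype.val hz) z.2

end HereditarySub

section Hereditary

variable {A : Type*} [NonUnitalCStarAlgebra A]

lemma isClosed_map_subtype_equalizer_zero {B : NonUnitalStarSubalgebra ℂ A}
    (hB : IsClosed (B : Set A)) (φ : B →⋆ₙₐ[ℂ] ℂ) :
    IsClosed (((NonUnitalStarAlgHom.equalizer φ (0 : B →⋆ₙₐ[ℂ] ℂ)).map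
      (NonUnitalStarSubalgebraClass.subtype B) : NonUnitalStarSubalgebra ℂ A) : Set A) := by
  have hφ : Continuous φ := AddMonoidHomClass.continuous_of_bound φ 1 fun x ↦ by
    simpa using NonUnitalStarAlgHom.norm_apply_le φ x
  exact hB.isClosedEmbedding_subtypeVal.isClosedMap _ (isClosed_eq hφ continuous_const)

variable {c : A} {hc : IsSelfAdjoint c}

lemma not_admitsCharacter_of_mem_topologicalClosure_adjoin_s5 {S : Set A}
    (hS : S ⊆ hereditarySub c hc) (hzero : ∀ z ∈ S, z * z = 0)
    (hcS : c ∈ (NonUnitalStarAlgebra.adjoin ℂ S).topologicalClosure) :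
    ¬ (hereditarySub c hc).AdmitsCharacter := by
  rintro ⟨φ, hφ⟩
  refine hφ ?_
  set K : NonUnitalStarSubalgebra ℂ A := (NonUnitalStarAlgHom.equalizer φ
    (0 : hereditarySub c hc →⋆ₙₐ[ℂ] ℂ)).map (NonUnitalStarSubalgebraClass.subtype _)
  have hK : IsClosed (K : Set A) :=
    isClosed_map_subtype_equalizer_zero (isClosed_hereditarySub_s5 hc) φ
  have hcK : c ∈ K := by
    refine closure_minimal ?_ hK hcS
    refine NonUnitalStarAlgebra.adjoin_le (S := K) fun z hz ↦ ⟨⟨z, hS hz⟩, ?_, rfl⟩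
    change φ _ = 0
    rw [← mul_self_eq_zero, ← map_mul, ← map_zero φ]
    exact congrArg φ (Subtype.ext (hzero z hz))
  have hcl : c ∈ closure {w | ∃ y, w = c * (c * y * c)} := by
    refine Metric.mem_closure_iff.mpr fun ε hε ↦ ?_
    obtain ⟨y, hy⟩ := exists_norm_sub_self_mul_star_mul_le c (half_pos hε)
    refine ⟨_, ⟨y, rfl⟩, ?_⟩
    rw [hc.star_eq] at hy
    rw [dist_eq_norm, mul_assoc c y, ← mul_assoc c c, ← mul_assoc]
    linarith
  have hle : hereditarySub c hc ≤ K := by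
    refine closure_minimal ?_ hK
    rintro _ ⟨x, rfl⟩
    refine closure_minimal (t := {w | w * x * c ∈ K}) ?_ (hK.preimage (by fun_prop)) hcl
    rintro _ ⟨y, rfl⟩
    obtain ⟨c', h0, hc'⟩ := hcK
    have h1 := mul_mul_self_mem_hereditarySub hc (y * c * x)
    have h2 : φ (c' * ⟨_, h1⟩) = 0 := by rw [map_mul, show φ c' = 0 from h0, zero_mul]
    refine ⟨_, h2, ?_⟩
    change (c' : A) * _ = _
    rw [show (c' : A) = c from hc']
    simp only [mul_assoc]
  ext b
  obtain ⟨b', h0, hb'⟩ := hle b.2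
  rw [← Subtype.ext hb']
  exact h0

lemma mul_mul_mem_hereditarySub {b b' : A} (hb : b ∈ hereditarySub c hc)
    (hb' : b' ∈ hereditarySub c hc) (x : A) : b * x * b' ∈ hereditarySub c hc := by
  refine closure_minimal (t := {b | b * x * b' ∈ hereditarySub c hc}) ?_
    ((isClosed_hereditarySub_s5 hc).preimage (by fun_prop)) hb
  rintro _ ⟨y, rfl⟩
  refine closure_minimal (t := {b' | c * y * c * x * b' ∈ hereditarySub c hc}) ?_
    ((isClosed_hereditarySub_s5 hc).preimage (by fun_prop)) hb'
  rintro _ ⟨y', rfl⟩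
  simpa [mul_assoc] using mul_mul_self_mem_hereditarySub hc (y * c * x * c * y')

variable [PartialOrder A] [StarOrderedRing A]

lemma sqrt_mem_closure_mul {a b : A} (ha : 0 ≤ a) (hab : a ≤ b) :
    CFC.sqrt a ∈ closure {w | ∃ y, w = y * b} := by
  refine Metric.mem_closure_iff.mpr fun ε hε ↦ ?_
  have hb := ha.trans hab
  have hs {x : A} (hx : 0 ≤ x) (e : A) : star (CFC.sqrt x - CFC.sqrt x * e) *
      (CFC.sqrt x - CFC.sqrt x * e) = x - x * e - star e * x + star e * x * e := by
    have h1 : CFC.sqrt x * CFC.sqrt x = x := CFC.sqrt_mul_sqrt_self x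
    have h2 : star (CFC.sqrt x) = CFC.sqrt x :=
      (IsSelfAdjoint.of_nonneg (CFC.sqrt_nonneg x)).star_eq
    rw [star_sub, star_mul, h2]
    nth_rw 5 6 7 8 [← h1]
    noncomm_ring
  obtain ⟨y, -, -, -, hy⟩ := exists_norm_sub_mul_star_mul_self_le (CFC.sqrt b) (half_pos hε)
  rw [(IsSelfAdjoint.of_nonneg (CFC.sqrt_nonneg b)).star_eq, CFC.sqrt_mul_sqrt_self b] at hy
  refine ⟨_, ⟨CFC.sqrt a * y, rfl⟩, ?_⟩
  rw [dist_eq_norm, mul_assoc]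
  refine lt_of_le_of_lt (le_trans ?_ hy) (half_lt_self hε)
  rw [← sq_le_sq₀ (norm_nonneg _) (norm_nonneg _), sq, sq, ← CStarRing.norm_star_mul_self,
    ← CStarRing.norm_star_mul_self]
  refine CStarAlgebra.norm_le_norm_of_nonneg_of_le (star_mul_self_nonneg _) ?_
  rw [← sub_nonneg]
  convert star_mul_self_nonneg (CFC.sqrt (b - a) - CFC.sqrt (b - a) * (y * b)) using 1
  rw [hs ha, hs hb, hs (sub_nonneg.mpr hab)]
  noncomm_ring

lemma hereditary_hereditarySub : (hereditarySub c hc).Hereditary := by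
  intro b hb a ha hab
  have := closure_minimal (t := {v | star v * v ∈ hereditarySub c hc}) ?_
    ((isClosed_hereditarySub_s5 hc).preimage (by fun_prop)) (sqrt_mem_closure_mul ha hab)
  · simpa [(IsSelfAdjoint.of_nonneg (CFC.sqrt_nonneg a)).star_eq, CFC.sqrt_mul_sqrt_self a]
      using this
  · rintro _ ⟨y, rfl⟩
    simpa [mul_assoc] using mul_mul_mem_hereditarySub (star_mem hb) hb (star y * y)

lemma exists_countable_of_not_admitsCharacter (h : ¬ (hereditarySub c hc).AdmitsCharacter) :
    ∃ G : Set A, G.Countable ∧ (∀ x ∈ G, (c * x * c) * (c * x * c) = 0) ∧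
      c ∈ (NonUnitalStarAlgebra.adjoin ℂ {y : A | ∃ x ∈ G, y = c * x * c}).topologicalClosure := by
  set S : Set A := {y | ∃ x, y = c * x * c ∧ y * y = 0}
  obtain ⟨T, hTS, hT, hcT⟩ := exists_countable_subset_mem_topologicalClosure (S := S)
    (hereditarySub_le_of_not_admitsCharacter isClosed_closure
      (fun x hx ↦ NonUnitalStarSubalgebra.le_topologicalClosure _
        (NonUnitalStarAlgebra.subset_adjoin ℂ S ⟨x, rfl, hx⟩)) h (self_mem_hereditarySub_s5 hc))
  choose g hg hg' using fun y : T ↦ hTS y.2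
  have := hT.to_subtype
  refine ⟨Set.range g, Set.countable_range g, ?_, ?_⟩
  · rintro _ ⟨y, rfl⟩
    rw [← hg y, hg' y]
  · refine closure_mono (NonUnitalStarAlgebra.adjoin_mono fun y hy ↦ ?_) hcT
    exact ⟨_, ⟨⟨y, hy⟩, rfl⟩, hg ⟨y, hy⟩⟩

end Hereditary

section Representation

open scoped ComplexOrder

variable {A : Type*} [NonUnitalCStarAlgebra A] [PartialOrder A] [StarOrderedRing A]

lemma NonUnitalStarSubalgebra.Hereditary.mul_mul_mem {B : NonUnitalStarSubalgebra ℂ A}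
    (hB : B.Hereditary) {e : A} (he : IsSelfAdjoint e) (heB : e ∈ B) (x : A) : e * x * e ∈ B := by
  have hx : x ∈ Submodule.span ℂ {a : A | 0 ≤ a} := by simp [CStarAlgebra.span_nonneg]
  induction hx using Submodule.span_induction with
  | mem x hx =>
    have h1 := CStarAlgebra.star_left_conjugate_le_norm_smul (a := e) (b := x) (.of_nonneg hx)
    have h2 := star_left_conjugate_nonneg hx e
    rw [he.star_eq] at h1 h2
    refine hB (‖x‖ • (e * e)) ?_ _ h2 h1
    rw [← Complex.coe_smul]
    exact SMulMemClass.smul_mem _ (mul_mem heB heB)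
  | zero => simp
  | add x y _ _ hx hy => simpa [mul_add, add_mul] using add_mem hx hy
  | smul r x _ hx =>
    simpa [mul_smul_comm, smul_mul_assoc] using SMulMemClass.smul_mem r hx

lemma NonUnitalStarSubalgebra.map_nonneg_of_isClosed {B : NonUnitalStarSubalgebra ℂ A}
    (hB : IsClosed (B : Set A)) (φ : B →⋆ₙₐ[ℂ] ℂ) {k : B} (hk : 0 ≤ (k : A)) : 0 ≤ φ k := by
  have hs : CFC.sqrt (k : A) ∈ B := by
    rw [CFC.sqrt_eq_real_sqrt _ hk]
    exact cfcₙ_mem _ k.2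
  have : star (⟨_, hs⟩ : B) * ⟨_, hs⟩ = k := Subtype.ext <| by
    change star (CFC.sqrt (k : A)) * CFC.sqrt (k : A) = k
    rw [(IsSelfAdjoint.of_nonneg (CFC.sqrt_nonneg _)).star_eq, CFC.sqrt_mul_sqrt_self _ hk]
  rw [← this, map_mul, map_star]
  exact star_mul_self_nonneg _

lemma exists_representation_eq_rankOne {B : NonUnitalStarSubalgebra ℂ A}
    (hBcl : IsClosed (B : Set A)) (hB : B.Hereditary) {φ : B →⋆ₙₐ[ℂ] ℂ} (hφ : φ ≠ 0) :
    ∃ (ψ : A →ₚ[ℂ] ℂ) (e : A) (ξ : ψ.GNS), 0 ≤ e ∧ ‖ξ‖ = 1 ∧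
      ∀ v, ψ.gnsNonUnitalStarAlgHom e v = inner ℂ ξ v • ξ := by
  obtain ⟨b, hb⟩ : ∃ b, φ b ≠ 0 := by
    by_contra! h
    exact hφ (by ext b; exact h b)
  set s : B := (φ b)⁻¹ • b with hs
  have hφs : φ s = 1 := by rw [hs, map_smul, smul_eq_mul, inv_mul_cancel₀ hb]
  set e : B := star s * s with he
  have hφe : φ e = 1 := by rw [he, map_mul, map_star, hφs]; simp
  have he0 : 0 ≤ (e : A) := star_mul_self_nonneg (s : A)
  have hesa : IsSelfAdjoint (e : A) := .of_nonneg he0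
  have hmem (x : A) : (e : A) * x * e ∈ B := hB.mul_mul_mem hesa e.2 x
  let ψ : A →ₚ[ℂ] ℂ := PositiveLinearMap.mk₀
    { toFun := fun x ↦ φ ⟨e * x * e, hmem x⟩
      map_add' := fun x y ↦ by
        rw [← map_add]
        exact congrArg φ (Subtype.ext (by simp [mul_add, add_mul]))
      map_smul' := fun r x ↦ by
        rw [RingHom.id_apply, ← map_smul]
        exact congrArg φ (Subtype.ext (by simp [mul_smul_comm, smul_mul_assoc])) }
    fun x hx ↦ B.map_nonneg_of_isClosed hBcl φ (by
      simpa [hesa.star_eq] using star_left_conjugate_nonneg hx (e : A))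
  have hψ (x : A) {k : B} (hk : (k : A) = e * x * e) : ψ x = φ k :=
    congrArg φ (Subtype.ext hk.symm)
  refine ⟨ψ, e, ((ψ.toPreGNS e : ψ.PreGNS) : ψ.GNS), he0, ?_, fun v ↦ ?_⟩
  · rw [UniformSpace.Completion.norm_coe, ← sq_eq_sq₀ (norm_nonneg _) zero_le_one,
      ← Complex.ofReal_inj, Complex.ofReal_pow, ψ.preGNS_norm_sq,
      hψ _ (k := e * (star e * e) * e) (by simp)]
    simp [map_mul, map_star, hφe]
  · induction v using UniformSpace.Completion.induction_on with
    | hp => apply isClosed_eq <;> fun_prop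
    | ih x =>
      set y : A := ψ.ofPreGNS x
      set l : B := ⟨e * y * e, hmem y⟩ with hl
      have hinner : inner ℂ (ψ.toPreGNS e) x = φ l := by
        rw [ψ.preGNS_inner_def, ψ.ofPreGNS_toPreGNS,
          hψ _ (k := e * l) (by simp [hl, hesa.star_eq, mul_assoc, y]),
          map_mul, hφe, one_mul]
      rw [UniformSpace.Completion.inner_coe, hinner, ψ.gnsNonUnitalStarAlgHom_apply_coe,
        ← UniformSpace.Completion.coe_smul, ← sub_eq_zero, ← UniformSpace.Completion.coe_sub,
        ← norm_eq_zero, UniformSpace.Completion.norm_coe, ← sq_eq_zero_iff, ← Complex.ofReal_inj,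
        Complex.ofReal_pow, ψ.preGNS_norm_sq]
      set k : B := l - φ l • (e * e) with hk
      have hφk : φ k = 0 := by simp [hk, hφe]
      rw [hψ _ (k := star k * k) ?_, map_mul, hφk]
      · simp
      · change star ((e : A) * y * e - φ l • ((e : A) * e)) *
            ((e : A) * y * e - φ l • ((e : A) * e)) =
          (e : A) * (star ((e : A) * y - φ l • (e : A)) * ((e : A) * y - φ l • (e : A))) * e
        have : (e : A) * y * e - φ l • ((e : A) * e) = (e * y - φ l • (e : A)) * e := by
          rw [sub_mul, smul_mul_assoc]
        rw [this, star_mul, hesa.star_eq]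
        simp only [mul_assoc]

end Representation

section RankOne

variable {A : Type*} [NonUnitalCStarAlgebra A]

lemma norm_sub_cutdown_le [PartialOrder A] [StarOrderedRing A] {b : A} (hb : 0 ≤ b) :
    ‖b - cutdown b‖ ≤ 1 / 2 := by
  nth_rw 1 [← cfcₙ_id' ℝ b]
  rw [cutdown, ← cfcₙ_sub _ _ b]
  refine norm_cfcₙ_le fun t ht ↦ ?_
  have : 0 ≤ t := quasispectrum_nonneg_of_nonneg b hb t ht
  rw [Real.norm_eq_abs, abs_le]
  rcases le_total t (1 / 2) with h | h
  · rw [max_eq_right (by linarith)]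
    constructor <;> linarith
  · rw [max_eq_left (by linarith)]
    constructor <;> linarith

lemma cutdown_mul_mul_cutdown [PartialOrder A] [StarOrderedRing A] {b : A} (hb : 0 ≤ b) :
    cutdown b * b * cutdown b = (1 / 2 : ℝ) • (cutdown b * cutdown b) +
      cutdown b * cutdown b * cutdown b := by
  have hid : cfcₙ (fun t : ℝ ↦ t) b = b := cfcₙ_id' ℝ b
  set f : ℝ → ℝ := fun t ↦ max (t - 1 / 2) 0 with hf
  have hfc : Continuous f := by fun_prop
  have hf0 : f 0 = 0 := by norm_num [hf]
  change cfcₙ f b * b * cfcₙ f b = (1 / 2 : ℝ) • (cfcₙ f b * cfcₙ f b) +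
      cfcₙ f b * cfcₙ f b * cfcₙ f b
  have h1 : cfcₙ f b * b = cfcₙ (fun t ↦ f t * t) b := by
    rw [cfcₙ_mul f (fun t ↦ t) b, hid]
  rw [h1, ← cfcₙ_mul (fun t ↦ f t * t) f b, ← cfcₙ_mul f f b,
    ← cfcₙ_mul (fun t ↦ f t * f t) f b (by fun_prop) (by simp [hf0]),
    ← cfcₙ_smul _ _ b (by fun_prop) (by simp [hf0]),
    ← cfcₙ_add _ _ b (by fun_prop) (by simp [hf0]) (by fun_prop) (by simp [hf0])]
  refine cfcₙ_congr fun t _ ↦ ?_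
  rcases le_total t (1 / 2) with h | h
  · simp only [hf, max_eq_right (show t - 1 / 2 ≤ 0 by linarith), smul_eq_mul]
    ring
  · simp only [hf, max_eq_left (show 0 ≤ t - 1 / 2 by linarith), smul_eq_mul]
    ring

variable {H : Type*} [NormedAddCommGroup H] [InnerProductSpace ℂ H] [CompleteSpace H]
  (π : A →⋆ₙₐ[ℂ] (H →L[ℂ] H))

lemma inner_representation_apply (a : A) (v w : H) :
    inner ℂ (π a v) w = inner ℂ v (π (star a) w) := by
  rw [map_star, ContinuousLinearMap.star_eq_adjoint, ContinuousLinearMap.adjoint_inner_right]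

lemma admitsCharacter_of_representation_rankOne {c : A} {hc : IsSelfAdjoint c} {η w : H}
    (hη : ‖η‖ = 1) (hw : π c w = η) (h : ∀ v, ∃ r : ℂ, π c v = r • η) :
    (hereditarySub c hc).AdmitsCharacter := by
  have hηη : inner ℂ η η = (1 : ℂ) := by simp [inner_self_eq_norm_sq_to_K, hη]
  have hcont : Continuous π := AddMonoidHomClass.continuous_of_bound π 1 fun x ↦ by
    simpa using NonUnitalStarAlgHom.norm_apply_le π x
  have key {a : A} (ha : a ∈ hereditarySub c hc) : π a η = inner ℂ η (π a η) • η := by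
    refine closure_minimal (t := {a | π a η = inner ℂ η (π a η) • η}) ?_
      (isClosed_eq (by fun_prop) (by fun_prop)) ha
    rintro _ ⟨x, rfl⟩
    obtain ⟨r, hr⟩ := h (π x (π c η))
    have : π (c * x * c) η = r • η := by rw [← hr, map_mul, map_mul]; rfl
    change π (c * x * c) η = inner ℂ η (π (c * x * c) η) • η
    rw [this, inner_smul_right, hηη, mul_one]
  refine ⟨{ toFun := fun a ↦ inner ℂ η (π a η)
            map_smul' := fun r a ↦ by simp
            map_zero' := by simp
            map_add' := fun a b ↦ by simp
            map_mul' := fun a b ↦ by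
              change inner ℂ η (π ((a : A) * b) η) = _
              rw [map_mul, mul_apply_eq_comp, key b.2, map_smul, inner_smul_right,
                mul_comm, ← key b.2]
            map_star' := fun a ↦ by
              change inner ℂ η (π (star (a : A)) η) = _
              rw [← inner_representation_apply]
              simp }, fun h0 ↦ ?_⟩
  have h1 : inner ℂ η (π c η) = (0 : ℂ) := DFunLike.congr_fun h0 ⟨c, self_mem_hereditarySub_s5 hc⟩
  have h2 : π c η = 0 := by rw [key (self_mem_hereditarySub_s5 hc), h1, zero_smul]
  have h3 : inner ℂ η η = (0 : ℂ) := by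
    nth_rw 1 [← hw]
    rw [inner_representation_apply, hc.star_eq, h2, inner_zero_right]
  exact one_ne_zero (hηη.symm.trans h3)

variable [PartialOrder A] [StarOrderedRing A]

lemma admitsCharacter_cutdown_of_representation {e b : A} (hb : 0 ≤ b) {ξ : H} (hξ : ‖ξ‖ = 1)
    (he : ∀ v, π e v = inner ℂ ξ v • ξ) (heb : ‖e - b‖ < 1 / 2) :
    (hereditarySub (cutdown b) (cutdown_isSelfAdjoint b)).AdmitsCharacter := by
  set c := cutdown b with hcdef
  have hc : IsSelfAdjoint c := cutdown_isSelfAdjoint b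
  have hc0 : 0 ≤ c := cfcₙ_nonneg fun t _ ↦ le_max_right _ _
  have hπ (a : A) (v : H) : ‖π a v‖ ≤ ‖a‖ * ‖v‖ :=
    ((π a).le_opNorm v).trans (by gcongr; exact NonUnitalStarAlgHom.norm_apply_le π a)
  have horth (w : H) (hw : inner ℂ ξ (π c w) = (0 : ℂ)) : π c w = 0 := by
    set v := π c w with hv
    have h1 : inner ℂ v (π b v) =
        (1 / 2 : ℝ) * (‖v‖ : ℂ) ^ 2 + (‖π (CFC.sqrt c * c) w‖ : ℂ) ^ 2 := by
      have hs : star (CFC.sqrt c * c) * (CFC.sqrt c * c) = c * c * c := by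
        rw [star_mul, (IsSelfAdjoint.of_nonneg (CFC.sqrt_nonneg c)).star_eq, hc.star_eq,
          mul_assoc, ← mul_assoc (CFC.sqrt c), CFC.sqrt_mul_sqrt_self c, mul_assoc]
      have hn (u : H) : (‖u‖ : ℂ) ^ 2 = inner ℂ u u := (inner_self_eq_norm_sq_to_K u).symm
      rw [hn, hn, inner_representation_apply, hv, inner_representation_apply,
        inner_representation_apply, hc.star_eq]
      simp only [← mul_apply_eq_comp, ← map_mul]
      rw [hs, ← mul_assoc, cutdown_mul_mul_cutdown hb, ← Complex.coe_smul]
      simp [← hcdef]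
    have h2 : inner ℂ v (π b v) = - inner ℂ v (π (e - b) v) := by
      rw [map_sub, sub_apply, he, hw]
      simp
    have h3 : 1 / 2 * ‖v‖ ^ 2 ≤ ‖e - b‖ * ‖v‖ ^ 2 := by
      calc 1 / 2 * ‖v‖ ^ 2 ≤ 1 / 2 * ‖v‖ ^ 2 + ‖π (CFC.sqrt c * c) w‖ ^ 2 := by
            linarith [sq_nonneg ‖π (CFC.sqrt c * c) w‖]
        _ = (inner ℂ v (π b v) : ℂ).re := by rw [h1]; norm_cast
        _ ≤ ‖(inner ℂ v (π b v) : ℂ)‖ := Complex.re_le_norm _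
        _ ≤ ‖v‖ * ‖π (e - b) v‖ := by rw [h2, norm_neg]; exact norm_inner_le_norm _ _
        _ ≤ ‖v‖ * (‖e - b‖ * ‖v‖) := by gcongr; exact hπ _ _
        _ = _ := by ring
    rw [← norm_eq_zero, ← sq_eq_zero_iff]
    nlinarith [sq_nonneg ‖v‖]
  obtain ⟨w, hw⟩ : ∃ w, π c w ≠ 0 := by
    by_contra! h
    have h1 : ξ = π (b - c) ξ + π (e - b) ξ := by
      simp [h, he, hξ]
    have h2 := norm_add_le (π (b - c) ξ) (π (e - b) ξ)
    have h3 := hπ (b - c) ξ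
    have h4 := hπ (e - b) ξ
    have h5 := norm_sub_cutdown_le hb
    rw [← h1] at h2
    rw [hξ, mul_one] at h3 h4
    linarith
  have hξw : inner ℂ ξ (π c w) ≠ (0 : ℂ) := fun h ↦ hw (horth w h)
  refine admitsCharacter_of_representation_rankOne π (η := (‖π c w‖⁻¹ : ℂ) • π c w)
    (w := (‖π c w‖⁻¹ : ℂ) • w) ?_ (map_smul _ _ _) fun v ↦ ?_
  · rw [norm_smul]
    simp [hw]
  · have h0 : π c (v - (inner ℂ ξ (π c v) / inner ℂ ξ (π c w) : ℂ) • w) = 0 := by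
      refine horth _ ?_
      rw [map_sub, map_smul, inner_sub_right, inner_smul_right, div_mul_cancel₀ _ hξw, sub_self]
    rw [map_sub, map_smul, sub_eq_zero] at h0
    refine ⟨(inner ℂ ξ (π c v) / inner ℂ ξ (π c w)) * ‖π c w‖, h0.trans ?_⟩
    rw [smul_smul, mul_assoc, mul_inv_cancel₀ (by simpa using hw), mul_one]

end RankOne

end Auxiliary

section Cutdown

variable {A : Type*} [NonUnitalCStarAlgebra A] [PartialOrder A] [StarOrderedRing A]

theorem nowhereScattered_tfae (A : Type*) [NonUnitalCStarAlgebra A] [PartialOrder A]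
    [StarOrderedRing A] :
    List.TFAE
      [ NowhereScattered A,
        ∀ a : A, 0 ≤ a → ∃ b : A, 0 ≤ b ∧ ‖a - b‖ < 1 / 2 ∧
          ¬ (hereditarySub (cutdown b) (cutdown_isSelfAdjoint b)).AdmitsCharacter,
        ∀ a : A, 0 ≤ a → ∃ b : A, 0 ≤ b ∧ ‖a - b‖ < 1 / 2 ∧
          ∃ G : Set A, G.Countable ∧
            (∀ x ∈ G, (cutdown b * x * cutdown b) * (cutdown b * x * cutdown b) = 0) ∧
            cutdown b ∈ (NonUnitalStarAlgebra.adjoin ℂ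
              {y : A | ∃ x ∈ G, y = cutdown b * x * cutdown b}).topologicalClosure ] := by
  tfae_have 1 → 2 := fun h a ha ↦ ⟨a, ha, by simp, h _
    (isClosed_hereditarySub_s5 (cutdown_isSelfAdjoint a)) hereditary_hereditarySub⟩
  tfae_have 2 → 3 := fun h a ha ↦ by
    obtain ⟨b, hb, hab, hB⟩ := h a ha
    exact ⟨b, hb, hab, exists_countable_of_not_admitsCharacter hB⟩
  tfae_have 3 → 2 := fun h a ha ↦ by
    obtain ⟨b, hb, hab, G, -, hG, hbG⟩ := h a ha
    refine ⟨b, hb, hab, not_admitsCharacter_of_mem_topologicalClosure_adjoin_s5 ?_ ?_ hbG⟩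
    · rintro _ ⟨x, -, rfl⟩
      exact mul_mul_self_mem_hereditarySub (cutdown_isSelfAdjoint b) x
    · rintro _ ⟨x, hx, rfl⟩
      exact hG x hx
  tfae_have 2 → 1 := fun h B hBcl hB ⟨φ, hφ⟩ ↦ by
    obtain ⟨ψ, e, ξ, he0, hξ, he⟩ := exists_representation_eq_rankOne hBcl hB hφ
    obtain ⟨b, hb, heb, hchar⟩ := h e he0
    exact hchar (admitsCharacter_cutdown_of_representation ψ.gnsNonUnitalStarAlgHom hb hξ he heb)
  tfae_finish

end Cutdown
end

section
/- Let A be a C*-algebra and let B ⊆ A be a nowhere scattered sub-C*-algebra that separates the ideals of A, meaning that any two closed two-sided ideals I, J ⊆ A with I ∩ B = J ∩ B satisfy I = J. Then A is nowhere scattered. -/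
open scoped InnerProductSpace ComplexOrder CStarAlgebra

section CornerSubalgebra

variable {C H : Type*} [NonUnitalRing C] [Module ℂ C] [StarRing C]
  [NormedAddCommGroup H] [InnerProductSpace ℂ H] [CompleteSpace H]
  {π : C →⋆ₙₐ[ℂ] (H →L[ℂ] H)}

lemma inner_map_star_apply (x : C) (u v : H) : ⟪π (star x) u, v⟫_ℂ = ⟪u, π x v⟫_ℂ := by
  rw [map_star, ContinuousLinearMap.star_eq_adjoint, ContinuousLinearMap.adjoint_inner_left]

lemma map_star_mul_self_apply_eq_zero_iff (x : C) (u : H) :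
    π (star x * x) u = 0 ↔ π x u = 0 := by
  refine ⟨fun h ↦ ?_, fun h ↦ by simp [h]⟩
  rw [← inner_self_eq_zero (𝕜 := ℂ), ← inner_map_star_apply, ← mul_apply_eq_comp,
    ← map_mul, h, inner_zero_left]

lemma map_star_mul_self_eq_zero_iff (x : C) : π (star x * x) = 0 ↔ π x = 0 := by
  simp only [ContinuousLinearMap.ext_iff, zero_apply,
    map_star_mul_self_apply_eq_zero_iff]

/-- The elements whose image under a representation `π` is supported on the subspace `W`, that is,
vanishes on `Wᗮ` together with its adjoint. -/
def cornerSubalgebra [StarModule ℂ C] (π : C →⋆ₙₐ[ℂ] (H →L[ℂ] H)) (W : Submodule ℂ H) :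
    NonUnitalStarSubalgebra ℂ C where
  carrier := {x | ∀ u ∈ Wᗮ, π x u = 0 ∧ π (star x) u = 0}
  add_mem' {x y} hx hy u hu := by simp [hx u hu, hy u hu]
  zero_mem' u _ := by simp
  mul_mem' {x y} hx hy u hu := by simp [hx u hu, hy u hu]
  smul_mem' c x hx u hu := by simp [hx u hu]
  star_mem' {x} hx u hu := by simpa using (hx u hu).symm

variable [StarModule ℂ C] {W : Submodule ℂ H}

lemma mem_cornerSubalgebra {x : C} :
    x ∈ cornerSubalgebra π W ↔ ∀ u ∈ Wᗮ, π x u = 0 ∧ π (star x) u = 0 := Iff.rfl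

lemma cornerSubalgebra_isClosed [TopologicalSpace C] [ContinuousStar C] (hπ : Continuous π) :
    IsClosed (cornerSubalgebra π W : Set C) := by
  have : (cornerSubalgebra π W : Set C) =
      ⋂ u ∈ Wᗮ, {x | π x u = 0} ∩ {x | π (star x) u = 0} := by
    ext x
    simp [mem_cornerSubalgebra]
  rw [this]
  refine isClosed_biInter fun u _ ↦ IsClosed.inter ?_ ?_ <;>
  exact isClosed_eq (by fun_prop) continuous_const

lemma map_apply_mem_of_mem_cornerSubalgebra [W.HasOrthogonalProjection] {x : C}
    (hx : x ∈ cornerSubalgebra π W) (w : H) : π x w ∈ W := by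
  rw [← W.orthogonal_orthogonal, Submodule.mem_orthogonal]
  intro u hu
  rw [← inner_map_star_apply, (hx u hu).2, inner_zero_left]

lemma map_eq_zero_of_mem_cornerSubalgebra [W.HasOrthogonalProjection] {x : C}
    (hx : x ∈ cornerSubalgebra π W) (h : ∀ w ∈ W, π x w = 0) : π x = 0 := by
  ext v
  obtain ⟨w, hw, u, hu, rfl⟩ := W.exists_add_mem_mem_orthogonal v
  simp [h w hw, (hx u hu).1]

/-- If `W` has minimal dimension among the finite-dimensional subspaces supporting a nonzero
operator in the image of `π`, then the elements supported on `W` act on `W` as scalars. -/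
lemma cornerSubalgebra_admitsCharacter [PartialOrder C] [TopologicalSpace C]
    [FiniteDimensional ℂ W] {x₀ : C} (hx₀ : x₀ ∈ cornerSubalgebra π W) (hπ₀ : π x₀ ≠ 0)
    (hmin : ∀ V : Submodule ℂ H, FiniteDimensional ℂ V →
      Module.finrank ℂ V < Module.finrank ℂ W → ∀ x ∈ cornerSubalgebra π V, π x = 0) :
    (cornerSubalgebra π W).AdmitsCharacter := by
  have vanish (x : C) (hx : x ∈ cornerSubalgebra π W) (u : H) (hu : u ∈ W) (hu0 : u ≠ 0)
      (hxu : π x u = 0) : π x = 0 := by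
    rw [← map_star_mul_self_eq_zero_iff]
    have hlt : W ⊓ (ℂ ∙ u)ᗮ < W := by
      refine lt_of_le_of_ne inf_le_left fun h ↦ hu0 ?_
      have := (h.symm ▸ hu : u ∈ W ⊓ (ℂ ∙ u)ᗮ).2
      rwa [SetLike.mem_coe, Submodule.mem_orthogonal_singleton_iff_inner_right,
        inner_self_eq_zero] at this
    refine hmin (W ⊓ (ℂ ∙ u)ᗮ) inferInstance (Submodule.finrank_lt_finrank_of_lt hlt) _ ?_
    have key : ∀ v ∈ (W ⊓ (ℂ ∙ u)ᗮ)ᗮ, π (star x * x) v = 0 := by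
      intro v hv
      rw [map_star_mul_self_apply_eq_zero_iff]
      obtain ⟨w, hw, w', hw', rfl⟩ := W.exists_add_mem_mem_orthogonal v
      obtain ⟨y, hy, z, hz, rfl⟩ := (ℂ ∙ u).exists_add_mem_mem_orthogonal w
      have hyW : y ∈ W := (Submodule.span_singleton_le_iff_mem _ _).2 hu hy
      have hzW : z ∈ W := by simpa using W.sub_mem hw hyW
      have hz0 : z = 0 := by
        have h0 := hv z ⟨hzW, hz⟩
        have h1 : ⟪z, y⟫_ℂ = 0 := Submodule.inner_left_of_mem_orthogonal hy hz
        have h2 : ⟪z, w'⟫_ℂ = 0 := Submodule.inner_right_of_mem_orthogonal hzW hw'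
        rwa [inner_add_right, inner_add_right, h1, h2, zero_add, add_zero,
          inner_self_eq_zero] at h0
      obtain ⟨c, rfl⟩ := Submodule.mem_span_singleton.1 hy
      simp [hz0, hxu, (hx w' hw').1]
    exact fun v hv ↦ ⟨key v hv, by simpa using key v hv⟩
  have hW : W ≠ ⊥ := by
    rintro rfl
    exact hπ₀ (map_eq_zero_of_mem_cornerSubalgebra hx₀ (by simp))
  have : Nontrivial W := Submodule.nontrivial_iff_ne_bot.2 hW
  have scalar (x : C) (hx : x ∈ cornerSubalgebra π W) : ∃ μ : ℂ, ∀ w ∈ W, π x w = μ • w := by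
    let T : Module.End ℂ W :=
      (π x : H →ₗ[ℂ] H).restrict fun w _ ↦ map_apply_mem_of_mem_cornerSubalgebra hx w
    obtain ⟨μ, hμ⟩ := Module.End.exists_eigenvalue T
    obtain ⟨v, hv⟩ := hμ.exists_hasEigenvector
    have hv' : π x v = μ • (v : H) := congrArg Subtype.val hv.apply_eq_smul
    have hv0 : (v : H) ≠ 0 := by simpa using hv.2
    have hzero : π (x * x - μ • x) = 0 :=
      vanish _ (sub_mem (mul_mem hx hx) (SMulMemClass.smul_mem μ hx)) v v.2 hv0 (by simp [hv'])
    refine ⟨μ, fun w hw ↦ ?_⟩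
    by_contra hne
    have hu : π x w - μ • w ∈ W :=
      W.sub_mem (map_apply_mem_of_mem_cornerSubalgebra hx w) (W.smul_mem μ hw)
    have hx0 : π x = 0 := vanish x hx _ hu (sub_ne_zero.2 hne) (by simpa using congr($hzero w))
    have hμ0 : μ = 0 := by simpa [hx0, hv0, eq_comm] using hv'
    simp [hx0, hμ0] at hne
  choose χ hχ using scalar
  obtain ⟨w, hw0⟩ := exists_ne (0 : W)
  have hw0' : (w : H) ≠ 0 := by simpa using hw0
  have eq_of (x : C) (hx) (c : ℂ) (h : π x w = c • (w : H)) : χ x hx = c :=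
    smul_left_injective ℂ hw0' ((hχ x hx w w.2).symm.trans h)
  let φ : cornerSubalgebra π W →⋆ₙₐ[ℂ] ℂ :=
    { toFun := fun x ↦ χ x x.2
      map_smul' := fun c x ↦ eq_of _ _ _ (by simp [hχ x x.2, smul_smul])
      map_zero' := eq_of _ _ _ (by simp)
      map_add' := fun x y ↦ eq_of _ _ _ (by simp [hχ x x.2, hχ y y.2, add_smul])
      map_mul' := fun x y ↦ eq_of _ _ _ (by
        simp [hχ x x.2, hχ y y.2, smul_smul, mul_comm])
      map_star' := fun x ↦ by
        have h := inner_map_star_apply (π := π) (x : C) (w : H) w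
        rw [hχ x x.2 w w.2, hχ _ (star_mem x.2) w w.2, inner_smul_left, inner_smul_right] at h
        have h' := mul_right_cancel₀ (inner_self_ne_zero.2 hw0') h
        simpa using congr(star $h') }
  refine ⟨φ, fun h ↦ hπ₀ (map_eq_zero_of_mem_cornerSubalgebra hx₀ fun v hv ↦ ?_)⟩
  have : χ x₀ hx₀ = 0 := congr($h ⟨x₀, hx₀⟩)
  rw [hχ x₀ hx₀ v hv, this, zero_smul]

end CornerSubalgebra

lemma cornerSubalgebra_hereditary {A H : Type*} [NonUnitalCStarAlgebra A] [PartialOrder A]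
    [StarOrderedRing A] [NormedAddCommGroup H] [InnerProductSpace ℂ H] [CompleteSpace H]
    (π : A →⋆ₙₐ[ℂ] (H →L[ℂ] H)) (W : Submodule ℂ H) : (cornerSubalgebra π W).Hereditary := by
  intro b hb a ha hab
  obtain ⟨y, rfl⟩ := CStarAlgebra.nonneg_iff_eq_star_mul_self.1 ha
  obtain ⟨z, hz⟩ := CStarAlgebra.nonneg_iff_eq_star_mul_self.1 (sub_nonneg.2 hab)
  rw [sub_eq_iff_eq_add] at hz
  have key : ∀ u ∈ Wᗮ, π (star y * y) u = 0 := by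
    intro u hu
    rw [map_star_mul_self_apply_eq_zero_iff]
    have h : ⟪u, π b u⟫_ℂ = 0 := by rw [(hb u hu).1, inner_zero_right]
    have hsq (x : A) : ⟪u, π (star x * x) u⟫_ℂ = ((‖π x u‖ ^ 2 : ℝ) : ℂ) := by
      rw [map_mul, mul_apply_eq_comp, ← inner_map_star_apply, star_star,
        inner_self_eq_norm_sq_to_K]
      simp
    rw [hz, map_add, add_apply, inner_add_right, hsq, hsq] at h
    norm_cast at h
    have : ‖π y u‖ ^ 2 = 0 := by nlinarith [sq_nonneg ‖π y u‖, sq_nonneg ‖π z u‖]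
    simpa using this
  exact fun u hu ↦ ⟨key u hu, by simpa using key u hu⟩

section HereditaryCharacter

variable {A : Type*} [NonUnitalCStarAlgebra A] [PartialOrder A] [StarOrderedRing A]
  {D : NonUnitalStarSubalgebra ℂ A}

lemma NonUnitalStarSubalgebra.Hereditary.star_mul_mul_mem (hD : D.Hereditary) {d : A}
    (hd : d ∈ D) (a : A) : star d * a * d ∈ D := by
  have ha : a ∈ Submodule.span ℂ {a : A | 0 ≤ a} := by simp [CStarAlgebra.span_nonneg]
  induction ha using Submodule.span_induction with
  | mem a ha =>
    refine hD _ ?_ _ (star_left_conjugate_nonneg ha d)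
      (CStarAlgebra.star_left_conjugate_le_norm_smul (.of_nonneg ha))
    rw [← Complex.coe_smul]
    exact SMulMemClass.smul_mem (_ : ℂ) (mul_mem (star_mem hd) hd)
  | zero => simp
  | add x y _ _ hx hy => simpa [mul_add, add_mul] using add_mem hx hy
  | smul c x _ hx => simpa [mul_smul_comm, smul_mul_assoc] using SMulMemClass.smul_mem c hx

lemma NonUnitalStarSubalgebra.character_nonneg (hDc : IsClosed (D : Set A)) (φ : D →⋆ₙₐ[ℂ] ℂ)
    {x : D} (hx : 0 ≤ (x : A)) : 0 ≤ φ x := by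
  have hs : CFC.sqrt (x : A) ∈ D := by
    rw [CFC.sqrt_eq_real_sqrt (x : A) hx]
    exact cfcₙ_mem (𝕜' := ℂ) (hs := hDc) _ x.2
  have hsa : IsSelfAdjoint (CFC.sqrt (x : A)) := .of_nonneg (CFC.sqrt_nonneg _)
  have : x = star ⟨_, hs⟩ * ⟨_, hs⟩ := Subtype.ext <| by
    simp [hsa.star_eq, CFC.sqrt_mul_sqrt_self (x : A) hx]
  rw [this, map_mul, map_star]
  exact star_mul_self_nonneg _

/-- A character on a hereditary subalgebra yields a representation whose image contains a nonzero
compact operator. -/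
lemma exists_gns_isCompactOperator (hDc : IsClosed (D : Set A)) (hD : D.Hereditary)
    (hφ : D.AdmitsCharacter) :
    ∃ (f : A →ₚ[ℂ] ℂ) (d : A), f.gnsNonUnitalStarAlgHom d ≠ 0 ∧
      IsCompactOperator (f.gnsNonUnitalStarAlgHom d) := by
  obtain ⟨φ, hφ⟩ := hφ
  obtain ⟨x, hx⟩ := DFunLike.ne_iff.1 hφ
  replace hx : φ x ≠ 0 := hx
  obtain ⟨d, hdsa, hd⟩ : ∃ d : D, star d = d ∧ φ d = 1 := by
    refine ⟨((‖φ x‖ ^ 2)⁻¹ : ℂ) • (star x * x), by simp, ?_⟩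
    rw [map_smul, map_mul, map_star, smul_eq_mul, Complex.star_def, Complex.conj_mul']
    exact inv_mul_cancel₀ (by simpa using hx)
  have hdsa' : star (d : A) = d := congrArg Subtype.val hdsa
  have hmem (a : A) : (d : A) * a * d ∈ D := by
    have := hD.star_mul_mul_mem d.2 a
    rwa [hdsa'] at this
  let f : A →ₚ[ℂ] ℂ := PositiveLinearMap.mk₀
    { toFun := fun a ↦ φ ⟨d * a * d, hmem a⟩
      map_add' := fun a b ↦ by
        rw [← map_add]
        congr 1
        exact Subtype.ext (by simp [mul_add, add_mul])
      map_smul' := fun c a ↦ by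
        rw [RingHom.id_apply, ← map_smul]
        congr 1
        exact Subtype.ext (by simp [mul_smul_comm, smul_mul_assoc]) }
    (fun a ha ↦ NonUnitalStarSubalgebra.character_nonneg hDc φ (by
      simpa only [hdsa'] using star_left_conjugate_nonneg ha (d : A)))
  have hf (a : A) : f a = φ ⟨d * a * d, hmem a⟩ := rfl
  have hfz (z : A) (hz : z * d ∈ D) : f (star z * z) = star (φ ⟨z * d, hz⟩) * φ ⟨z * d, hz⟩ := by
    rw [hf, ← map_star, ← map_mul]
    congr 1
    refine Subtype.ext ?_
    simp [mul_assoc, hdsa']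
  let ξ : f.PreGNS := f.toPreGNS d
  have hξ : ‖(ξ : f.GNS)‖ = 1 := by
    rw [UniformSpace.Completion.norm_coe, f.preGNS_norm_def, f.ofPreGNS_toPreGNS,
      hfz _ (mul_mem d.2 d.2)]
    have : (⟨d * d, mul_mem d.2 d.2⟩ : D) = d * d := rfl
    simp [this, hd]
  have hrank (a : f.PreGNS) :
      f.gnsNonUnitalStarAlgHom d (a : f.GNS) = f (f.ofPreGNS a) • (ξ : f.GNS) := by
    rw [f.gnsNonUnitalStarAlgHom_apply_coe, ← UniformSpace.Completion.coe_smul, ← sub_eq_zero,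
      ← UniformSpace.Completion.coe_sub, ← norm_eq_zero, UniformSpace.Completion.norm_coe,
      f.preGNS_norm_def]
    set c := f (f.ofPreGNS a) with hc
    have hz : f.ofPreGNS (f.leftMulMapPreGNS d a - c • ξ) = d * f.ofPreGNS a - c • (d : A) := rfl
    have hzd : (d * f.ofPreGNS a - c • (d : A)) * d ∈ D := by
      rw [sub_mul, smul_mul_assoc]
      exact sub_mem (hmem _) (SMulMemClass.smul_mem c (mul_mem d.2 d.2))
    have : (⟨_, hzd⟩ : D) = ⟨d * f.ofPreGNS a * d, hmem _⟩ - c • (d * d) :=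
      Subtype.ext (by simp [sub_mul, smul_mul_assoc])
    rw [hz, hfz _ hzd, this, map_sub, map_smul, map_mul, hd, ← hf, ← hc]
    simp
  refine ⟨f, d, fun h ↦ ?_, ?_⟩
  · have hd3 : f d = 1 := by
      rw [hf]
      have : (⟨d * d * d, hmem d⟩ : D) = d * d * d := rfl
      simp [this, hd]
    have := hrank ξ
    rw [f.ofPreGNS_toPreGNS, hd3, one_smul, h] at this
    rw [← this, zero_apply, norm_zero] at hξ
    exact zero_ne_one hξ
  · have hrange (v : f.GNS) : f.gnsNonUnitalStarAlgHom d v ∈ (ℂ ∙ (ξ : f.GNS)) := by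
      induction v using UniformSpace.Completion.induction_on with
      | hp =>
        exact (Submodule.closed_of_finiteDimensional _).preimage
          (f.gnsNonUnitalStarAlgHom d).continuous
      | ih a =>
        rw [hrank]
        exact Submodule.smul_mem _ _ (Submodule.mem_span_singleton_self _)
    let T := (f.gnsNonUnitalStarAlgHom (d : A)).codRestrict _ hrange
    exact ((isCompactOperator_id_iff_finiteDimensional (𝕜 := ℂ)).2 inferInstance
      |>.comp_clm T).clm_comp (ℂ ∙ (ξ : f.GNS)).subtypeL

end HereditaryCharacter

section Ideals

variable {A H : Type*} [NonUnitalCStarAlgebra A] [NormedAddCommGroup H] [InnerProductSpace ℂ H]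
  [CompleteSpace H] (π : A →⋆ₙₐ[ℂ] (H →L[ℂ] H))

/-- The ideal of elements represented by compact operators. -/
def compactIdeal : TwoSidedIdeal A :=
  .mk' {x | IsCompactOperator (π x)}
    (by simpa using isCompactOperator_zero)
    (fun {x y} hx hy ↦ by simpa using hx.add hy)
    (fun {x} hx ↦ by simpa using hx.neg)
    (fun {x y} hy ↦ by simpa using hy.clm_comp (π x))
    (fun {x y} hx ↦ by simpa using hx.comp_clm (π y))

lemma mem_compactIdeal {x : A} : x ∈ compactIdeal π ↔ IsCompactOperator (π x) :=
  TwoSidedIdeal.mem_mk' ..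

lemma compactIdeal_isClosed : IsClosed (compactIdeal π : Set A) := by
  rw [compactIdeal, TwoSidedIdeal.coe_mk']
  exact isClosed_setOfPred_isCompactOperator.preimage (map_continuous π)

lemma ker_isClosed : IsClosed (TwoSidedIdeal.ker π : Set A) := by
  have : (TwoSidedIdeal.ker π : Set A) = π ⁻¹' {0} := by
    ext
    simp [TwoSidedIdeal.mem_ker]
  rw [this]
  exact isClosed_singleton.preimage (map_continuous π)

/-- If a selfadjoint element acts as a nonzero compact operator, then its functional calculus
contains an element acting as a nonzero operator of finite rank. -/
lemma exists_mem_cornerSubalgebra_of_isCompactOperator {b : A} (hb : IsSelfAdjoint b)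
    (hπb : π b ≠ 0) (hc : IsCompactOperator (π b)) :
    ∃ (g : ℝ → ℝ) (W : Submodule ℂ H), FiniteDimensional ℂ W ∧
      cfcₙ g b ∈ cornerSubalgebra π W ∧ π (cfcₙ g b) ≠ 0 := by
  obtain ⟨ε, hε, hεb⟩ : ∃ ε, 0 < ε ∧ ε < ‖π b‖ := exists_between (norm_pos_iff.2 hπb)
  let clamp : ℝ → ℝ := fun t ↦ max (-ε) (min ε t)
  let k : ℝ → ℝ := fun t ↦ t / max (t ^ 2) (ε ^ 2)
  have hclamp : Continuous clamp := by fun_prop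
  have hclamp0 : clamp 0 = 0 := by simp [clamp, hε.le]
  have hk : Continuous k := by
    refine continuous_id.div (by fun_prop) fun t ↦ ?_
    positivity
  have hk0 : k 0 = 0 := by simp [k]
  have hmul (t : ℝ) : t * k t * (t - clamp t) = t - clamp t := by
    by_cases ht : |t| ≤ ε
    · have : clamp t = t := by
        simp [clamp, (abs_le.1 ht).1, (abs_le.1 ht).2]
      simp [this]
    · have h2 : ε ^ 2 < t ^ 2 := by
        rw [← sq_abs t]
        exact pow_lt_pow_left₀ (not_le.1 ht) hε.le two_ne_zero
      have : t ≠ 0 := by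
        rintro rfl
        simp [hε.le] at ht
      have : t * k t = 1 := by
        simp only [k, max_eq_left h2.le]
        field_simp
      rw [this, one_mul]
  set g : ℝ → ℝ := fun t ↦ t - clamp t with hg
  have hgc : Continuous g := by fun_prop
  have hg0 : g 0 = 0 := by simp [g, hclamp0]
  set c := cfcₙ g b with hcdef
  have hcsa : IsSelfAdjoint c := cfcₙ_predicate g b
  have hbk : b * cfcₙ k b * c = c := by
    have h : b * cfcₙ k b = cfcₙ (fun t ↦ t * k t) b := by
      rw [cfcₙ_mul (fun t ↦ t) k b (by fun_prop) rfl (by fun_prop) hk0, cfcₙ_id' ℝ b]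
    rw [h, hcdef, ← cfcₙ_mul _ g b (by fun_prop) (by simp) (by fun_prop) hg0]
    exact cfcₙ_congr fun t _ ↦ hmul t
  let W := Module.End.eigenspace (π (b * cfcₙ k b) : H →ₗ[ℂ] H) 1
  have hW : FiniteDimensional ℂ W := by
    refine ContinuousLinearMap.finite_dimensional_eigenspace ?_ 1 one_ne_zero
    simpa using hc.comp_clm (π (cfcₙ k b))
  have hrange (v : H) : π c v ∈ W := by
    rw [Module.End.mem_eigenspace_iff, one_smul]
    simpa using congr(π $hbk v)
  refine ⟨g, W, hW, ?_, fun h0 ↦ ?_⟩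
  · have key : ∀ u ∈ Wᗮ, π c u = 0 := fun u hu ↦ by
      rw [← inner_self_eq_zero (𝕜 := ℂ)]
      nth_rw 1 [← hcsa.star_eq]
      rw [inner_map_star_apply]
      exact Submodule.inner_left_of_mem_orthogonal (hrange _) hu
    exact fun u hu ↦ ⟨key u hu, by rw [hcsa.star_eq]; exact key u hu⟩
  · have h1 : b - c = cfcₙ clamp b := by
      rw [hcdef, hg, cfcₙ_sub (fun t ↦ t) clamp b (by fun_prop) rfl (by fun_prop) hclamp0,
        cfcₙ_id' ℝ b, sub_sub_cancel]
    have h2 : ‖cfcₙ clamp b‖ ≤ ε := norm_cfcₙ_le fun t _ ↦ by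
      simp only [clamp, Real.norm_eq_abs, abs_le]
      exact ⟨le_max_left _ _, max_le (by linarith) (min_le_left _ _)⟩
    have h3 : ‖π (b - c)‖ ≤ ‖b - c‖ := NonUnitalStarAlgHom.norm_apply_le π _
    rw [map_sub, h0, sub_zero, h1] at h3
    linarith

end Ideals

theorem nowhereScattered_of_separatesIdeals {A : Type*} [NonUnitalCStarAlgebra A]
    [PartialOrder A] [StarOrderedRing A] (B : NonUnitalStarSubalgebra ℂ A)
    (hBclosed : IsClosed (B : Set A)) (hBns : NowhereScattered B)
    (hsep : ∀ I J : TwoSidedIdeal A, IsClosed (I : Set A) → IsClosed (J : Set A) →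
      (I : Set A) ∩ (B : Set A) = (J : Set A) ∩ (B : Set A) → I = J) :
    NowhereScattered A := by
  intro D hDc hD hφ
  obtain ⟨f, d, hd0, hdc⟩ := exists_gns_isCompactOperator hDc hD hφ
  set π := f.gnsNonUnitalStarAlgHom
  obtain ⟨x, hxB, hxc, hx0⟩ : ∃ x ∈ B, IsCompactOperator (π x) ∧ π x ≠ 0 := by
    by_contra! hcon
    have hker := hsep (compactIdeal π) (.ker π) (compactIdeal_isClosed π) (ker_isClosed π) <| by
      ext x
      simp only [Set.mem_inter_iff, SetLike.mem_coe, mem_compactIdeal, TwoSidedIdeal.mem_ker,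
        and_congr_left_iff]
      exact fun hx ↦ ⟨hcon x hx, fun h ↦ by simpa [h] using isCompactOperator_zero⟩
    exact hd0 ((TwoSidedIdeal.mem_ker π).1 (hker ▸ (mem_compactIdeal π).2 hdc))
  obtain ⟨g, W₀, hW₀, hmem, hne⟩ := exists_mem_cornerSubalgebra_of_isCompactOperator π
    (IsSelfAdjoint.star_mul_self x) ((map_star_mul_self_eq_zero_iff x).not.2 hx0)
    (by simpa using hxc.clm_comp (π (star x)))
  have hcB : cfcₙ g (star x * x) ∈ B :=
    cfcₙ_mem (𝕜' := ℂ) (hs := hBclosed) _ (mul_mem (star_mem hxB) hxB)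
  let ρ : B →⋆ₙₐ[ℂ] (f.GNS →L[ℂ] f.GNS) := π.comp (NonUnitalStarSubalgebraClass.subtype B)
  let P : ℕ → Prop := fun n ↦ ∃ W : Submodule ℂ f.GNS, FiniteDimensional ℂ W ∧
    Module.finrank ℂ W = n ∧ ∃ x ∈ cornerSubalgebra ρ W, ρ x ≠ 0
  have hP : ∃ n, P n := ⟨_, W₀, hW₀, rfl, ⟨_, hcB⟩, hmem, hne⟩
  classical
  obtain ⟨W, hW, hWn, x₀, hx₀, hx₀'⟩ := Nat.find_spec hP
  refine hBns (cornerSubalgebra ρ W) ?_ ?_ (cornerSubalgebra_admitsCharacter hx₀ hx₀' ?_)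
  · exact cornerSubalgebra_isClosed ((map_continuous π).comp continuous_subtype_val)
  · exact fun b hb a ha hab ↦ cornerSubalgebra_hereditary π W b hb a ha hab
  · intro V hV hlt x hx
    by_contra hx0
    exact Nat.find_min hP (hWn ▸ hlt) ⟨V, hV, rfl, x, hx, hx0⟩
end

section
/- Let A be a C*-algebra and let (A_λ)_{λ∈Λ} be a family of nowhere scattered sub-C*-algebras of A that approximates A, meaning that for every finite subset {a₁,…,aₙ} ⊆ A and every ε > 0 there exist λ ∈ Λ and b₁,…,bₙ ∈ A_λ with ‖a_k − b_k‖ < ε for k = 1,…,n. Then A is nowhere scattered. -/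
open scoped ComplexOrder InnerProductSpace

/-- The compression of a character `φ` on a hereditary subalgebra by a positive element `b` with
`φ b = 1` is a positive functional on the whole algebra. -/
lemma NonUnitalStarSubalgebra.Hereditary.exists_positiveLinearMap {A : Type*}
    [NonUnitalCStarAlgebra A] [PartialOrder A] [StarOrderedRing A]
    {B : NonUnitalStarSubalgebra ℂ A} (hB : B.Hereditary) (hchar : B.AdmitsCharacter) :
    ∃ (f : A →ₚ[ℂ] ℂ) (b : A), 0 ≤ b ∧ f (b * b) = 1 ∧ (∀ x, f (x * b) = f x) ∧
      (∀ x, f (b * x) = f x) ∧ ∀ x y, f (x * (b * b) * y) = f x * f y := by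
  obtain ⟨φ, hφ⟩ := hchar
  obtain ⟨x, hx⟩ : ∃ x, φ x ≠ 0 := by
    by_contra! h
    exact hφ (NonUnitalStarAlgHom.ext h)
  obtain ⟨b, hb0, hb1⟩ : ∃ b : B, 0 ≤ (b : A) ∧ φ b = 1 := by
    have hr : φ (star x * x) = ((‖φ x‖ ^ 2 : ℝ) : ℂ) := by
      rw [map_mul, map_star, Complex.star_def, ← Complex.normSq_eq_conj_mul_self,
        Complex.normSq_eq_norm_sq]
    refine ⟨(((‖φ x‖ ^ 2)⁻¹ : ℝ) : ℂ) • (star x * x), ?_, ?_⟩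
    · have h := smul_nonneg (by positivity : (0 : ℝ) ≤ (‖φ x‖ ^ 2)⁻¹)
        (star_mul_self_nonneg (x : A))
      simpa [← Complex.coe_smul] using h
    · rw [map_smul, hr, smul_eq_mul, ← Complex.ofReal_mul, inv_mul_cancel₀ (by simpa using hx),
        Complex.ofReal_one]
  have hbs : star (b : A) = b := hb0.star_eq
  have hle (a : A) (ha : 0 ≤ a) : b * a * b ≤ ((‖a‖ : ℂ) • b * b : A) := by
    have h := CStarAlgebra.star_left_conjugate_le_norm_smul (a := (b : A)) (b := a)
      ha.isSelfAdjoint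
    rwa [hbs, ← Complex.coe_smul, ← smul_mul_assoc] at h
  have hpos (a : A) (ha : 0 ≤ a) : 0 ≤ (b * a * b : A) := by
    simpa [hbs] using star_left_conjugate_nonneg ha (b : A)
  have hmem_nonneg (a : A) (ha : 0 ≤ a) : b * a * b ∈ B :=
    hB _ (mul_mem (SMulMemClass.smul_mem _ b.2) b.2) _ (hpos a ha) (hle a ha)
  have hmem (a : A) : b * a * b ∈ B := by
    have ha : a ∈ Submodule.span ℂ {y : A | 0 ≤ y} := by
      rw [CStarAlgebra.span_nonneg]; trivial
    induction ha using Submodule.span_induction with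
    | mem y hy => exact hmem_nonneg y hy
    | zero => simp
    | add y z _ _ hy hz => simpa [mul_add, add_mul] using B.add_mem hy hz
    | smul r y _ hy => 
      simpa [mul_smul_comm, smul_mul_assoc] using SMulMemClass.smul_mem (s := B) r hy
  have hφ_pos (a : A) (ha : 0 ≤ a) : 0 ≤ φ ⟨b * a * b, hmem a⟩ := by
    have hs : CFC.sqrt (b * a * b : A) ∈ B := by
      refine hB ((Real.sqrt ‖a‖ : ℂ) • b) (SMulMemClass.smul_mem _ b.2) _ (CFC.sqrt_nonneg _) ?_
      have hb' : 0 ≤ ((Real.sqrt ‖a‖ : ℂ) • b : A) := by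
        rw [Complex.coe_smul]; exact smul_nonneg (Real.sqrt_nonneg _) hb0
      rw [← CFC.sqrt_mul_self ((Real.sqrt ‖a‖ : ℂ) • b : A) hb']
      refine CFC.sqrt_le_sqrt _ _ ((hle a ha).trans_eq ?_)
      rw [smul_mul_smul_comm, ← Complex.ofReal_mul, Real.mul_self_sqrt (norm_nonneg _),
        smul_mul_assoc]
    have key : (⟨b * a * b, hmem a⟩ : B) = star ⟨_, hs⟩ * ⟨_, hs⟩ := by
      ext
      simp [(CFC.sqrt_nonneg (b * a * b : A)).star_eq, CFC.sqrt_mul_sqrt_self _ (hpos a ha)]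
    rw [key, map_mul, map_star]
    exact star_mul_self_nonneg _
  let f₀ : A →ₗ[ℂ] ℂ :=
    { toFun a := φ ⟨b * a * b, hmem a⟩
      map_add' x y := by
        rw [← map_add]; congr 1; ext; simp [mul_add, add_mul]
      map_smul' r x := by
        rw [RingHom.id_apply, ← map_smul]; congr 1; ext; simp [mul_smul_comm, smul_mul_assoc] }
  have hf (a : A) (y : B) (h : (b * a * b : A) = y) : f₀ a = φ y := by
    change φ ⟨b * a * b, hmem a⟩ = φ y
    congr 1; ext; exact h
  refine ⟨.mk₀ f₀ hφ_pos, b, hb0, ?_, fun x ↦ ?_, fun x ↦ ?_, fun x y ↦ ?_⟩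
  · exact (hf _ (b * (b * b) * b) (by simp)).trans (by simp [hb1])
  · exact (hf _ (⟨b * x * b, hmem x⟩ * b) (by simp [mul_assoc])).trans
      (by rw [map_mul, hb1, mul_one]; rfl)
  · exact (hf _ (b * ⟨b * x * b, hmem x⟩) (by simp [mul_assoc])).trans
      (by rw [map_mul, hb1, one_mul]; rfl)
  · exact (hf _ (⟨b * x * b, hmem x⟩ * ⟨b * y * b, hmem y⟩) (by simp [mul_assoc])).trans
      (by rw [map_mul]; rfl)

/-- If `f (x * b² * y) = f x * f y`, then `b²` acts as a rank-one projection in the GNS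
representation of `f`. -/
lemma PositiveLinearMap.exists_gns_eq_inner_smul {A : Type*} [NonUnitalCStarAlgebra A]
    [PartialOrder A] [StarOrderedRing A] (f : A →ₚ[ℂ] ℂ) {b : A} (hb : 0 ≤ b)
    (hone : f (b * b) = 1) (hr : ∀ x, f (x * b) = f x) (hl : ∀ x, f (b * x) = f x)
    (hmul : ∀ x y, f (x * (b * b) * y) = f x * f y) :
    ∃ ξ : f.GNS, ‖ξ‖ = 1 ∧ ∀ v, f.gnsNonUnitalStarAlgHom (b * b) v = ⟪ξ, v⟫_ℂ • ξ := by
  have hpre (y : f.PreGNS) : f.leftMulMapPreGNS (b * b) y -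
      ⟪f.toPreGNS b, y⟫_ℂ • f.toPreGNS b ∈ {z : f.PreGNS | ‖z‖ = 0} := by
    obtain ⟨y, rfl⟩ := f.toPreGNS.surjective y
    have hinner : ⟪f.toPreGNS b, f.toPreGNS y⟫_ℂ = f y := by
      simp [f.preGNS_inner_def, hb.star_eq, hl]
    have hz : f.leftMulMapPreGNS (b * b) (f.toPreGNS y) - f y • f.toPreGNS b =
        f.toPreGNS (b * b * y - f y • b) := by
      simp [mul_assoc]
    rw [Set.mem_ofPred_eq, hinner, hz, f.preGNS_norm_def, f.ofPreGNS_toPreGNS]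
    have h1 : f (star y * (b * b) * (b * b * y)) = star (f y) * f y := by
      rw [hmul, map_star, mul_assoc, hl, hl]
    have h2 : f (star y * (b * b) * b) = star (f y) := by
      rw [hr, ← mul_assoc, hr, hr, map_star]
    have h3 : f (b * (b * b * y)) = f y := by rw [hl, mul_assoc, hl, hl]
    have h0 : f (star (b * b * y - f y • b) * (b * b * y - f y • b)) = 0 := by
      have : star (b * b * y - f y • b) * (b * b * y - f y • b) =
          star y * (b * b) * (b * b * y) - f y • (star y * (b * b) * b) -
            star (f y) • (b * (b * b * y)) + (star (f y) * f y) • (b * b) := by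
        simp only [star_sub, star_mul, star_smul, hb.star_eq, sub_mul, mul_sub, smul_mul_assoc,
          mul_smul_comm, mul_smul]
        rw [smul_sub, smul_comm (f y)]
        abel
      rw [this]
      simp only [map_add, map_sub, map_smul, h1, h2, h3, hone, smul_eq_mul]
      ring
    rw [h0]; simp
  refine ⟨(f.toPreGNS b : f.PreGNS), ?_, fun v ↦ ?_⟩
  · rw [UniformSpace.Completion.norm_coe, f.preGNS_norm_def]
    simp [hb.star_eq, hone]
  · induction v using UniformSpace.Completion.induction_on with
    | hp => apply isClosed_eq <;> fun_prop
    | ih y =>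
      rw [f.gnsNonUnitalStarAlgHom_apply_coe, UniformSpace.Completion.inner_coe,
        ← UniformSpace.Completion.coe_smul, ← sub_eq_zero, ← UniformSpace.Completion.coe_sub,
        ← norm_eq_zero, UniformSpace.Completion.norm_coe]
      exact hpre y

section Representation

variable {A : Type*} [NonUnitalCStarAlgebra A] {H : Type*}
  [NormedAddCommGroup H] [InnerProductSpace ℂ H] [CompleteSpace H]
  (π : A →⋆ₙₐ[ℂ] (H →L[ℂ] H))

lemma NonUnitalStarAlgHom.inner_apply_left_s8 (x : A) (u v : H) :
    ⟪π x u, v⟫_ℂ = ⟪u, π (star x) v⟫_ℂ := by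
  rw [map_star, ContinuousLinearMap.star_eq_adjoint, ContinuousLinearMap.adjoint_inner_right]

lemma NonUnitalStarAlgHom.inner_star_mul_self_apply (s : A) (v : H) :
    ⟪v, π (star s * s) v⟫_ℂ = (‖π s v‖ ^ 2 : ℝ) := by
  rw [map_mul, mul_apply_eq_comp, ← π.inner_apply_left_s8, inner_self_eq_norm_sq_to_K]
  simp

/-- The elements which a representation sends to multiples of the rank-one projection onto the
span of a unit vector. -/
def NonUnitalStarAlgHom.rankOneSubalgebra (η : H) (hη : ‖η‖ = 1) :
    NonUnitalStarSubalgebra ℂ A where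
  carrier := {x | ∀ v, π x v = (⟪η, π x η⟫_ℂ * ⟪η, v⟫_ℂ) • η}
  add_mem' {x y} hx hy v := by
    rw [map_add, _root_.add_apply, _root_.add_apply, inner_add_right,
      add_mul, add_smul, ← hx, ← hy]
  zero_mem' v := by simp
  smul_mem' r x hx v := by
    rw [map_smul, _root_.smul_apply, _root_.smul_apply,
      inner_smul_right, mul_assoc, mul_smul, ← hx]
  mul_mem' {x y} hx hy v := by
    have h1 : ⟪η, η⟫_ℂ = 1 := inner_self_eq_one_of_norm_eq_one hη
    rw [map_mul, mul_apply_eq_comp, mul_apply_eq_comp, hx (π y v),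
      hx (π y η), hy v]
    simp only [inner_smul_right, h1, mul_one, mul_assoc]
  star_mem' {x} hx v := by
    refine ext_inner_left ℂ fun u ↦ ?_
    have h : ⟪η, π (star x) η⟫_ℂ = starRingEnd ℂ ⟪η, π x η⟫_ℂ := by
      rw [← π.inner_apply_left_s8, inner_conj_symm]
    rw [← π.inner_apply_left_s8, hx u, inner_smul_left, inner_smul_right, h, map_mul,
      inner_conj_symm, inner_conj_symm]
    ring

variable {π} in
lemma NonUnitalStarAlgHom.mem_rankOneSubalgebra {η : H} {hη : ‖η‖ = 1} {x : A} :
    x ∈ π.rankOneSubalgebra η hη ↔ ∀ v, π x v = (⟪η, π x η⟫_ℂ * ⟪η, v⟫_ℂ) • η :=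
  Iff.rfl

lemma NonUnitalStarAlgHom.isClosed_rankOneSubalgebra (η : H) (hη : ‖η‖ = 1) :
    IsClosed (π.rankOneSubalgebra η hη : Set A) := by
  have hπ : Continuous π :=
    AddMonoidHomClass.continuous_of_bound π 1 fun x ↦ by
      simpa using NonUnitalStarAlgHom.norm_apply_le π x
  have : (π.rankOneSubalgebra η hη : Set A) =
      ⋂ v, {x | π x v = (⟪η, π x η⟫_ℂ * ⟪η, v⟫_ℂ) • η} := by
    ext x; simp [mem_rankOneSubalgebra]
  rw [this]
  exact isClosed_iInter fun v ↦ isClosed_eq (by fun_prop) (by fun_prop)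

variable [PartialOrder A] [StarOrderedRing A]

lemma NonUnitalStarAlgHom.inner_apply_nonneg {x : A} (hx : 0 ≤ x) (v : H) :
    0 ≤ ⟪v, π x v⟫_ℂ := by
  obtain ⟨s, rfl⟩ := CStarAlgebra.nonneg_iff_eq_star_mul_self.mp hx
  rw [π.inner_star_mul_self_apply]
  exact Complex.zero_le_real.mpr (sq_nonneg _)

lemma NonUnitalStarAlgHom.apply_eq_zero_of_inner_eq_zero {x : A} (hx : 0 ≤ x) {v : H}
    (h : ⟪v, π x v⟫_ℂ = 0) : π x v = 0 := by
  obtain ⟨s, rfl⟩ := CStarAlgebra.nonneg_iff_eq_star_mul_self.mp hx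
  rw [π.inner_star_mul_self_apply] at h
  have hs : π s v = 0 := by simpa using h
  rw [map_mul, mul_apply_eq_comp, hs, map_zero]

variable {π}

lemma NonUnitalStarAlgHom.hereditary_rankOneSubalgebra (η : H) (hη : ‖η‖ = 1) :
    (π.rankOneSubalgebra η hη).Hereditary := by
  intro x hx y hy hyx
  have h1 : ⟪η, η⟫_ℂ = 1 := inner_self_eq_one_of_norm_eq_one hη
  have hker (v : H) (hv : ⟪η, v⟫_ℂ = 0) : π y v = 0 := by
    refine π.apply_eq_zero_of_inner_eq_zero hy (le_antisymm ?_ (π.inner_apply_nonneg hy v))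
    have hxv : π x v = 0 := by rw [hx v, hv, mul_zero, zero_smul]
    have h := π.inner_apply_nonneg (sub_nonneg.mpr hyx) v
    simpa [hxv] using h
  have horth (w : H) : ⟪η, w - ⟪η, w⟫_ℂ • η⟫_ℂ = 0 := by
    rw [inner_sub_right, inner_smul_right, h1, mul_one, sub_self]
  have hη' : π y η = ⟪η, π y η⟫_ℂ • η := by
    rw [← sub_eq_zero, ← inner_self_eq_zero (𝕜 := ℂ)]
    set w := π y η - ⟪η, π y η⟫_ℂ • η with hw
    have hwη : ⟪η, w⟫_ℂ = 0 := horth _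
    have h2 : ⟪π y η, w⟫_ℂ = 0 := by
      rw [π.inner_apply_left_s8, hy.star_eq, hker w hwη, inner_zero_right]
    nth_rewrite 1 [hw]
    rw [inner_sub_left, h2, inner_smul_left, hwη, mul_zero, sub_zero]
  intro v
  have hv := hker _ (horth v)
  rw [map_sub, map_smul, sub_eq_zero] at hv
  rw [hv, hη', smul_smul, inner_smul_right, h1, mul_one, mul_comm]

/-- A subalgebra containing an element that acts as a nonzero multiple of a rank-one projection
in some representation of the ambient algebra is not nowhere scattered. -/
lemma not_nowhereScattered_of_mem_rankOneSubalgebra {C : NonUnitalStarSubalgebra ℂ A} {η : H}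
    (hη : ‖η‖ = 1) {a : A} (haC : a ∈ C) (ha : a ∈ π.rankOneSubalgebra η hη) (ha0 : π a ≠ 0) :
    ¬ NowhereScattered C := by
  intro hC
  let D : NonUnitalStarSubalgebra ℂ C :=
    (π.rankOneSubalgebra η hη).comap (NonUnitalStarSubalgebraClass.subtype C)
  have hD (x : D) (v : H) : π x v = (⟪η, π x η⟫_ℂ * ⟪η, v⟫_ℂ) • η := x.2 v
  have h1 : ⟪η, η⟫_ℂ = 1 := inner_self_eq_one_of_norm_eq_one hη
  refine hC D ?_ ?_ ?_
  · exact (π.isClosed_rankOneSubalgebra η hη).preimage continuous_subtype_val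
  · exact fun x hx y hy hyx ↦ π.hereditary_rankOneSubalgebra η hη x hx y hy hyx
  · let ψ : D →⋆ₙₐ[ℂ] ℂ :=
      { toFun x := ⟪η, π x η⟫_ℂ
        map_smul' r x := by simp
        map_zero' := by simp
        map_add' x y := by simp
        map_mul' x y := by
          change ⟪η, π ((x : A) * (y : A)) η⟫_ℂ = _
          rw [map_mul, mul_apply_eq_comp, hD x, hD y]
          simp only [inner_smul_right, h1, mul_one]
        map_star' x := by
          change ⟪η, π (star (x : A)) η⟫_ℂ = _
          rw [← π.inner_apply_left_s8, ← inner_conj_symm]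
          rfl }
    refine ⟨ψ, fun h ↦ ha0 ?_⟩
    have h0 : ⟪η, π a η⟫_ℂ = 0 := DFunLike.congr_fun h ⟨⟨a, haC⟩, ha⟩
    ext v
    rw [ha v, h0, zero_mul, zero_smul, _root_.zero_apply]

/-- A self-adjoint element whose image is close to a rank-one projection admits a function
of it whose image is a nonzero multiple of a rank-one projection. -/
lemma NonUnitalStarAlgHom.exists_cfcₙ_mem_rankOneSubalgebra {ξ : H} (hξ : ‖ξ‖ = 1) {c e : A}
    (he : ∀ v, π e v = ⟪ξ, v⟫_ℂ • ξ) (hc : IsSelfAdjoint c) (hce : ‖c - e‖ ≤ 1 / 10) :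
    ∃ (η : H) (hη : ‖η‖ = 1), cfcₙ (fun t : ℝ ↦ max (t - 1 / 2) 0) c ∈
      π.rankOneSubalgebra η hη ∧ π (cfcₙ (fun t : ℝ ↦ max (t - 1 / 2) 0) c) ≠ 0 := by
  set a := cfcₙ (fun t : ℝ ↦ max (t - 1 / 2) 0) c
  have ha_star : star a = a := (cfcₙ_predicate _ c : IsSelfAdjoint a).star_eq
  have hc_id : cfcₙ (fun t : ℝ ↦ t) c = c := cfcₙ_id' ℝ c
  have hlower : 0 ≤ a * c * a - (1 / 2 : ℝ) • (a * a) := by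
    have : a * c * a - (1 / 2 : ℝ) • (a * a) =
        cfcₙ (fun t : ℝ ↦ max (t - 1 / 2) 0 * t * max (t - 1 / 2) 0 -
          (1 / 2 : ℝ) • (max (t - 1 / 2) 0 * max (t - 1 / 2) 0)) c := by
      rw [cfcₙ_sub _ _ c (by fun_prop) (by simp) (by fun_prop) (by simp),
        cfcₙ_mul _ _ c (by fun_prop) (by simp) (by fun_prop) (by simp),
        cfcₙ_mul _ _ c (by fun_prop) (by simp) (by fun_prop) (by simp),
        cfcₙ_smul _ _ c (by fun_prop) (by simp),
        cfcₙ_mul _ _ c (by fun_prop) (by simp) (by fun_prop) (by simp), hc_id]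
    rw [this]
    refine cfcₙ_nonneg fun t _ ↦ ?_
    rcases max_cases (t - 1 / 2) 0 with ⟨h, h'⟩ | ⟨h, h'⟩
    · rw [h, smul_eq_mul]
      nlinarith [pow_nonneg h' 3]
    · simp only [h, mul_zero, smul_zero, sub_zero, le_refl]
  have hupper : 0 ≤ c * a * c - (c * c * c - (1 / 2 : ℝ) • (c * c)) := by
    have : c * a * c - (c * c * c - (1 / 2 : ℝ) • (c * c)) =
        cfcₙ (fun t : ℝ ↦ t * max (t - 1 / 2) 0 * t - (t * t * t - (1 / 2 : ℝ) • (t * t))) c := by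
      rw [cfcₙ_sub _ _ c (by fun_prop) (by simp) (by fun_prop) (by simp),
        cfcₙ_sub _ _ c (by fun_prop) (by simp) (by fun_prop) (by simp),
        cfcₙ_mul _ _ c (by fun_prop) (by simp) (by fun_prop) (by simp),
        cfcₙ_mul _ _ c (by fun_prop) (by simp) (by fun_prop) (by simp),
        cfcₙ_smul _ _ c (by fun_prop) (by simp),
        cfcₙ_mul _ _ c (by fun_prop) (by simp) (by fun_prop) (by simp),
        cfcₙ_mul _ _ c (by fun_prop) (by simp) (by fun_prop) (by simp), hc_id]
    rw [this]
    refine cfcₙ_nonneg fun t _ ↦ ?_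
    rw [smul_eq_mul]
    nlinarith [mul_nonneg (sub_nonneg.mpr (le_max_left (t - 1 / 2) 0)) (mul_self_nonneg t)]
  have hsub (v : H) : ‖π c v - ⟪ξ, v⟫_ℂ • ξ‖ ≤ 1 / 10 * ‖v‖ := by
    have h := (π (c - e)).le_opNorm v
    rw [map_sub, _root_.sub_apply, he] at h
    refine h.trans (mul_le_mul_of_nonneg_right ?_ (norm_nonneg v))
    rw [← map_sub]
    exact (NonUnitalStarAlgHom.norm_apply_le π _).trans hce
  have hinner (v : H) : |(⟪v, π c v⟫_ℂ).re - ‖⟪ξ, v⟫_ℂ‖ ^ 2| ≤ 1 / 10 * ‖v‖ ^ 2 := by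
    have h1 : (⟪v, π c v - ⟪ξ, v⟫_ℂ • ξ⟫_ℂ).re = (⟪v, π c v⟫_ℂ).re - ‖⟪ξ, v⟫_ℂ‖ ^ 2 := by
      rw [inner_sub_right, inner_smul_right, Complex.sub_re, ← inner_conj_symm v ξ,
        Complex.mul_conj, Complex.normSq_eq_norm_sq, Complex.ofReal_re]
    rw [← h1]
    calc _ ≤ ‖⟪v, π c v - ⟪ξ, v⟫_ℂ • ξ⟫_ℂ‖ := Complex.abs_re_le_norm _
      _ ≤ ‖v‖ * ‖π c v - ⟪ξ, v⟫_ℂ • ξ‖ := norm_inner_le_norm _ _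
      _ ≤ ‖v‖ * (1 / 10 * ‖v‖) := mul_le_mul_of_nonneg_left (hsub v) (norm_nonneg v)
      _ = _ := by ring
  have hre (r : ℝ) (x : A) (v w : H) : (⟪v, π (r • x) w⟫_ℂ).re = r * (⟪v, π x w⟫_ℂ).re := by
    rw [← Complex.coe_smul, map_smul, _root_.smul_apply, inner_smul_right,
      Complex.re_ofReal_mul]
  have hrange (u : H) (hu : ⟪ξ, π a u⟫_ℂ = 0) : π a u = 0 := by
    have h := (Complex.nonneg_iff.mp (π.inner_apply_nonneg hlower u)).1
    have h2 : (⟪u, π (a * c * a) u⟫_ℂ).re = (⟪π a u, π c (π a u)⟫_ℂ).re := by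
      rw [π.inner_apply_left_s8, ha_star]; simp [mul_assoc]
    have h3 : (⟪u, π (a * a) u⟫_ℂ).re = ‖π a u‖ ^ 2 := by
      nth_rewrite 1 [← ha_star]
      rw [π.inner_star_mul_self_apply, Complex.ofReal_re]
    rw [map_sub, _root_.sub_apply, inner_sub_right, Complex.sub_re, hre, h2, h3] at h
    have h4 := (abs_le.mp (hinner (π a u))).2
    rw [hu] at h4
    simp only [norm_zero] at h4
    have : ‖π a u‖ ^ 2 = 0 := by nlinarith [sq_nonneg ‖π a u‖]
    simpa using this
  have ha0 : π a ≠ 0 := by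
    intro h0
    have h := (Complex.nonneg_iff.mp (π.inner_apply_nonneg hupper ξ)).1
    have h1 : π (c * a * c) = 0 := by simp [h0]
    have h2 : (⟪ξ, π (c * c * c) ξ⟫_ℂ).re = (⟪π c ξ, π c (π c ξ)⟫_ℂ).re := by
      rw [π.inner_apply_left_s8, hc.star_eq]; simp [mul_assoc]
    have h3 : (⟪ξ, π (c * c) ξ⟫_ℂ).re = ‖π c ξ‖ ^ 2 := by
      nth_rewrite 1 [← hc.star_eq]
      rw [π.inner_star_mul_self_apply, Complex.ofReal_re]
    rw [map_sub, map_sub, h1, zero_sub, _root_.neg_apply,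
      _root_.sub_apply, inner_neg_right, inner_sub_right, Complex.neg_re,
      Complex.sub_re, hre, h2, h3] at h
    have h4 := (abs_le.mp (hinner (π c ξ))).1
    have h5 := (abs_le.mp (hinner ξ)).1
    have h6 := hsub ξ
    have h7 : ⟪ξ, ξ⟫_ℂ = 1 := inner_self_eq_one_of_norm_eq_one hξ
    rw [h7, one_smul, hξ] at h6
    rw [h7, hξ, norm_one] at h5
    have h8 : (⟪ξ, π c ξ⟫_ℂ).re ≤ ‖⟪ξ, π c ξ⟫_ℂ‖ := Complex.re_le_norm _
    have h9 : ‖π c ξ‖ ≤ 11 / 10 := by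
      have := norm_le_norm_add_norm_sub' (π c ξ) ξ
      rw [hξ] at this
      linarith
    have h10 : 9 / 10 ≤ ‖⟪ξ, π c ξ⟫_ℂ‖ := by linarith
    nlinarith [norm_nonneg (π c ξ)]
  obtain ⟨u₀, hu₀⟩ : ∃ u, π a u ≠ 0 := by
    by_contra! h
    exact ha0 (ContinuousLinearMap.ext h)
  have hw : ⟪ξ, π a u₀⟫_ℂ ≠ 0 := fun h ↦ hu₀ (hrange u₀ h)
  have hnorm : ‖π a u₀‖ ≠ 0 := norm_ne_zero_iff.mpr hu₀
  set η : H := ((‖π a u₀‖⁻¹ : ℝ) : ℂ) • π a u₀ with hη_def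
  have hη : ‖η‖ = 1 := by
    rw [hη_def, norm_smul]
    simp [hnorm]
  have hspan (u : H) : ∃ r : ℂ, π a u = r • η := by
    refine ⟨⟪ξ, π a u⟫_ℂ / ⟪ξ, π a u₀⟫_ℂ * ‖π a u₀‖, ?_⟩
    have h := hrange (u - (⟪ξ, π a u⟫_ℂ / ⟪ξ, π a u₀⟫_ℂ) • u₀) (by
      rw [map_sub, map_smul, inner_sub_right, inner_smul_right, div_mul_cancel₀ _ hw, sub_self])
    rw [map_sub, map_smul, sub_eq_zero] at h
    rw [hη_def, smul_smul, mul_assoc, ← Complex.ofReal_mul, mul_inv_cancel₀ hnorm,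
      Complex.ofReal_one, mul_one]
    exact h
  have h1 : ⟪η, η⟫_ℂ = 1 := inner_self_eq_one_of_norm_eq_one hη
  have hcoeff (u : H) : π a u = ⟪η, π a u⟫_ℂ • η := by
    obtain ⟨r, hr⟩ := hspan u
    rw [hr, inner_smul_right, h1, mul_one]
  refine ⟨η, hη, fun v ↦ ?_, ha0⟩
  have h2 : ⟪η, π a v⟫_ℂ = ⟪η, π a η⟫_ℂ * ⟪η, v⟫_ℂ := by
    have h3 : ⟪η, π a v⟫_ℂ = ⟪π a η, v⟫_ℂ := by rw [π.inner_apply_left_s8, ha_star]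
    rw [h3, hcoeff η, inner_smul_left, inner_conj_symm, π.inner_apply_left_s8, ha_star,
      inner_smul_right, h1, mul_one]
  rw [hcoeff v, h2]

end Representation

theorem nowhereScattered_of_approximating {A : Type*} [NonUnitalCStarAlgebra A]
    [PartialOrder A] [StarOrderedRing A] {Λ : Type*}
    (𝒜 : Λ → NonUnitalStarSubalgebra ℂ A)
    (hclosed : ∀ l, IsClosed (𝒜 l : Set A))
    (hns : ∀ l, NowhereScattered (𝒜 l))
    (happrox : ∀ (n : ℕ) (a : Fin n → A) (ε : ℝ), 0 < ε →
      ∃ l, ∃ b : Fin n → A, (∀ k, b k ∈ 𝒜 l) ∧ ∀ k, ‖a k - b k‖ < ε) :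
    NowhereScattered A := by
  intro B _ hB hchar
  obtain ⟨f, b, hb, hone, hr, hl, hmul⟩ := hB.exists_positiveLinearMap hchar
  obtain ⟨ξ, hξ, he⟩ := f.exists_gns_eq_inner_smul hb hone hr hl hmul
  obtain ⟨l, c, hcl, hc⟩ := happrox 1 (fun _ ↦ b * b) (1 / 10) (by norm_num)
  set d : A := (1 / 2 : ℂ) • (c 0 + star (c 0)) with hd
  have hd_mem : d ∈ 𝒜 l :=
    SMulMemClass.smul_mem _ (add_mem (hcl 0) (star_mem (hcl 0)))
  have hd_sa : IsSelfAdjoint d := by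
    rw [isSelfAdjoint_iff, hd, star_smul, star_add, star_star, add_comm]
    simp
  have hd_near : ‖d - b * b‖ ≤ 1 / 10 := by
    have h1 : d - b * b = (1 / 2 : ℂ) • (-(b * b - c 0) + -star (b * b - c 0)) := by
      have h2 : b * b = (1 / 2 : ℂ) • (b * b + b * b) := by
        rw [← two_smul ℂ (b * b), smul_smul]; norm_num
      rw [hd, star_sub, star_mul, hb.star_eq]
      nth_rewrite 1 [h2]
      rw [← smul_sub]
      congr 1
      abel
    have h3 := norm_add_le (-(b * b - c 0)) (-star (b * b - c 0))
    rw [norm_neg, norm_neg, norm_star] at h3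
    rw [h1, norm_smul]
    have h4 := hc 0
    have h5 : ‖(1 / 2 : ℂ)‖ = 1 / 2 := by simp
    rw [h5]
    linarith
  obtain ⟨η, hη, ha, ha0⟩ :=
    NonUnitalStarAlgHom.exists_cfcₙ_mem_rankOneSubalgebra hξ he hd_sa hd_near
  have ha_mem : cfcₙ (fun t : ℝ ↦ max (t - 1 / 2) 0) d ∈ 𝒜 l :=
    have := hclosed l
    cfcₙ_mem (𝕜' := ℂ) _ hd_mem
  exact not_nowhereScattered_of_mem_rankOneSubalgebra hη ha_mem ha ha0 (hns l)
end
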